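/- (Cassidy, random Schreier graphs) Fix r ≥ 1. For each N, let σ_1^N,…,σ_r^N be independent uniformly distributed random permutations of {1,…,N}, and let k_N be integers with 1 ≤ k_N ≤ N^{1/21}. Let [N]_k denote the set of k-tuples of distinct elements of {1,…,N}, on which S_N acts elementwise: σ(x_1,…,x_k) = (σ(x_1),…,σ(x_k)). Define the operator A^{N,k_N} on ℓ²([N]_{k_N}) by (A^{N,k_N} f)(x̃) = Σ_{i=1}^r [ f(σ_i^N(x̃)) + f((σ_i^N)⁻¹(x̃)) ]. Then ‖A^{N,k_N}|_{1⊥}‖ converges in probability to 2·√(2r−1) as N → ∞, where 1⊥ is the subspace of functions f on [N]_{k_N} with Σ_{x̃} f(x̃) = 0. -/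

import Mathlib

/-!
Statement 7 (Cassidy, random Schreier graphs): for i.i.d. uniform random permutations
`σ₁,…,σ_r` of `{1,…,N}` and `1 ≤ k_N ≤ N^{1/21}`, the adjacency operator of the Schreier graph
of the action of `S_N` on `k_N`-tuples of distinct elements (modelled as embeddings
`Fin k_N ↪ Fin N`), defined by `(A f)(x̃) = ∑ᵢ [f(σᵢ(x̃)) + f(σᵢ⁻¹(x̃))]`, satisfies
`‖A|_{1⊥}‖ → 2√(2r−1)` in probability as `N → ∞`.

Uniform probabilities over the finite set of tuples of permutations are expressed by counting.
-/

noncomputable section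

/-- The operator norm of (the restriction of) a complex matrix on the orthogonal complement of
the all-ones vector: the supremum of `‖Av‖₂ / ‖v‖₂` over nonzero `v` with `∑ i, v i = 0`. -/
def restNormC {n : Type*} [Fintype n] [DecidableEq n] (A : Matrix n n ℂ) : ℝ :=
  sSup {c : ℝ | ∃ v : EuclideanSpace ℂ n, v ≠ 0 ∧ (∑ i, v i) = 0 ∧
    c = ‖Matrix.toEuclideanLin A v‖ / ‖v‖}

/-- The matrix (on `ℓ²` of the set of `k`-tuples of distinct elements of `{1,…,N}`, i.e. of
embeddings `Fin k ↪ Fin N`) whose action is `(M f)(x̃) = f(τ(x̃))`, where `τ` acts on tuples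
elementwise. -/
def actMat {N k : ℕ} (τ : Equiv.Perm (Fin N)) :
    Matrix (Fin k ↪ Fin N) (Fin k ↪ Fin N) ℂ :=
  Matrix.of fun x y => if y = x.trans τ.toEmbedding then 1 else 0

section

open Finset

theorem prod_sq_sub_sq_of_lt (i : ℕ) (hi : 1 ≤ i) :
    (∏ l ∈ Ico 1 i, ((i:ℝ)^2 - (l:ℝ)^2)) * (2 * i^2) = (2 * i).factorial := by
  have h1 : ∀ a : ℕ, 1 ≤ a → a ≤ i →
      (∏ l ∈ Ico 1 a, ((i:ℝ)^2 - (l:ℝ)^2)) * (i - a).factorial * i = (i + a - 1).factorial := by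
    intro a ha
    induction a, ha using Nat.le_induction with
    | base =>
      intro _
      simp only [Ico_self, prod_empty, one_mul, Nat.add_sub_cancel]
      rw [mul_comm]
      exact_mod_cast Nat.mul_factorial_pred (by omega)
    | succ a ha ih =>
      intro hai
      have ih := ih (by omega)
      rw [prod_Ico_succ_top (by omega), show i + (a+1) - 1 = (i + a - 1) + 1 by omega, Nat.factorial_succ]
      push_cast
      rw [← ih, show i - a = (i - (a+1)) + 1 by omega, Nat.factorial_succ]
      push_cast [Nat.cast_sub hai, Nat.cast_sub (show 1 ≤ i + a by omega)]
      ring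
  have := h1 i hi le_rfl
  rw [Nat.sub_self, Nat.factorial_zero] at this
  rw [← Nat.mul_factorial_pred (show 2 * i ≠ 0 by omega), show 2 * i - 1 = i + i - 1 by omega]
  push_cast
  rw [← this]
  push_cast
  ring

theorem factorial_sq_le (d i : ℕ) (h : i ≤ d) :
    d.factorial ^ 2 ≤ (d - i).factorial * (d + i).factorial := by
  have h1 := Nat.factorial_mul_descFactorial h
  have h2 := Nat.factorial_mul_ascFactorial d i
  have h3 : d.descFactorial i ≤ (d+1).ascFactorial i :=
    (Nat.descFactorial_le_pow d i).trans ((Nat.pow_le_pow_left (by omega) i).trans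
      (Nat.pow_succ_le_ascFactorial (d+1) i))
  calc d.factorial ^ 2 = ((d-i).factorial * d.descFactorial i) * d.factorial := by rw [h1]; ring
    _ ≤ (d-i).factorial * (d+1).ascFactorial i * d.factorial := by gcongr
    _ = _ := by rw [← h2]; ring

theorem prod_node_le_aux (i d : ℕ) (hi : 1 ≤ i) (hd : i ≤ d) :
    (∏ l ∈ (Icc 1 d).erase i, ((l:ℝ)^2 / |(l:ℝ)^2 - (i:ℝ)^2|)) =
      2 * (d.factorial:ℝ)^2 / ((d - i).factorial * (d + i).factorial) := by
  induction d, hd using Nat.le_induction with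
  | base =>
    have : (Icc 1 i).erase i = Ico 1 i := by ext x; simp only [mem_erase, mem_Icc, mem_Ico]; omega
    rw [this, prod_div_distrib]
    have e1 : ∏ l ∈ Ico 1 i, |(l:ℝ)^2 - (i:ℝ)^2| = ∏ l ∈ Ico 1 i, ((i:ℝ)^2 - (l:ℝ)^2) := by
      refine prod_congr rfl fun l hl => ?_
      rw [abs_sub_comm, abs_of_nonneg]
      have : (l:ℝ) ≤ i := by exact_mod_cast (mem_Ico.1 hl).2.le
      nlinarith [(Nat.cast_nonneg l : (0:ℝ) ≤ l)]
    have e2 := prod_sq_sub_sq_of_lt i hi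
    have e3 : (∏ l ∈ Ico 1 i, (l:ℝ)^2) * i^2 = (i.factorial:ℝ)^2 := by
      rw [Finset.prod_pow, ← mul_pow]
      congr 1
      obtain ⟨i, rfl⟩ : ∃ k, i = k + 1 := ⟨i-1, by omega⟩
      rw [← Nat.cast_prod, Finset.prod_Ico_id_eq_factorial, Nat.factorial_succ]
      push_cast; ring
    have hi0 : (i:ℝ) ≠ 0 := by positivity
    have hp : (∏ l ∈ Ico 1 i, ((i:ℝ)^2 - (l:ℝ)^2)) ≠ 0 := by
      intro h; rw [h, zero_mul] at e2
      exact (Nat.cast_ne_zero.2 (Nat.factorial_ne_zero _)) e2.symm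
    rw [e1, ← e3, Nat.sub_self, Nat.factorial_zero, ← two_mul, ← e2]
    field_simp
    push_cast
    ring
  | succ d hd ih =>
    have : (Icc 1 (d+1)).erase i = insert (d+1) ((Icc 1 d).erase i) := by ext; simp; omega
    rw [this, prod_insert (by simp), ih]
    have : |((d+1:ℕ):ℝ)^2 - (i:ℝ)^2| = ((d:ℝ)+1-i)*(d+1+i) := by
      rw [abs_of_nonneg]
      · push_cast; ring
      · have : (i:ℝ) ≤ (d:ℝ) := by exact_mod_cast hd
        push_cast
        nlinarith [(Nat.cast_nonneg i : (0:ℝ) ≤ i)]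
    rw [this, show d + 1 - i = (d - i) + 1 by omega, show d + 1 + i = (d+i)+1 by omega,
      Nat.factorial_succ, Nat.factorial_succ, Nat.factorial_succ]
    push_cast [Nat.cast_sub hd]
    have h1 : ((d:ℝ) - i + 1) ≠ 0 := by
      have : (i:ℝ) ≤ (d:ℝ) := by exact_mod_cast hd
      linarith
    have h1' : ((d:ℝ) +1 - i) ≠ 0 := by
      have : (i:ℝ) ≤ (d:ℝ) := by exact_mod_cast hd
      linarith
    field_simp
    ring

theorem prod_node_le (i d : ℕ) (hi : 1 ≤ i) (hd : i ≤ d) :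
    (∏ l ∈ (Icc 1 d).erase i, ((l:ℝ)^2 / |(l:ℝ)^2 - (i:ℝ)^2|)) ≤ 2 := by
  rw [prod_node_le_aux i d hi hd, div_le_iff₀ (by positivity)]
  have := factorial_sq_le d i hd
  have h : (d.factorial:ℝ)^2 ≤ (d - i).factorial * (d + i).factorial := by exact_mod_cast this
  linarith

/-- interpolation nodes -/
def nodeM (d i : ℕ) : ℕ := 2 * d^4 / i^2

theorem nodeM_le (d i : ℕ) : nodeM d i ≤ 2 * d^4 := Nat.div_le_self _ _

theorem le_nodeM (d i : ℕ) (hi : 1 ≤ i) (hd : i ≤ d) : 2 * d^2 ≤ nodeM d i := by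
  unfold nodeM
  rw [Nat.le_div_iff_mul_le (by positivity)]
  calc 2 * d^2 * i^2 ≤ 2 * d^2 * d^2 := by gcongr
    _ = _ := by ring

theorem node_sep (d i l : ℕ) (hi : i ∈ Icc 1 d) (hl : l ∈ Icc 1 d) (h : l ≠ i) :
    0 < |(nodeM d i:ℝ) - nodeM d l| ∧
    (nodeM d i : ℝ) / |(nodeM d i:ℝ) - nodeM d l| ≤
      (l:ℝ)^2 / |(l:ℝ)^2 - (i:ℝ)^2| * (1 - 1/(2*(d:ℝ)))⁻¹ := by
  rw [mem_Icc] at hi hl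
  have hi1 : (1:ℝ) ≤ i := by exact_mod_cast hi.1
  have hl1 : (1:ℝ) ≤ l := by exact_mod_cast hl.1
  have hid : (i:ℝ) ≤ d := by exact_mod_cast hi.2
  have hld : (l:ℝ) ≤ d := by exact_mod_cast hl.2
  have hd1 : (1:ℝ) ≤ d := hi1.trans hid
  have key : (l:ℝ) + i ≤ |(l:ℝ)^2 - (i:ℝ)^2| := by
    have : (l:ℝ)^2 - (i:ℝ)^2 = (l - i) * (l + i) := by ring
    rw [this, abs_mul, abs_of_nonneg (by linarith : (0:ℝ) ≤ l + i)]
    have : (1:ℝ) ≤ |(l:ℝ) - i| := by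
      have h1 : (1:ℤ) ≤ |(l:ℤ) - i| := Int.one_le_abs (by omega)
      exact_mod_cast h1
    nlinarith
  set A := |(l:ℝ)^2 - (i:ℝ)^2| with hA
  have hApos : 0 < A := by linarith
  set L : ℝ := 2 * d^4 with hL
  have hgap : |L / i^2 - L / l^2| = L * A / ((i:ℝ)^2 * (l:ℝ)^2) := by
    rw [div_sub_div _ _ (by positivity) (by positivity), abs_div, abs_of_pos (by positivity : (0:ℝ) < i^2*l^2),
      show L * (l:ℝ)^2 - i^2 * L = L * ((l:ℝ)^2 - i^2) by ring, abs_mul, abs_of_nonneg (by positivity : 0 ≤ L)]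
  have hgap2 : 2 * (d:ℝ) ≤ L * A / ((i:ℝ)^2 * (l:ℝ)^2) := by
    rw [le_div_iff₀ (by positivity)]
    have : (i:ℝ)^2 * (l:ℝ)^2 ≤ (d:ℝ)^3 * i := by
      calc (i:ℝ)^2 * (l:ℝ)^2 = (i:ℝ) * (l:ℝ)^2 * i := by ring
        _ ≤ (d:ℝ) * (d:ℝ)^2 * i := by gcongr
        _ = _ := by ring
    calc 2 * (d:ℝ) * ((i:ℝ)^2 * (l:ℝ)^2) ≤ 2 * d * (d^3 * i) := by gcongr
      _ = L * i := by rw [hL]; ring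
      _ ≤ L * A := by gcongr; linarith
  have fl : ∀ m : ℕ, 1 ≤ m → (nodeM d m : ℝ) ≤ L / m^2 ∧ L / m^2 - 1 < (nodeM d m:ℝ) := by
    intro m hm
    have hm' : (0:ℝ) < m := by exact_mod_cast hm
    have e : (L / (m:ℝ)^2) = ((2*d^4 : ℕ):ℝ) / ((m^2:ℕ):ℝ) := by rw [hL]; push_cast; ring
    rw [e]
    refine ⟨Nat.cast_div_le, ?_⟩
    have := Nat.lt_div_mul_add (a := 2*d^4) (b := m^2) (by positivity)
    rw [sub_lt_iff_lt_add, div_lt_iff₀ (by positivity)]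
    have h2 : ((2*d^4:ℕ):ℝ) < ((2*d^4/m^2*m^2 + m^2 : ℕ):ℝ) := by exact_mod_cast this
    rw [nodeM]
    push_cast at h2 ⊢
    linarith
  have hi2 := fl i hi.1
  have hl2 := fl l hl.1
  have hsep : (1 - 1/(2*(d:ℝ))) * (L * A / ((i:ℝ)^2 * (l:ℝ)^2)) ≤ |(nodeM d i:ℝ) - nodeM d l| := by
    have h1 : |L / i^2 - L / l^2| - 1 ≤ |(nodeM d i:ℝ) - nodeM d l| := by
      rcases abs_cases (L / (i:ℝ)^2 - L / (l:ℝ)^2) with ⟨e, _⟩ | ⟨e, _⟩ <;> rw [e]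
      · refine le_trans ?_ (le_abs_self _); linarith
      · refine le_trans ?_ (neg_le_abs _); linarith
    rw [hgap] at h1
    refine le_trans ?_ h1
    have : 1 ≤ 1 / (2*(d:ℝ)) * (L * A / ((i:ℝ)^2 * (l:ℝ)^2)) := by
      rw [one_div, inv_mul_eq_div, le_div_iff₀ (by positivity)]; linarith
    linarith
  have hc : 0 < 1 - 1/(2*(d:ℝ)) := by
    have : 1/(2*(d:ℝ)) ≤ 1/2 := by gcongr; linarith
    linarith
  have hpos : 0 < (1 - 1/(2*(d:ℝ))) * (L * A / ((i:ℝ)^2 * (l:ℝ)^2)) := by positivity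
  refine ⟨hpos.trans_le hsep, ?_⟩
  calc (nodeM d i : ℝ) / |(nodeM d i:ℝ) - nodeM d l| ≤
      (L / i^2) / ((1 - 1/(2*(d:ℝ))) * (L * A / ((i:ℝ)^2 * (l:ℝ)^2))) := by gcongr; exact hi2.1
    _ = _ := by
      have hL0 : L ≠ 0 := by positivity
      generalize 1 - 1/(2*(d:ℝ)) = c at hc
      field_simp

theorem interp_bound (p : Polynomial ℝ) (d e N : ℕ) (hp : p.natDegree < d) (C : ℝ) (hC : 0 ≤ C)
    (h : ∀ i ∈ Icc 1 d, |p.eval (nodeM d i : ℝ)| ≤ C * (nodeM d i : ℝ)^(e + (d-1)))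
    (hN : 2 * d^4 ≤ N) :
    |p.eval (N:ℝ)| ≤ 4 * C * d * (2 * d^4)^e * N^(d-1) := by
  have hd : 1 ≤ d := by omega
  have hd1 : (1:ℝ) ≤ d := by exact_mod_cast hd
  have hinj : Set.InjOn (fun i => (nodeM d i : ℝ)) (Icc 1 d : Finset ℕ) := by
    intro i hi l hl hil
    by_contra hne
    have := (node_sep d i l hi hl (Ne.symm hne)).1
    simp only at hil
    rw [hil, sub_self, abs_zero] at this
    exact lt_irrefl _ this
  have h_interp := Lagrange.eq_interpolate (s := Icc 1 d) (v := fun i => (nodeM d i : ℝ)) (f := p) hinj (by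
    rw [Nat.card_Icc]
    by_cases hp0 : p = 0
    · rw [hp0, Polynomial.degree_zero]; exact WithBot.bot_lt_coe _
    · rw [Polynomial.degree_eq_natDegree hp0]; norm_cast)
  rw [h_interp, Lagrange.interpolate_apply, Polynomial.eval_finsetSum]
  have hterm : ∀ i ∈ Icc 1 d, |(Polynomial.C (p.eval (nodeM d i : ℝ)) *
      Lagrange.basis (Icc 1 d) (fun i => (nodeM d i : ℝ)) i).eval (N:ℝ)| ≤
      4 * C * (2 * d^4)^e * N^(d-1) := by
    intro i hi
    have hi' := mem_Icc.1 hi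
    rw [Polynomial.eval_mul, Polynomial.eval_C, Lagrange.basis, Polynomial.eval_prod, abs_mul, abs_prod]
    have hMpos : (0:ℝ) < nodeM d i := by
      have := le_nodeM d i hi'.1 hi'.2
      have h2 : 0 < 2 * d^2 := by positivity
      exact_mod_cast h2.trans_le this
    have hb : ∏ l ∈ (Icc 1 d).erase i, |(Lagrange.basisDivisor (nodeM d i : ℝ) (nodeM d l : ℝ)).eval (N:ℝ)| ≤
        ∏ l ∈ (Icc 1 d).erase i, ((N:ℝ) / nodeM d i * ((l:ℝ)^2 / |(l:ℝ)^2 - (i:ℝ)^2| * (1 - 1/(2*(d:ℝ)))⁻¹)) := by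
      refine prod_le_prod (fun _ _ => abs_nonneg _) fun l hl => ?_
      rw [mem_erase] at hl
      have hs := node_sep d i l hi hl.2 hl.1
      rw [Lagrange.basisDivisor]
      simp only [Polynomial.eval_mul, Polynomial.eval_C, Polynomial.eval_sub, Polynomial.eval_X]
      rw [abs_mul, abs_inv]
      have hNl : |(N:ℝ) - nodeM d l| ≤ N := by
        have : (nodeM d l:ℝ) ≤ N := by exact_mod_cast (nodeM_le d l).trans hN
        rw [abs_of_nonneg (by linarith)]
        linarith [(Nat.cast_nonneg (nodeM d l) : (0:ℝ) ≤ _)]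
      calc |(nodeM d i:ℝ) - nodeM d l|⁻¹ * |(N:ℝ) - nodeM d l| ≤ |(nodeM d i:ℝ) - nodeM d l|⁻¹ * N := by gcongr
        _ = (N:ℝ) / nodeM d i * (nodeM d i / |(nodeM d i:ℝ) - nodeM d l|) := by
          field_simp
        _ ≤ _ := by gcongr; exact hs.2
    have hcard : ((Icc 1 d).erase i).card = d - 1 := by rw [card_erase_of_mem hi, Nat.card_Icc]; omega
    rw [prod_mul_distrib, prod_mul_distrib, prod_const, prod_const, hcard] at hb
    have hpn := prod_node_le i d hi'.1 hi'.2
    have hc : 0 < 1 - 1/(2*(d:ℝ)) := by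
      have : 1/(2*(d:ℝ)) ≤ 1/2 := by gcongr; linarith
      linarith
    have hbern : ((1 - 1/(2*(d:ℝ)))⁻¹)^(d-1) ≤ 2 := by
      rw [inv_pow]
      have h1 := one_add_mul_le_pow (a := -(1/(2*(d:ℝ)))) (by
        have : 1/(2*(d:ℝ)) ≤ 1/2 := by gcongr; linarith
        linarith) (d-1)
      have h2 : (1/2:ℝ) ≤ (1 - 1/(2*(d:ℝ)))^(d-1) := by
        rw [sub_eq_add_neg]
        refine le_trans ?_ h1
        rw [Nat.cast_sub hd, Nat.cast_one]
        have : ((d:ℝ)-1) * (1/(2*(d:ℝ))) ≤ 1/2 := by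
          rw [mul_one_div, div_le_iff₀ (by positivity)]; linarith
        linarith
      calc ((1 - 1/(2*(d:ℝ)))^(d-1))⁻¹ ≤ (1/2:ℝ)⁻¹ := by gcongr
        _ = 2 := by norm_num
    have hMle : (nodeM d i:ℝ) ≤ 2 * d^4 := by exact_mod_cast nodeM_le d i
    calc |p.eval (nodeM d i:ℝ)| * ∏ l ∈ (Icc 1 d).erase i, |(Lagrange.basisDivisor (nodeM d i : ℝ) (nodeM d l : ℝ)).eval (N:ℝ)|
        ≤ (C * (nodeM d i : ℝ)^(e + (d-1))) * (((N:ℝ) / nodeM d i)^(d-1) * (2 * 2)) := by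
          gcongr
          · exact h i hi
          · refine hb.trans ?_
            gcongr
      _ = 4 * C * (nodeM d i:ℝ)^e * N^(d-1) := by
          rw [pow_add, div_pow]; field_simp; ring
      _ ≤ _ := by gcongr
  refine (abs_sum_le_sum_abs _ _).trans ((sum_le_sum hterm).trans ?_)
  rw [sum_const, Nat.card_Icc, nsmul_eq_mul]
  apply le_of_eq
  push_cast [Nat.add_sub_cancel]
  ring

end

section

open Finset

/-- The upper binomial tail `∑_{i ≥ θn} C(n,i) y^i (1-y)^{n-i}` as a polynomial in `y`. -/
noncomputable def tailPoly (n : ℕ) (θ : ℝ) : Polynomial ℝ :=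
  ∑ i ∈ (range (n+1)).filter (fun i : ℕ => θ * n ≤ i), bernsteinPolynomial ℝ n i

theorem bern_eval_nonneg (n i : ℕ) (y : ℝ) (h0 : 0 ≤ y) (h1 : y ≤ 1) :
    0 ≤ (bernsteinPolynomial ℝ n i).eval y := by
  have : 0 ≤ 1 - y := by linarith
  simp [bernsteinPolynomial]
  positivity

theorem bern_eval_sum_mul (n : ℕ) (y l : ℝ) :
    ∑ i ∈ range (n+1), (bernsteinPolynomial ℝ n i).eval y * l^i = (1 - y + l * y)^n := by
  rw [show 1 - y + l * y = l * y + (1 - y) by ring, add_pow]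
  refine sum_congr rfl fun i _ => ?_
  simp [bernsteinPolynomial]
  ring

theorem bern_eval_sum (n : ℕ) (y : ℝ) :
    ∑ i ∈ range (n+1), (bernsteinPolynomial ℝ n i).eval y = 1 := by
  simpa using bern_eval_sum_mul n y 1

theorem tailPoly_natDegree (n : ℕ) (θ : ℝ) : (tailPoly n θ).natDegree ≤ n := by
  refine Polynomial.natDegree_sum_le_of_forall_le _ _ fun i hi => ?_
  rw [mem_filter, mem_range] at hi
  unfold bernsteinPolynomial
  have h1 : (1 - Polynomial.X : Polynomial ℝ).natDegree ≤ 1 := by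
    refine (Polynomial.natDegree_sub_le _ _).trans ?_
    simp
  refine (Polynomial.natDegree_mul_le).trans ?_
  have h2 : ((n.choose i : Polynomial ℝ) * Polynomial.X ^ i).natDegree ≤ i := by
    refine (Polynomial.natDegree_mul_le).trans ?_
    simp
  have h3 : ((1 - Polynomial.X : Polynomial ℝ) ^ (n - i)).natDegree ≤ n - i := by
    refine (Polynomial.natDegree_pow_le).trans ?_
    calc _ ≤ (n - i) * 1 := by gcongr
      _ = _ := by ring
  omega

theorem tailPoly_eval_nonneg (n : ℕ) (θ y : ℝ) (h0 : 0 ≤ y) (h1 : y ≤ 1) :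
    0 ≤ (tailPoly n θ).eval y := by
  rw [tailPoly, Polynomial.eval_finsetSum]
  exact sum_nonneg fun i _ => bern_eval_nonneg n i y h0 h1

theorem tailPoly_eval_add (n : ℕ) (θ y : ℝ) :
    (tailPoly n θ).eval y + ∑ i ∈ (range (n+1)).filter (fun i : ℕ => ¬ θ * n ≤ i),
      (bernsteinPolynomial ℝ n i).eval y = 1 := by
  rw [tailPoly, Polynomial.eval_finsetSum, sum_filter_add_sum_filter_not, bern_eval_sum]

theorem tailPoly_eval_le_one (n : ℕ) (θ y : ℝ) (h0 : 0 ≤ y) (h1 : y ≤ 1) :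
    (tailPoly n θ).eval y ≤ 1 := by
  have := tailPoly_eval_add n θ y
  have h2 : 0 ≤ ∑ i ∈ (range (n+1)).filter (fun i : ℕ => ¬ θ * n ≤ i),
      (bernsteinPolynomial ℝ n i).eval y := sum_nonneg fun i _ => bern_eval_nonneg n i y h0 h1
  linarith

/-- Chernoff bound for a part of the binomial distribution. -/
theorem chernoff (n : ℕ) (θ y l : ℝ) (h0 : 0 ≤ y) (h1 : y ≤ 1) (hl : 0 < l)
    (s : Finset ℕ) (hs : s ⊆ range (n+1)) (h : ∀ i ∈ s, θ * n * Real.log l ≤ i * Real.log l) :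
    ∑ i ∈ s, (bernsteinPolynomial ℝ n i).eval y ≤
      Real.exp ((l - 1) * y - θ * Real.log l) ^ n := by
  have hb := bern_eval_sum_mul n y l
  have hpos : ∀ i, 0 ≤ (bernsteinPolynomial ℝ n i).eval y := fun i => bern_eval_nonneg n i y h0 h1
  have e1 : ∀ i : ℕ, l^i = Real.exp (i * Real.log l) := by
    intro i; rw [← Real.log_pow, Real.exp_log (by positivity)]
  have h2 : (1 - y + l * y)^n ≤ Real.exp ((l-1)*y)^n := by
    have h3 := Real.add_one_le_exp ((l-1)*y)
    have : 0 ≤ l * y := by positivity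
    gcongr
    linarith
  have h4 : (∑ i ∈ s, (bernsteinPolynomial ℝ n i).eval y) * Real.exp (θ * n * Real.log l)
      ≤ (1 - y + l * y)^n := by
    rw [← hb, sum_mul]
    refine (sum_le_sum fun i hi => ?_).trans (sum_le_sum_of_subset_of_nonneg hs
      fun i _ _ => mul_nonneg (hpos i) (by positivity))
    rw [e1]
    exact mul_le_mul_of_nonneg_left (Real.exp_le_exp.2 (h i hi)) (hpos i)
  rw [← le_div_iff₀ (Real.exp_pos _)] at h4
  refine h4.trans ?_
  rw [div_le_iff₀ (Real.exp_pos _)]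
  refine h2.trans (le_of_eq ?_)
  rw [← Real.exp_nat_mul, ← Real.exp_nat_mul, ← Real.exp_add]
  congr 1; ring

theorem exists_step_unit (a b : ℝ) (ha : 0 ≤ a) (hab : a < b) :
    ∃ κ : ℝ, 0 < κ ∧ κ < 1 ∧ ∃ n0 : ℕ, ∀ n ≥ n0, ∃ p : Polynomial ℝ, p.natDegree ≤ n ∧
      (∀ y, 0 ≤ y → y ≤ 1 → 0 ≤ p.eval y ∧ p.eval y ≤ 1) ∧
      (∀ y, 0 ≤ y → y ≤ 1 → y ≤ a → p.eval y ≤ κ^n) ∧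
      (∀ y, 0 ≤ y → y ≤ 1 → b ≤ y → 1/2 ≤ p.eval y) := by
  set θ := (a+b)/2 with hθ
  have h1 : a < θ := by linarith
  have h2 : θ < b := by linarith
  have hθ0 : 0 < θ := by linarith
  set l := 2*θ/(a+θ) with hl
  set m := (θ+b)/(2*b) with hm
  have hb0 : 0 < b := by linarith
  have hl1 : 1 < l := by rw [hl, lt_div_iff₀ (by linarith)]; linarith
  have hm0 : 0 < m := by positivity
  have hm1 : m < 1 := by rw [hm, div_lt_iff₀ (by linarith)]; linarith
  have hκ1 : (l - 1) * a - θ * Real.log l < 0 := by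
    have := Real.one_sub_inv_le_log_of_pos (by linarith : 0 < l)
    have e : (1 - l⁻¹) * θ = (l - 1) * ((a+θ)/2) := by
      have : l⁻¹ = (a+θ)/(2*θ) := by rw [hl, inv_div]
      rw [this, hl]; field_simp
    nlinarith
  have hκ2 : (m - 1) * b - θ * Real.log m < 0 := by
    have := Real.one_sub_inv_le_log_of_pos hm0
    have e : θ * (1 - m⁻¹) = (m - 1) * (θ / m) := by field_simp
    have e2 : θ / m < b := by
      rw [hm, div_div_eq_mul_div, div_lt_iff₀ (by linarith)]; nlinarith
    nlinarith
  refine ⟨Real.exp ((l - 1) * a - θ * Real.log l), Real.exp_pos _, by rwa [Real.exp_lt_one_iff], ?_⟩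
  have ht := tendsto_pow_atTop_nhds_zero_of_lt_one (Real.exp_pos ((m - 1) * b - θ * Real.log m)).le
    (by rwa [Real.exp_lt_one_iff])
  obtain ⟨n0, hn0⟩ := Filter.eventually_atTop.1 (ht.eventually (gt_mem_nhds (by norm_num : (0:ℝ) < 1/2)))
  refine ⟨n0, fun n hn => ⟨tailPoly n θ, tailPoly_natDegree n θ, fun y hy0 hy1 =>
    ⟨tailPoly_eval_nonneg n θ y hy0 hy1, tailPoly_eval_le_one n θ y hy0 hy1⟩, ?_, ?_⟩⟩
  · intro y hy0 hy1 hya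
    rw [tailPoly, Polynomial.eval_finsetSum]
    refine (chernoff n θ y l hy0 hy1 (by linarith) _ (filter_subset _ _) fun i hi => ?_).trans ?_
    · have := Real.log_pos hl1
      have := (mem_filter.1 hi).2
      gcongr
    · have : 0 ≤ l - 1 := by linarith
      gcongr
  · intro y hy0 hy1 hyb
    have h3 := tailPoly_eval_add n θ y
    have h4 : ∑ i ∈ (range (n+1)).filter (fun i : ℕ => ¬ θ * n ≤ i),
      (bernsteinPolynomial ℝ n i).eval y ≤ 1/2 := by
      refine (chernoff n θ y m hy0 hy1 hm0 _ (filter_subset _ _) fun i hi => ?_).trans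
        (le_trans ?_ (hn0 n hn).le)
      · have := Real.log_neg hm0 hm1
        have := (mem_filter.1 hi).2
        nlinarith
      · gcongr ?_ ^ n
        apply Real.exp_le_exp.2
        nlinarith
    linarith

theorem exists_step_poly (R ρ ε : ℝ) (hρ : 0 ≤ ρ) (hε : 0 < ε) (hR : 0 < R) :
    ∃ κ : ℝ, 0 < κ ∧ κ < 1 ∧ ∃ n0 : ℕ, ∀ n ≥ n0, ∃ g : Polynomial ℝ, g.natDegree ≤ 2 * n ∧
      (∀ x, |x| ≤ R → |g.eval x| ≤ 1) ∧
      (∀ x, |x| ≤ R → |x| ≤ ρ → |g.eval x| ≤ κ^n) ∧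
      (∀ x, |x| ≤ R → ρ + ε ≤ |x| → 1/2 ≤ |g.eval x|) := by
  obtain ⟨κ, hκ0, hκ1, n0, H⟩ := exists_step_unit ((ρ/R)^2) (((ρ+ε)/R)^2) (by positivity) (by gcongr; linarith)
  refine ⟨κ, hκ0, hκ1, n0, fun n hn => ?_⟩
  obtain ⟨p, hd, hp1, hp2, hp3⟩ := H n hn
  have hy : ∀ x, |x| ≤ R → 0 ≤ (|x|/R)^2 ∧ (|x|/R)^2 ≤ 1 := by
    intro x hx
    refine ⟨by positivity, ?_⟩
    rw [sq_le_one_iff₀ (by positivity), div_le_one hR]; exact hx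
  have ev : ∀ x, (p.comp (Polynomial.C ((1/R)^2) * Polynomial.X^2)).eval x = p.eval ((|x|/R)^2) := by
    intro x
    rw [Polynomial.eval_comp]
    congr 1
    simp only [Polynomial.eval_mul, Polynomial.eval_C, Polynomial.eval_pow, Polynomial.eval_X]
    rw [div_pow, div_pow, sq_abs]; ring
  refine ⟨p.comp (Polynomial.C ((1/R)^2) * Polynomial.X^2), ?_, ?_, ?_, ?_⟩
  · refine (Polynomial.natDegree_comp_le).trans ?_
    have : (Polynomial.C ((1/R)^2) * Polynomial.X^2 : Polynomial ℝ).natDegree ≤ 2 :=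
      Polynomial.natDegree_C_mul_X_pow_le _ _
    nlinarith
  · intro x hx
    have := hy x hx
    have := hp1 _ this.1 this.2
    rw [ev, abs_of_nonneg this.1]; exact this.2
  · intro x hx hxρ
    have h := hy x hx
    rw [ev, abs_of_nonneg (hp1 _ h.1 h.2).1]
    exact hp2 _ h.1 h.2 (by gcongr)
  · intro x hx hxρ
    have h := hy x hx
    rw [ev, abs_of_nonneg (hp1 _ h.1 h.2).1]
    exact hp3 _ h.1 h.2 (by gcongr)

end

section

open Finset

/-- Inverse letter. -/
def cinv {r : ℕ} (c : Fin r × Bool) : Fin r × Bool := (c.1, !c.2)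

@[simp] theorem cinv_cinv {r : ℕ} (c : Fin r × Bool) : cinv (cinv c) = c := by simp [cinv]

theorem cinv_ne {r : ℕ} (c : Fin r × Bool) : cinv c ≠ c := by
  intro h; have := congrArg Prod.snd h; simp [cinv] at this

section Alg
variable {r : ℕ} {R : Type} [Ring R] [Algebra ℝ R] (u : Fin r × Bool → R)

/-- Sum of `∏ u` over reduced words of length `m+1` beginning with the letter `c`. -/
def sphC : ℕ → Fin r × Bool → R
  | 0, c => u c
  | m+1, c => u c * ∑ c' ∈ univ.filter (fun c' => c' ≠ cinv c), sphC m c'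

/-- Sum of `∏ u` over reduced words of length `m`. -/
def sph : ℕ → R
  | 0 => 1
  | m+1 => ∑ c, sphC u m c

/-- `sph l + sph (l-2) + ⋯`. -/
def balB : ℕ → R
  | 0 => 1
  | 1 => sph u 1
  | l+2 => sph u (l+2) + balB l

theorem sph_one {R : Type} [Ring R] (u : Fin r × Bool → R) : sph u 1 = ∑ c, u c := rfl

theorem sph_mul_succ (hu : ∀ c, u c * u (cinv c) = 1) (m : ℕ) :
    sph u 1 * sph u (m+2) = sph u (m+3) + (2 * (r:ℝ) - 1) • sph u (m+1) := by
  have h1 : ∀ c, u c * sph u (m+2) = sphC u (m+2) c + (sph u (m+1) - sphC u m c) := by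
    intro c
    have : sph u (m+2) = ∑ c' ∈ univ.filter (fun c' => c' ≠ cinv c), sphC u (m+1) c' + sphC u (m+1) (cinv c) := by
      rw [sph, ← sum_filter_add_sum_filter_not univ (fun c' => c' ≠ cinv c)]
      congr 1
      rw [show (univ.filter fun c' => ¬ c' ≠ cinv c) = {cinv c} by ext; simp]
      simp
    rw [this, mul_add]
    congr 1
    rw [sphC, ← mul_assoc, hu, one_mul, cinv_cinv, sph, eq_sub_iff_add_eq,
      ← sum_filter_add_sum_filter_not univ (fun c' => c' ≠ c)]
    congr 1
    rw [show (univ.filter fun c' => ¬ c' ≠ c) = {c} by ext; simp]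
    simp
  rw [sph_one, sum_mul, sum_congr rfl fun c _ => h1 c, sum_add_distrib, sum_sub_distrib]
  rw [sum_const, card_univ, Fintype.card_prod, Fintype.card_fin, Fintype.card_bool]
  rw [show ∑ c, sphC u (m+2) c = sph u (m+3) from rfl, show ∑ c, sphC u m c = sph u (m+1) from rfl]
  congr 1
  rw [sub_smul, one_smul, mul_comm]
  congr 1
  rw [← Nat.cast_smul_eq_nsmul ℝ]
  push_cast; rfl

theorem sph_mul_one (hu : ∀ c, u c * u (cinv c) = 1) :
    sph u 1 * sph u 1 = sph u 2 + (2 * (r:ℝ)) • 1 := by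
  have h1 : ∀ c, u c * sph u 1 = sphC u 1 c + 1 := by
    intro c
    have : sph u 1 = ∑ c' ∈ univ.filter (fun c' => c' ≠ cinv c), sphC u 0 c' + sphC u 0 (cinv c) := by
      rw [sph, ← sum_filter_add_sum_filter_not univ (fun c' => c' ≠ cinv c)]
      congr 1
      rw [show (univ.filter fun c' => ¬ c' ≠ cinv c) = {cinv c} by ext; simp]
      simp
    rw [this, mul_add]
    congr 1
    exact hu c
  nth_rewrite 1 [sph_one]
  rw [sum_mul, sum_congr rfl fun c _ => h1 c, sum_add_distrib]
  rw [sum_const, card_univ, Fintype.card_prod, Fintype.card_fin, Fintype.card_bool]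
  rw [show ∑ c, sphC u 1 c = sph u 2 from rfl]
  congr 1
  rw [← Nat.cast_smul_eq_nsmul ℝ]
  push_cast; rw [mul_comm]

theorem sph_mul_balB (hu : ∀ c, u c * u (cinv c) = 1) (l : ℕ) :
    sph u 1 * balB u (l+1) = balB u (l+2) + (2 * (r:ℝ) - 1) • balB u l := by
  induction l using Nat.twoStepInduction with
  | zero =>
    simp only [balB]
    rw [sph_mul_one u hu, sub_smul, one_smul]; abel
  | one =>
    simp only [balB]
    rw [mul_add, sph_mul_succ u hu, mul_one]; simp only [Nat.reduceAdd, zero_add]; abel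
  | more l ih _ =>
    have e1 : balB u (l+2+1) = sph u (l+3) + balB u (l+1) := rfl
    have e2 : balB u (l+2+2) = sph u (l+4) + balB u (l+2) := rfl
    have e3 : balB u (l+2) = sph u (l+2) + balB u l := rfl
    rw [e1, e2, mul_add, ih, sph_mul_succ u hu (l+1)]
    nth_rewrite 3 [e3]
    rw [smul_add]; simp only [show l + 1 + 3 = l + 4 by ring, show l+1+1 = l + 2 by ring]; abel

/-- The spheres generate: `U_l(A/2s) = s^{-l} B_l`. -/
theorem aeval_U (hu : ∀ c, u c * u (cinv c) = 1) (s : ℝ) (hs : 0 < s) (hs2 : s^2 = 2 * r - 1) (l : ℕ) :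
    Polynomial.aeval ((2*s)⁻¹ • sph u 1) (Polynomial.Chebyshev.U ℝ (l:ℤ)) = (s^l)⁻¹ • balB u l := by
  induction l using Nat.twoStepInduction with
  | zero => simp [balB]
  | one =>
    have e2 : (Polynomial.aeval ((2*s)⁻¹ • sph u 1)) (2 : Polynomial ℝ) = algebraMap ℝ R 2 := by
      rw [← map_ofNat Polynomial.C, Polynomial.aeval_C]
    rw [Nat.cast_one, Polynomial.Chebyshev.U_one, map_mul, e2, Polynomial.aeval_X, ← Algebra.smul_def,
      smul_smul, balB]
    congr 1
    field_simp
  | more l ih1 ih2 =>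
    have e : ((l+2 : ℕ):ℤ) = (l:ℤ) + 2 := by push_cast; ring
    have e1 : ((l+1 : ℕ):ℤ) = (l:ℤ) + 1 := by push_cast; ring
    rw [e, Polynomial.Chebyshev.U_add_two, map_sub, map_mul, ih1, ← e1, ih2, map_mul, Polynomial.aeval_X]
    have e2 : (Polynomial.aeval ((2*s)⁻¹ • sph u 1)) (2 : Polynomial ℝ) = algebraMap ℝ R 2 := by
      rw [← map_ofNat Polynomial.C, Polynomial.aeval_C]
    rw [e2, ← Algebra.smul_def, smul_smul, smul_mul_smul_comm, sph_mul_balB u hu, smul_add, smul_smul, ← hs2,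
      add_sub_assoc, ← sub_smul]
    have h1 : 2 * (2*s)⁻¹ * (s^(l+1))⁻¹ = (s^(l+2))⁻¹ := by field_simp; ring
    have h2 : 2 * (2*s)⁻¹ * (s^(l+1))⁻¹ * s^2 - (s^l)⁻¹ = 0 := by rw [h1]; field_simp; ring
    rw [h2, h1, zero_smul, add_zero]


/-- Coefficients of `balB` on spheres. -/
noncomputable def bc : ℕ → ℕ → ℝ
  | 0, m => if m = 0 then 1 else 0
  | 1, m => if m = 1 then 1 else 0
  | l+2, m => (if m = l+2 then 1 else 0) + bc l m

theorem bc_eq_zero (l m : ℕ) (h : l < m) : bc l m = 0 := by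
  induction l using Nat.twoStepInduction with
  | zero => simp [bc]; omega
  | one => simp [bc]; omega
  | more l ih _ => rw [bc, if_neg (by omega), ih (by omega), zero_add]

theorem bc_mem (l m : ℕ) : 0 ≤ bc l m ∧ bc l m ≤ 1 := by
  induction l using Nat.twoStepInduction with
  | zero => rw [bc]; split_ifs <;> norm_num
  | one => rw [bc]; split_ifs <;> norm_num
  | more l ih _ =>
    rw [bc]
    split_ifs with h
    · rw [bc_eq_zero l m (by omega)]; norm_num
    · simpa using ih

theorem balB_eq {R : Type} [Ring R] [Algebra ℝ R] (u : Fin r × Bool → R) (l q : ℕ) (h : l ≤ q) :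
    balB u l = ∑ m ∈ range (q+1), bc l m • sph u m := by
  induction l using Nat.twoStepInduction with
  | zero => simp [bc, balB, sph]
  | one => simp [bc, balB, ite_smul]; omega
  | more l ih _ =>
    simp only [bc, balB, ih (by omega), add_smul, sum_add_distrib, ite_smul, one_smul, zero_smul]
    rw [Finset.sum_ite_eq' (range (q+1)) (l+2), if_pos (by simp; omega)]

/-- Coefficients of `T_l(A/2s)` on spheres. -/
noncomputable def tc (s : ℝ) : ℕ → ℕ → ℝ
  | 0, m => if m = 0 then 1 else 0
  | 1, m => if m = 1 then (2*s)⁻¹ else 0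
  | l+2, m => 2⁻¹ * (s^(l+2))⁻¹ * ((if m = l+2 then 1 else 0) - (s^2 - 1) * bc l m)

theorem tc_bound (s : ℝ) (hs : 1 ≤ s) (l m : ℕ) : |tc s l m| ≤ (s^m)⁻¹ := by
  have hs0 : 0 < s := by linarith
  match l with
  | 0 =>
    rw [tc]; split_ifs with h
    · simp [h]
    · simp; positivity
  | 1 =>
    rw [tc]; split_ifs with h
    · rw [h, abs_of_pos (by positivity), pow_one]; gcongr; linarith
    · simp; positivity
  | l+2 =>
    rw [tc]
    by_cases h : m = l + 2
    · rw [if_pos h, bc_eq_zero l m (by omega), h, mul_zero, sub_zero, mul_one, abs_of_pos (by positivity)]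
      have : 0 < (s^(l+2))⁻¹ := by positivity
      linarith
    · rw [if_neg h, zero_sub, mul_neg, abs_neg]
      have hb := bc_mem l m
      have h1 : 0 ≤ s^2 - 1 := by nlinarith
      by_cases hm : l < m
      · rw [bc_eq_zero l m hm]; simp; positivity
      rw [abs_of_nonneg (mul_nonneg (by positivity) (mul_nonneg h1 hb.1))]
      calc 2⁻¹ * (s^(l+2))⁻¹ * ((s^2-1) * bc l m) ≤ 1 * (s^(l+2))⁻¹ * (s^2 * 1) := by
            gcongr
            · exact mul_nonneg h1 hb.1
            · norm_num
            · exact hb.1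
            · linarith
            · exact hb.2
        _ = (s^l)⁻¹ := by field_simp; ring
        _ ≤ (s^m)⁻¹ := by
          gcongr
          omega

theorem aeval_T {R : Type} [Ring R] [Algebra ℝ R] (u : Fin r × Bool → R)
    (hu : ∀ c, u c * u (cinv c) = 1) (s : ℝ) (hs : 0 < s) (hs2 : s^2 = 2 * r - 1) (l q : ℕ) (hl : l ≤ q) :
    Polynomial.aeval ((2*s)⁻¹ • sph u 1) (Polynomial.Chebyshev.T ℝ (l:ℤ)) =
      ∑ m ∈ range (q+1), tc s l m • sph u m := by
  match l with
  | 0 => simp [tc, sph]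
  | 1 => simp [tc, ite_smul]; omega
  | l+2 =>
    have e : ((l+2 : ℕ):ℤ) = (l:ℤ) + 2 := by push_cast; ring
    have e3 : Polynomial.Chebyshev.T ℝ ((l+2:ℕ):ℤ) = (2⁻¹:ℝ) • (Polynomial.Chebyshev.U ℝ ((l+2:ℕ):ℤ) - Polynomial.Chebyshev.U ℝ (l:ℤ)) := by
      rw [e, ← Polynomial.Chebyshev.two_mul_T_eq_U_sub_U, ← map_ofNat Polynomial.C 2, ← Polynomial.smul_eq_C_mul, smul_smul]
      norm_num
    rw [e3, map_smul, map_sub, aeval_U u hu s hs hs2, aeval_U u hu s hs hs2]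
    have e4 : balB u (l+2) = sph u (l+2) + balB u l := rfl
    rw [e4]
    have e5 : ∀ m, tc s (l+2) m • sph u m = (if m = l + 2 then (2⁻¹ * (s^(l+2))⁻¹) • sph u m else 0) -
        (2⁻¹ * (s^(l+2))⁻¹ * (s^2-1)) • (bc l m • sph u m) := by
      intro m
      rw [tc, smul_smul]
      split_ifs
      · rw [← sub_smul]; congr 1; ring
      · rw [zero_sub, zero_sub, ← neg_smul]; congr 1; ring
    rw [sum_congr rfl fun m _ => e5 m, sum_sub_distrib, ← smul_sum, ← balB_eq u l q (by omega),
      Finset.sum_ite_eq' (range (q+1)) (l+2), if_pos (by simp; omega)]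
    rw [smul_sub, smul_add, smul_add, smul_smul, smul_smul, smul_smul, add_sub_assoc, ← sub_smul, sub_eq_add_neg _ ((_:ℝ) • balB u l), ← neg_smul]
    congr 2
    field_simp
    ring

open Polynomial in
theorem exists_T_expansion (q : ℕ) : ∀ p : ℝ[X], p.natDegree ≤ q →
    ∃ c : ℕ → ℝ, p = ∑ l ∈ range (q+1), c l • Polynomial.Chebyshev.T ℝ (l:ℤ) := by
  induction q with
  | zero =>
    intro p hp
    refine ⟨fun _ => p.coeff 0, ?_⟩
    simp
    rw [Polynomial.eq_C_of_natDegree_le_zero hp]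
    simp [Polynomial.smul_eq_C_mul]
  | succ q ih =>
    intro p hp
    set t := Polynomial.Chebyshev.T ℝ ((q+1:ℕ):ℤ) with ht
    have hdeg : t.natDegree = q+1 := by
      rw [ht, Polynomial.Chebyshev.natDegree_T]; rfl
    have hlc : t.coeff (q+1) ≠ 0 := by
      rw [← hdeg, Polynomial.coeff_natDegree, Polynomial.leadingCoeff_ne_zero]
      intro h; rw [h] at hdeg; simp at hdeg
    obtain ⟨c, hc⟩ := ih (p - (p.coeff (q+1) / t.coeff (q+1)) • t) (by
      rw [Polynomial.natDegree_le_iff_coeff_eq_zero]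
      intro m hm
      rw [Polynomial.coeff_sub, Polynomial.coeff_smul, smul_eq_mul]
      rcases (show m = q+1 ∨ q + 1 < m by omega) with rfl | h
      · field_simp; ring
      · have ht0 : t.coeff m = 0 := Polynomial.coeff_eq_zero_of_natDegree_lt (by rw [hdeg]; exact h)
        rw [Polynomial.coeff_eq_zero_of_natDegree_lt (p := p) (by omega), ht0]
        ring)
    refine ⟨fun l => if l = q+1 then p.coeff (q+1) / t.coeff (q+1) else c l, ?_⟩
    rw [sum_range_succ]
    dsimp only
    rw [if_pos rfl, ← ht, ← sub_eq_iff_eq_add, hc]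
    refine sum_congr rfl fun l hl => ?_
    rw [if_neg (by have := mem_range.1 hl; omega)]

open Polynomial Polynomial.Chebyshev MeasureTheory in
theorem T_coeff_bound (q : ℕ) (p : ℝ[X]) (c : ℕ → ℝ) (η : ℝ)
    (hp : p = ∑ l ∈ range (q+1), c l • T ℝ (l:ℤ))
    (hη : ∀ x, |x| ≤ 1 → |p.eval x| ≤ η) (l : ℕ) (hl : l ≤ q) : |c l| ≤ 2 * η := by
  have h_integrable : ∀ f : ℝ[X], Integrable (fun x => f.eval x) measureT := fun f =>
    integrable_measureT f.continuous.continuousOn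
  have h1 : ∫ x, (p * T ℝ (l:ℤ)).eval x ∂measureT = c l * ∫ x, (T ℝ (l:ℤ)).eval x * (T ℝ (l:ℤ)).eval x ∂measureT := by
    have : ∀ x, (p * T ℝ (l:ℤ)).eval x = ∑ m ∈ range (q+1), c m * ((T ℝ (m:ℤ)).eval x * (T ℝ (l:ℤ)).eval x) := by
      intro x
      nth_rewrite 1 [hp]
      rw [sum_mul, eval_finsetSum]
      refine sum_congr rfl fun m _ => ?_
      simp
    simp_rw [this]
    rw [integral_finsetSum]
    · rw [Finset.sum_eq_single l]
      · rw [integral_const_mul]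
      · intro m _ hm
        rw [integral_const_mul, integral_eval_T_real_mul_eval_T_real_measureT_of_ne hm, mul_zero]
      · intro h; simp at h; omega
    · intro m _
      refine Integrable.const_mul ?_ _
      simpa using h_integrable (T ℝ (m:ℤ) * T ℝ (l:ℤ))
  have h2 : Real.pi / 2 ≤ ∫ x, (T ℝ (l:ℤ)).eval x * (T ℝ (l:ℤ)).eval x ∂measureT := by
    by_cases h0 : l = 0
    · subst h0
      have := integral_eval_T_real_mul_self_measureT_zero
      rw [Nat.cast_zero, this]
      linarith [Real.pi_pos]
    · rw [integral_T_real_mul_self_measureT_of_ne_zero h0]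
  have h3 : |∫ x, (p * T ℝ (l:ℤ)).eval x ∂measureT| ≤ η * Real.pi := by
    rw [integral_measureT_eq_integral_cos]
    have := intervalIntegral.norm_integral_le_of_norm_le_const (a := 0) (b := Real.pi)
      (f := fun θ => (p * T ℝ (l:ℤ)).eval (Real.cos θ)) (C := η) (fun θ _ => by
        rw [Real.norm_eq_abs, eval_mul, abs_mul, T_real_cos]
        calc _ ≤ η * 1 := by
              gcongr
              · exact (abs_nonneg _).trans (hη 0 (by simp))
              · exact hη _ (Real.abs_cos_le_one θ)
              · exact Real.abs_cos_le_one _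
          _ = η := mul_one _)
    simpa [abs_of_pos Real.pi_pos] using this
  rw [h1, abs_mul, abs_of_nonneg (le_trans (by positivity) h2)] at h3
  have h4 := mul_le_mul_of_nonneg_left h2 (abs_nonneg (c l))
  have := Real.pi_pos
  nlinarith

open Polynomial in
/-- Polynomials of the adjacency element, expanded over spheres. -/
theorem exists_sphere_expansion (r : ℕ) (s : ℝ) (hs : 1 ≤ s) (hs2 : s^2 = 2 * r - 1) (q : ℕ) (p : ℝ[X])
    (hp : p.natDegree ≤ q) (η : ℝ) (hη : ∀ x, |x| ≤ 2 * s → |p.eval x| ≤ η) :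
    ∃ a : ℕ → ℝ, (∀ m, |a m| ≤ 2 * (q+1) * η * (s^m)⁻¹) ∧
      ∀ (R : Type) [Ring R] [Algebra ℝ R] (u : Fin r × Bool → R), (∀ c, u c * u (cinv c) = 1) →
        aeval (∑ c, u c) p = ∑ m ∈ range (q+1), a m • sph u m := by
  have hs0 : 0 < s := by linarith
  set p' := p.comp (C (2*s) * X) with hp'
  have hd' : p'.natDegree ≤ q := by
    refine natDegree_comp_le.trans ?_
    have : (C (2*s) * X : ℝ[X]).natDegree ≤ 1 := by simpa using natDegree_C_mul_X_pow_le (2*s) 1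
    nlinarith
  obtain ⟨c, hc⟩ := exists_T_expansion q p' hd'
  have hb := T_coeff_bound q p' c η hc (fun x hx => by
    rw [hp', eval_comp]
    apply hη
    simp [abs_mul, abs_of_pos hs0]
    nlinarith)
  have hη0 : 0 ≤ η := (abs_nonneg _).trans (hη 0 (by simp; linarith))
  refine ⟨fun m => ∑ l ∈ range (q+1), c l * tc s l m, fun m => ?_, fun R _ _ u hu => ?_⟩
  · calc |∑ l ∈ range (q+1), c l * tc s l m| ≤ ∑ l ∈ range (q+1), |c l * tc s l m| := abs_sum_le_sum_abs _ _
      _ ≤ ∑ l ∈ range (q+1), (2 * η) * (s^m)⁻¹ := by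
        refine sum_le_sum fun l hl => ?_
        rw [abs_mul]
        have := mem_range.1 hl
        gcongr
        · exact hb l (by omega)
        · exact tc_bound s hs l m
      _ = _ := by rw [sum_const, card_range, nsmul_eq_mul]; push_cast; ring
  · have e : aeval (∑ c, u c) p = aeval ((2*s)⁻¹ • sph u 1) p' := by
      rw [hp', aeval_comp]
      congr 1
      rw [map_mul, aeval_C, aeval_X, ← Algebra.smul_def, smul_smul, mul_inv_cancel₀ (by positivity), one_smul]
      rfl
    rw [e, hc, map_sum]
    simp_rw [sum_smul]
    rw [sum_comm]
    refine sum_congr rfl fun l hl => ?_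
    have := mem_range.1 hl
    rw [map_smul, aeval_T u hu s hs0 hs2 l q (by omega), smul_sum]
    refine sum_congr rfl fun m _ => ?_
    rw [smul_smul]

/-- Ballot numbers. -/
noncomputable def ballot : ℕ → ℕ → ℝ
  | 0, l => if l = 0 then 1 else 0
  | n+1, 0 => ballot n 1
  | n+1, l+1 => ballot n l + ballot n (l+2)

theorem ballot_eq_zero (n l : ℕ) (h : n < l) : ballot n l = 0 := by
  induction n generalizing l with
  | zero => rw [ballot, if_neg (by omega)]
  | succ n ih =>
    match l with
    | 0 => omega
    | l+1 => rw [ballot, ih _ (by omega), ih _ (by omega), add_zero]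

theorem ballot_nonneg (n l : ℕ) : 0 ≤ ballot n l := by
  induction n generalizing l with
  | zero => rw [ballot]; split_ifs <;> norm_num
  | succ n ih =>
    match l with
    | 0 => rw [ballot]; exact ih _
    | l+1 => rw [ballot]; exact add_nonneg (ih _) (ih _)

theorem pow_eq_sum_ballot {R : Type} [Ring R] [Algebra ℝ R] (x : R) (b : ℕ → R)
    (h0 : x * b 0 = b 1) (h1 : ∀ l, x * b (l+1) = b (l+2) + b l) (n L : ℕ) (hL : n < L) :
    x^n * b 0 = ∑ l ∈ range L, ballot n l • b l := by
  induction n generalizing L with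
  | zero => simp [ballot, ite_smul]; omega
  | succ n ih =>
    obtain ⟨J, rfl⟩ : ∃ J, L = J + 2 := ⟨L - 2, by omega⟩
    rw [pow_succ', mul_assoc, ih (J+2) (by omega)]
    rw [sum_range_succ', sum_range_succ' (fun l => ballot (n+1) l • b l)]
    simp only [ballot, add_smul, sum_add_distrib, mul_add, mul_sum, mul_smul_comm, h0, h1, smul_add]
    rw [sum_range_succ (fun l => ballot n (l+1) • b (l+2)), ballot_eq_zero n (J+1) (by omega), zero_smul, add_zero]
    rw [sum_range_succ' (fun l => ballot n (l+1) • b l)]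
    rw [sum_range_succ (fun l => ballot n (l+2) • b (l+1)), ballot_eq_zero n (J+2) (by omega), zero_smul, add_zero]
    rw [sum_range_succ' (fun l => ballot n l • b (l+1))]
    simp only [zero_add, add_assoc, show ∀ l, l + 1 + 1 = l + 2 from fun l => rfl]
    abel

theorem ballot_slide (m n L : ℕ) (hm : m + 1 < L) (hn : n + 1 < L) :
    ∑ l ∈ range L, ballot (m+1) l * ballot n l = ∑ l ∈ range L, ballot m l * ballot (n+1) l := by
  obtain ⟨J, rfl⟩ : ∃ J, L = J + 2 := ⟨L - 2, by omega⟩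
  rw [sum_range_succ', sum_range_succ' (fun l => ballot m l * ballot (n+1) l)]
  simp only [ballot, add_mul, mul_add, sum_add_distrib]
  rw [sum_range_succ (fun l => ballot m (l+2) * ballot n (l+1)), ballot_eq_zero m (J+2) (by omega)]
  rw [sum_range_succ (fun l => ballot m (l+1) * ballot n (l+2)), ballot_eq_zero n (J+2) (by omega)]
  rw [sum_range_succ' (fun l => ballot m l * ballot n (l+1)), sum_range_succ' (fun l => ballot m (l+1) * ballot n l)]
  simp only [zero_add, add_assoc, show ∀ l, l + 1 + 1 = l + 2 from fun l => rfl]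
  ring

theorem ballot_add_zero (m n L : ℕ) (hL : m + n + 1 < L) :
    ballot (m+n) 0 = ∑ l ∈ range L, ballot m l * ballot n l := by
  induction m generalizing n with
  | zero => simp [ballot]; intro h; omega
  | succ m ih =>
    rw [ballot_slide m n L (by omega) (by omega), ← ih (n+1) (by omega)]
    congr 1; omega

theorem ballot_lower (p : ℕ) : (4:ℝ)^p ≤ ballot (2*p) 0 * (2*p+3)^3 := by
  have h1 : (2:ℝ)^p = ∑ l ∈ range (2*p+2), ballot p l * (l+1) := by
    have := pow_eq_sum_ballot (2:ℝ) (fun l => (l:ℝ)+1) (by norm_num) (fun l => by push_cast; ring) p (2*p+2) (by omega)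
    simpa using this
  have h2 := ballot_add_zero p p (2*p+2) (by omega)
  rw [← two_mul] at h2
  have h3 := Finset.sum_mul_sq_le_sq_mul_sq (range (2*p+2)) (fun l => ballot p l) (fun l => (l:ℝ)+1)
  rw [← h1] at h3
  have h4 : ∑ l ∈ range (2*p+2), ((l:ℝ)+1)^2 ≤ (2*(p:ℝ)+3)^3 := by
    calc ∑ l ∈ range (2*p+2), ((l:ℝ)+1)^2 ≤ ∑ l ∈ range (2*p+2), (2*(p:ℝ)+3)^2 := by
          refine sum_le_sum fun l hl => ?_
          have : (l:ℝ) ≤ 2 * p + 2 := by exact_mod_cast (mem_range.1 hl).le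
          gcongr ?_ ^ 2
          linarith
      _ ≤ _ := by
          rw [sum_const, card_range, nsmul_eq_mul]; push_cast
          nlinarith [sq_nonneg (2*(p:ℝ)+3)]
  calc (4:ℝ)^p = (2^p)^2 := by rw [← pow_mul, mul_comm, pow_mul]; norm_num
    _ ≤ _ := h3
    _ ≤ ballot (2*p) 0 * (2*p+3)^3 := by
      rw [h2]
      have e : ∑ l ∈ range (2*p+2), ballot p l ^2 = ∑ l ∈ range (2*p+2), ballot p l * ballot p l :=
        sum_congr rfl fun _ _ => sq _
      rw [e]
      gcongr
      exact sum_nonneg fun _ _ => mul_self_nonneg _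

theorem pow_adj_eq {R : Type} [Ring R] [Algebra ℝ R] (u : Fin r × Bool → R)
    (hu : ∀ c, u c * u (cinv c) = 1) (s : ℝ) (hs : 0 < s) (hs2 : s^2 = 2 * r - 1) (n : ℕ) :
    (∑ c, u c)^n = s^n • ∑ l ∈ range (n+1), (ballot n l * (s^l)⁻¹) • balB u l := by
  have := pow_eq_sum_ballot (s⁻¹ • sph u 1) (fun l => (s^l)⁻¹ • balB u l) (by simp [balB]) (fun l => by
    rw [smul_mul_smul_comm, sph_mul_balB u hu, smul_add, smul_smul, ← hs2]
    congr 2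
    · field_simp; ring
    · field_simp; ring) n (n+1) (by omega)
  simp only [balB, pow_zero, inv_one, one_smul, mul_one, smul_smul] at this
  rw [← this, smul_pow, smul_smul, ← mul_pow, mul_inv_cancel₀ hs.ne', one_pow, one_smul]
  rfl

theorem balB_entry_nonneg {ι : Type} [Fintype ι] [DecidableEq ι] (u : Fin r × Bool → Matrix ι ι ℝ)
    (hu : ∀ c i j, 0 ≤ u c i j) (l : ℕ) (i j : ι) : 0 ≤ balB u l i j := by
  have h1 : ∀ m c i j, 0 ≤ sphC u m c i j := by
    intro m
    induction m with
    | zero => intro c i j; exact hu c i j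
    | succ m ih =>
      intro c i j
      rw [sphC, Matrix.mul_apply]
      refine sum_nonneg fun k _ => mul_nonneg (hu _ _ _) ?_
      rw [Matrix.sum_apply]
      exact sum_nonneg fun c _ => ih _ _ _
  have h2 : ∀ m i j, 0 ≤ sph u m i j := by
    intro m i j
    match m with
    | 0 => rw [sph, Matrix.one_apply]; split_ifs <;> norm_num
    | m+1 => rw [sph, Matrix.sum_apply]; exact sum_nonneg fun c _ => h1 _ _ _ _
  induction l using Nat.twoStepInduction with
  | zero => exact h2 0 i j
  | one => exact h2 1 i j
  | more l ih _ => rw [balB, Matrix.add_apply]; exact add_nonneg (h2 _ _ _) ih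

theorem pow_adj_diag_lower {ι : Type} [Fintype ι] [DecidableEq ι] (u : Fin r × Bool → Matrix ι ι ℝ)
    (hu : ∀ c, u c * u (cinv c) = 1) (hu0 : ∀ c i j, 0 ≤ u c i j)
    (s : ℝ) (hs : 0 < s) (hs2 : s^2 = 2 * r - 1) (n : ℕ) (i : ι) :
    s^n * ballot n 0 ≤ ((∑ c, u c)^n) i i := by
  rw [pow_adj_eq u hu s hs hs2, Matrix.smul_apply, Matrix.sum_apply, smul_eq_mul]
  gcongr
  have : ballot n 0 = ((ballot n 0 * (s^0)⁻¹) • balB u 0) i i := by simp [balB]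
  rw [this]
  refine single_le_sum (f := fun l => ((ballot n l * (s^l)⁻¹) • balB u l) i i) (fun l _ => ?_) (by simp)
  rw [Matrix.smul_apply, smul_eq_mul]
  exact mul_nonneg (mul_nonneg (ballot_nonneg _ _) (by positivity)) (balB_entry_nonneg u hu0 l i i)

end Alg

end

section

open Finset

/-- Reduced words of length `m+1` with first letter `c`. -/
def rwC (r : ℕ) : ℕ → Fin r × Bool → Finset (List (Fin r × Bool))
  | 0, c => {[c]}
  | m+1, c => ((univ.filter (fun c' => c' ≠ cinv c)).biUnion (rwC r m)).image (List.cons c)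

/-- Reduced words of length `m`. -/
def rWords (r : ℕ) : ℕ → Finset (List (Fin r × Bool))
  | 0 => {[]}
  | m+1 => univ.biUnion (rwC r m)

theorem mem_rwC_head (r m : ℕ) (c : Fin r × Bool) (w) (h : w ∈ rwC r m c) : ∃ t, w = c :: t := by
  match m with
  | 0 => simp [rwC] at h; exact ⟨[], h⟩
  | m+1 =>
    rw [rwC, mem_image] at h
    obtain ⟨t, -, rfl⟩ := h
    exact ⟨t, rfl⟩

theorem rwC_disj (r m : ℕ) (s : Finset (Fin r × Bool)) :
    (s : Set (Fin r × Bool)).PairwiseDisjoint (rwC r m) := by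
  intro a _ b _ hab
  rw [Function.onFun, disjoint_left]
  intro w hw hw'
  obtain ⟨t, rfl⟩ := mem_rwC_head r m a w hw
  obtain ⟨t', h⟩ := mem_rwC_head r m b _ hw'
  exact hab (by injection h)

theorem sphC_eq {r : ℕ} {R : Type} [Ring R] (u : Fin r × Bool → R) (m : ℕ) (c) :
    sphC u m c = ∑ w ∈ rwC r m c, (w.map u).prod := by
  induction m generalizing c with
  | zero => simp [sphC, rwC]
  | succ m ih =>
    rw [sphC, rwC, sum_image (by intro a _ b _ h; exact List.cons_injective h), sum_biUnion (rwC_disj _ _ _), mul_sum]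
    refine sum_congr rfl fun c' _ => ?_
    rw [ih, mul_sum]
    simp

theorem sph_eq {r : ℕ} {R : Type} [Ring R] (u : Fin r × Bool → R) (m : ℕ) :
    sph u m = ∑ w ∈ rWords r m, (w.map u).prod := by
  match m with
  | 0 => simp [sph, rWords]
  | m+1 =>
    rw [sph, rWords, sum_biUnion (rwC_disj _ _ _)]
    exact sum_congr rfl fun c _ => sphC_eq u m c

theorem mem_rwC {r m : ℕ} {c : Fin r × Bool} {w} :
    w ∈ rwC r m c ↔ w.length = m + 1 ∧ w.head? = some c ∧ FreeGroup.IsReduced w := by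
  induction m generalizing c w with
  | zero =>
    simp only [rwC, mem_singleton, zero_add, List.length_eq_one_iff]
    constructor
    · rintro rfl; exact ⟨⟨c, rfl⟩, rfl, by simp⟩
    · rintro ⟨⟨a, rfl⟩, h, -⟩
      simpa using h
  | succ m ih =>
    simp only [rwC, mem_image, mem_biUnion, mem_filter, mem_univ, true_and]
    constructor
    · rintro ⟨t, ⟨c', hc', ht⟩, rfl⟩
      obtain ⟨h1, h2, h3⟩ := ih.1 ht
      refine ⟨by simp [h1], rfl, ?_⟩
      obtain ⟨t', rfl⟩ := mem_rwC_head r m c' t ht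
      rw [FreeGroup.IsReduced, List.isChain_cons_cons]
      refine ⟨fun h => ?_, h3⟩
      by_contra hne
      apply hc'
      ext1
      · exact h.symm
      · simp only [cinv]; cases h4 : c.2 <;> cases h5 : c'.2 <;> simp_all
    · rintro ⟨h1, h2, h3⟩
      match w with
      | [] => simp at h1
      | [a] => simp at h1
      | a :: b :: t =>
        simp at h2; subst h2
        rw [FreeGroup.IsReduced, List.isChain_cons_cons] at h3
        refine ⟨b :: t, ⟨b, ?_, ih.2 ⟨by simpa using h1, rfl, h3.2⟩⟩, rfl⟩
        rintro rfl
        simpa [cinv] using h3.1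

theorem mem_rWords {r m : ℕ} {w} :
    w ∈ rWords r m ↔ w.length = m ∧ FreeGroup.IsReduced w := by
  match m with
  | 0 =>
    simp only [rWords, mem_singleton, List.length_eq_zero_iff]
    exact ⟨by rintro rfl; simp, fun h => h.1⟩
  | m+1 =>
    simp only [rWords, mem_biUnion, mem_univ, true_and, mem_rwC]
    constructor
    · rintro ⟨c, h1, _, h3⟩; exact ⟨h1, h3⟩
    · rintro ⟨h1, h3⟩
      match w with
      | [] => simp at h1
      | c :: t => exact ⟨c, h1, rfl, h3⟩

theorem card_rwC (r m : ℕ) (c) : (rwC r m c).card = (2*r-1)^m := by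
  induction m generalizing c with
  | zero => simp [rwC]
  | succ m ih =>
    rw [rwC, card_image_of_injective _ List.cons_injective, card_biUnion (rwC_disj _ _ _),
      sum_congr rfl fun c _ => ih c, sum_const, filter_ne', card_erase_of_mem (mem_univ _)]
    simp [pow_succ]; rw [mul_comm, mul_comm r 2]

theorem card_rWords_le (r m : ℕ) (hr : 1 ≤ r) : (rWords r m).card ≤ 2 * (2*r-1)^m := by
  match m with
  | 0 => simp [rWords]
  | m+1 =>
    rw [rWords, card_biUnion (rwC_disj _ _ _), sum_congr rfl fun c _ => card_rwC r m c, sum_const]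
    simp
    calc r * 2 * (2*r-1)^m ≤ 2 * (2*r-1) * (2*r-1)^m := Nat.mul_le_mul_right _ (by omega)
      _ = _ := by ring

/-- Words whose cyclic core is nonempty and has no rotation symmetry. -/
def GoodWord {r : ℕ} (w : List (Fin r × Bool)) : Prop :=
  FreeGroup.reduceCyclically w ≠ [] ∧ ∀ t, 0 < t → t < (FreeGroup.reduceCyclically w).length →
    (FreeGroup.reduceCyclically w).rotate t ≠ FreeGroup.reduceCyclically w

theorem eq_of_rotate_eq {α : Type} (c d : List α) (t : ℕ) (ht : 0 < t) (hl : c.length = d.length)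
    (hc : c.rotate t = c) (hd : d.rotate t = d) (h : c.take t = d.take t) : c = d := by
  have key : ∀ (e : List α), e.rotate t = e → ∀ i (h : i + t < e.length), e[i + t] = e[i] := by
    intro e he i hi
    have h1 := List.getElem_rotate e t i (by simp; omega)
    have h2 : (e.rotate t)[i]'(by simp; omega) = e[i] := by simp only [he]
    rw [h2] at h1
    rw [h1]
    congr 1
    rw [Nat.mod_eq_of_lt hi]
  refine List.ext_getElem hl ?_
  intro i
  induction i using Nat.strong_induction_on with
  | _ i ih =>
    intro h1 h2
    by_cases hi : i < t
    · have h3 : (c.take t)[i]'(by simp; omega) = (d.take t)[i]'(by simp; omega) := by simp only [h]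
      simpa using h3
    · obtain ⟨k, rfl⟩ : ∃ k, i = k + t := ⟨i - t, by omega⟩
      rw [key c hc k h1, key d hd k h2]
      exact ih k (by omega) _ _

/-- Data witnessing that a word is not good. -/
def BadAt {r : ℕ} (m a t : ℕ) (w : List (Fin r × Bool)) : Prop :=
  ∃ g c, w = g ++ c ++ FreeGroup.invRev g ∧ g.length = a ∧ w.length = m ∧ c.rotate t = c

theorem exists_badAt {r m : ℕ} {w : List (Fin r × Bool)} (hw : w.length = m) (hm : m ≠ 0)
    (hr : FreeGroup.IsReduced w) (hb : ¬ GoodWord w) :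
    ∃ a t, 0 < t ∧ 2 * (a + t) ≤ m ∧ BadAt m a t w := by
  have hd := FreeGroup.reduceCyclically.conj_conjugator_reduceCyclically w
  set g := FreeGroup.reduceCyclically.conjugator w
  set c := FreeGroup.reduceCyclically w with hc
  have hlen : 2 * g.length + c.length = m := by
    have := congrArg List.length hd
    simp at this; omega
  have hcne : c ≠ [] := by
    intro h
    rw [h, List.append_nil] at hd
    have : FreeGroup.mk w = FreeGroup.mk [] := by
      rw [← hd, ← FreeGroup.mul_mk, ← FreeGroup.inv_mk, mul_inv_cancel, FreeGroup.one_eq_mk]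
    have := FreeGroup.reduce.sound this
    rw [hr.reduce_eq] at this
    simp at this
    rw [this] at hw
    exact hm hw.symm
  have : ∃ t, 0 < t ∧ t < c.length ∧ c.rotate t = c := by
    by_contra hcon
    push Not at hcon
    exact hb ⟨hcne, hcon⟩
  obtain ⟨t, ht0, ht1, ht⟩ := this
  by_cases h2 : 2 * t ≤ c.length
  · exact ⟨g.length, t, ht0, by omega, g, c, hd.symm, rfl, hw, ht⟩
  · refine ⟨g.length, c.length - t, by omega, by omega, g, c, hd.symm, rfl, hw, ?_⟩
    nth_rewrite 1 [← ht]
    rw [List.rotate_rotate, show t + (c.length - t) = c.length by omega, List.rotate_length]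

theorem badAt_inj {r m a t : ℕ} (ht : 0 < t) {w w' : List (Fin r × Bool)}
    (h : BadAt m a t w) (h' : BadAt m a t w') (he : w.take (a+t) = w'.take (a+t)) : w = w' := by
  obtain ⟨g, c, hw, hg, hm, hc⟩ := h
  obtain ⟨g', c', hw', hg', hm', hc'⟩ := h'
  have hgg : g = g' := by
    have h1 : w.take a = g := by rw [hw, List.append_assoc, ← hg, List.take_left]
    have h1' : w'.take a = g' := by rw [hw', List.append_assoc, ← hg', List.take_left]
    rw [← h1, ← h1']
    have := congrArg (List.take a) he
    simpa [List.take_take] using this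
  subst hgg
  have hl : c.length = c'.length := by
    rw [hw] at hm; rw [hw'] at hm'
    simp at hm hm'; omega
  have hcc : c = c' := by
    refine eq_of_rotate_eq c c' t ht hl hc hc' ?_
    have := congrArg (List.drop a) he
    rw [List.drop_take, List.drop_take, hw, hw', List.append_assoc, List.append_assoc, ← hg,
      List.drop_left, List.drop_left] at this
    simp only [Nat.add_sub_cancel_left] at this
    have hh : ∀ e : List (Fin r × Bool), e.rotate t = e → True := fun _ _ => trivial
    by_cases hcl : t ≤ c.length
    · rwa [List.take_append_of_le_length hcl, List.take_append_of_le_length (hl ▸ hcl)] at this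
    · rw [List.take_of_length_le (by omega), List.take_of_length_le (by omega)]
      have h3 := congrArg (List.take c.length) this
      rw [List.take_take, List.take_take, min_eq_left (by omega), List.take_left, hl, List.take_left] at h3
      exact h3
  rw [hw, hw', hcc]

open Classical in
theorem card_bad_le (r m : ℕ) (hr : 1 ≤ r) (s : ℝ) (hs : 1 ≤ s) (hs2 : s^2 = 2 * r - 1) :
    (((rWords r m).filter (fun w => ¬ GoodWord w)).card : ℝ) ≤ 2 * (m+1)^2 * s^m := by
  by_cases hm : m = 0
  · subst hm
    have : ((rWords r 0).filter (fun w => ¬ GoodWord w)).card ≤ 1 :=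
      (card_filter_le _ _).trans (by simp [rWords])
    have : (((rWords r 0).filter (fun w => ¬ GoodWord w)).card : ℝ) ≤ 1 := by exact_mod_cast this
    simp; linarith
  set I := ((range (m+1)) ×ˢ (range (m+1))).filter (fun x => 0 < x.2 ∧ 2 * (x.1 + x.2) ≤ m)
  have hsub : (rWords r m).filter (fun w => ¬ GoodWord w) ⊆
      I.biUnion fun x => (rWords r m).filter (fun w => BadAt m x.1 x.2 w) := by
    intro w hw
    rw [mem_filter] at hw
    obtain ⟨h1, h2⟩ := mem_rWords.1 hw.1
    obtain ⟨a, t, h3, h4, h5⟩ := exists_badAt h1 hm h2 hw.2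
    rw [mem_biUnion]
    refine ⟨(a, t), ?_, mem_filter.2 ⟨hw.1, h5⟩⟩
    simp [I]; omega
  have hterm : ∀ x ∈ I, (((rWords r m).filter (fun w => BadAt m x.1 x.2 w)).card : ℝ) ≤ 2 * s^m := by
    intro x hx
    have hx := (mem_filter.1 hx).2
    have h1 : ((rWords r m).filter (fun w => BadAt m x.1 x.2 w)).card ≤ (rWords r (x.1 + x.2)).card := by
      refine card_le_card_of_injOn (fun w => w.take (x.1+x.2)) ?_ ?_
      · intro w hw
        have hw := mem_filter.1 (mem_coe.1 hw)
        obtain ⟨h1, h2⟩ := mem_rWords.1 hw.1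
        refine mem_coe.2 (mem_rWords.2 ⟨by simp; omega, ?_⟩)
        exact List.IsChain.take h2 _
      · intro w hw w' hw' he
        exact badAt_inj hx.1 (mem_filter.1 (mem_coe.1 hw)).2 (mem_filter.1 (mem_coe.1 hw')).2 he
    have h2 := h1.trans (card_rWords_le r (x.1+x.2) hr)
    have h3 : (((2*r-1 : ℕ)):ℝ) = s^2 := by
      rw [hs2, Nat.cast_sub (by omega)]; push_cast; ring
    calc (((rWords r m).filter (fun w => BadAt m x.1 x.2 w)).card : ℝ) ≤ ((2 * (2*r-1)^(x.1+x.2) : ℕ):ℝ) := by exact_mod_cast h2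
      _ = 2 * s^(2*(x.1+x.2)) := by rw [Nat.cast_mul, Nat.cast_pow, h3, ← pow_mul]; norm_num
      _ ≤ 2 * s^m := by
        gcongr
        exact hx.2
  calc (((rWords r m).filter (fun w => ¬ GoodWord w)).card : ℝ)
      ≤ ((I.biUnion fun x => (rWords r m).filter (fun w => BadAt m x.1 x.2 w)).card : ℝ) := by
        exact_mod_cast card_le_card hsub
    _ ≤ ∑ x ∈ I, (((rWords r m).filter (fun w => BadAt m x.1 x.2 w)).card : ℝ) := by
        exact_mod_cast card_biUnion_le
    _ ≤ ∑ x ∈ I, 2 * s^m := sum_le_sum hterm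
    _ = I.card * (2 * s^m) := by rw [sum_const, nsmul_eq_mul]
    _ ≤ ((m+1)^2 : ℕ) * (2 * s^m) := by
        gcongr
        refine (card_filter_le _ _).trans ?_
        simp [sq]
    _ = _ := by push_cast; ring

end

section

open Finset

variable {α : Type} [DecidableEq α]

/-- Left multiplication by a generator in the power series ring with square-zero generators. -/
def magL (i : α) (f : List α → ℤ) (l : List α) : ℤ :=
  if l.head? = some i ∧ l.tail.head? ≠ some i then f l.tail else 0

/-- Right multiplication by a generator in the power series ring with square-zero generators. -/
def magR (i : α) (f : List α → ℤ) (l : List α) : ℤ :=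
  if l.getLast? = some i ∧ l.dropLast.getLast? ≠ some i then f l.dropLast else 0

/-- The sign attached to the exponent of a letter. -/
def magSgn (b : Bool) : ℤ := if b then 1 else -1

/-- Left multiplication by `1 ± x`. -/
def magTL (c : α × Bool) (f : List α → ℤ) (l : List α) : ℤ := f l + magSgn c.2 * magL c.1 f l

/-- Right multiplication by `1 ± x`. -/
def magTR (c : α × Bool) (f : List α → ℤ) (l : List α) : ℤ := f l + magSgn c.2 * magR c.1 f l

/-- The Magnus expansion of a word. -/
def magnus : List (α × Bool) → List α → ℤ
  | [] => fun l => if l = [] then 1 else 0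
  | c :: w => magTL c (magnus w)

theorem magSgn_not (b : Bool) : magSgn (!b) = - magSgn b := by cases b <;> rfl

theorem magL_magL (i : α) (f : List α → ℤ) : magL i (magL i f) = 0 := by
  funext l
  simp only [magL, Pi.zero_apply]
  split_ifs with h h' <;> simp_all

theorem magR_magR (i : α) (f : List α → ℤ) : magR i (magR i f) = 0 := by
  funext l
  simp only [magR, Pi.zero_apply]
  split_ifs with h h' <;> simp_all

theorem magL_add (i : α) (f g : List α → ℤ) (s : ℤ) (l : List α) :
    magL i (fun l => f l + s * g l) l = magL i f l + s * magL i g l := by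
  simp only [magL]; split_ifs <;> simp

theorem magR_add (i : α) (f g : List α → ℤ) (s : ℤ) (l : List α) :
    magR i (fun l => f l + s * g l) l = magR i f l + s * magR i g l := by
  simp only [magR]; split_ifs <;> simp

theorem magL_magR (i j : α) (f : List α → ℤ) : magL i (magR j f) = magR j (magL i f) := by
  funext l
  induction l using List.bidirectionalRec with
  | nil => simp [magL, magR]
  | singleton a => simp [magL, magR]
  | cons_append a m b _ =>
    have e1 : (a :: (m ++ [b])).dropLast = a :: m := by
      rw [← List.cons_append, List.dropLast_concat]
    have e2 : (a :: (m ++ [b])).getLast? = some b := by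
      rw [← List.cons_append, List.getLast?_concat]
    simp only [magL, magR, e1, e2, List.head?_cons, List.tail_cons, List.getLast?_concat,
      List.dropLast_concat]
    cases m with
    | nil => simp; grind
    | cons d m =>
      have e3 : (a :: d :: m).getLast? = (d :: m).getLast? := by simp
      rw [e3]; simp; grind

theorem magTL_magTR (c d : α × Bool) (f : List α → ℤ) :
    magTL c (magTR d f) = magTR d (magTL c f) := by
  funext l
  simp only [magTL, magTR]
  have h1 : magL c.1 (magTR d f) l = magL c.1 f l + magSgn d.2 * magL c.1 (magR d.1 f) l :=
    magL_add _ _ _ _ _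
  have h2 : magR d.1 (magTL c f) l = magR d.1 f l + magSgn c.2 * magR d.1 (magL c.1 f) l :=
    magR_add _ _ _ _ _
  rw [h1, h2, magL_magR]; ring

theorem magTL_cancel (i : α) (b : Bool) (f : List α → ℤ) : magTL (i, b) (magTL (i, !b) f) = f := by
  funext l
  have h1 : magL i (magTL (i, !b) f) l = magL i f l + magSgn (!b) * magL i (magL i f) l :=
    magL_add _ _ _ _ _
  rw [magTL]; dsimp only
  rw [h1, magTL, magL_magL, magSgn_not]; simp

theorem magTR_cancel (i : α) (b : Bool) (f : List α → ℤ) : magTR (i, b) (magTR (i, !b) f) = f := by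
  funext l
  have h1 : magR i (magTR (i, !b) f) l = magR i f l + magSgn (!b) * magR i (magR i f) l :=
    magR_add _ _ _ _ _
  rw [magTR]; dsimp only
  rw [h1, magTR, magR_magR, magSgn_not]; simp

theorem magnus_concat (w : List (α × Bool)) (c : α × Bool) :
    magnus (w ++ [c]) = magTR c (magnus w) := by
  induction w with
  | nil =>
    funext l
    simp only [List.nil_append, magnus, magTL, magTR, magL, magR]
    match l with
    | [] => simp
    | [a] => simp
    | a :: b :: l => simp
  | cons d w ih => rw [List.cons_append, magnus, ih, magTL_magTR]; rfl

theorem magnus_append_congr (u v v' : List (α × Bool)) (h : magnus v = magnus v') :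
    magnus (u ++ v) = magnus (u ++ v') := by
  induction u with
  | nil => exact h
  | cons c u ih => simp only [List.cons_append, magnus, ih]

theorem magnus_red {v v' : List (α × Bool)} (h : FreeGroup.Red v v') : magnus v = magnus v' := by
  induction h with
  | refl => rfl
  | tail _ h ih =>
    rw [ih]
    cases h with
    | not => exact magnus_append_congr _ _ _ (magTL_cancel _ _ _)

theorem magnus_reduced (v : List (α × Bool)) (i : α) (b : Bool)
    (hv : FreeGroup.IsReduced ((i, b) :: v)) :
    ∃ (s : List α) (p n : ℤ), s.head? ≠ some i ∧ p ≠ 0 ∧ 0 < n ∧ magnus ((i, b) :: v) s = p ∧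
      magnus ((i, b) :: v) (i :: s) = magSgn b * n * p ∧
      (∀ m : List α, s.length + 1 < m.length → magnus ((i, b) :: v) m = 0) ∧
      (∀ m : List α, s.length + 1 = m.length → m.head? ≠ some i → magnus ((i, b) :: v) m = 0) := by
  induction v generalizing i b with
  | nil =>
    refine ⟨[], 1, 1, by simp, by simp, by simp, ?_, ?_, ?_, ?_⟩
    · simp [magnus, magTL, magL]
    · simp [magnus, magTL, magL]
    · intro m hm
      match m with
      | a :: b :: m => simp [magnus, magTL, magL]
    · intro m hm hm'
      match m with
      | [a] => simp at hm'; simp [magnus, magTL, magL, hm']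
  | cons c v ih =>
    obtain ⟨i', b'⟩ := c
    have hv2 : FreeGroup.IsReduced ((i', b') :: v) := List.IsChain.tail hv
    have hv1 : i = i' → b = b' := by
      have := List.isChain_cons_cons.1 hv
      exact this.1
    obtain ⟨s, p, n, hs, hp, hn, h1, h2, h3, h4⟩ := ih i' b' hv2
    by_cases hi : i = i'
    · subst hi
      obtain rfl := hv1 rfl
      refine ⟨s, p, n + 1, hs, hp, by omega, ?_, ?_, ?_, ?_⟩
      · rw [magnus, magTL, h1]; simp [magL, hs]
      · rw [magnus, magTL, h2]; simp [magL, hs, h1]; ring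
      · intro m hm
        rw [magnus, magTL, h3 m hm]
        simp only [magL]
        split_ifs with h
        · rcases Nat.lt_or_ge (s.length + 1) m.tail.length with h' | h'
          · simp [h3 _ h']
          · rw [h4 m.tail (by simp at *; omega) h.2]; simp
        · simp
      · intro m hm hm'
        rw [magnus, magTL, h4 m hm hm']; simp [magL, hm']
    · have hi' : ¬ i' = i := fun h => hi h.symm
      refine ⟨i' :: s, magSgn b' * n * p, 1, by simp; exact fun h => hi h.symm, ?_, by simp,
        ?_, ?_, ?_, ?_⟩
      · have : magSgn b' ≠ 0 := by cases b' <;> simp [magSgn]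
        positivity
      · rw [magnus, magTL, h2]; simp [magL, hi']
      · rw [magnus, magTL, h3 _ (by simp)]; simp [magL, h2, hi']
      · intro m hm
        simp at hm
        rw [magnus, magTL, h3 m (by omega)]
        simp only [magL]
        rw [h3 m.tail (by simp; omega)]; simp
      · intro m hm hm'
        simp at hm
        rw [magnus, magTL, h3 m (by omega)]; simp [magL, hm']

theorem magnus_injective {v w : List (α × Bool)} (hv : FreeGroup.IsReduced v)
    (hw : FreeGroup.IsReduced w) (h : magnus v = magnus w) : v = w := by
  set u := FreeGroup.reduce (FreeGroup.invRev w ++ v) with hu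
  have h1 : magnus u = magnus [] := by
    rw [← magnus_red FreeGroup.reduce.red, magnus_append_congr _ _ _ h]
    apply magnus_red
    have : FreeGroup.mk (FreeGroup.invRev w ++ w) = FreeGroup.mk [] := by
      rw [← FreeGroup.mul_mk, ← FreeGroup.inv_mk, inv_mul_cancel, FreeGroup.one_eq_mk]
    have h2 := FreeGroup.reduce.red (L := FreeGroup.invRev w ++ w)
    have h3 : FreeGroup.reduce (FreeGroup.invRev w ++ w) = [] := by
      rw [FreeGroup.reduce.sound this]; rfl
    rwa [h3] at h2
  have h2 : u = [] := by
    have hr : FreeGroup.IsReduced u := FreeGroup.isReduced_iff_reduce_eq.2 (by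
      rw [hu, FreeGroup.reduce.idem])
    match hh : u with
    | [] => rfl
    | (i, b) :: u' =>
      obtain ⟨s, p, n, _, hp, hn, _, h2, _⟩ := magnus_reduced u' i b hr
      rw [h1] at h2
      have : magSgn b ≠ 0 := by cases b <;> simp [magSgn]
      have h3 : magSgn b * n * p ≠ 0 := by positivity
      simp only [magnus] at h2
      simp at h2
      omega
  have h3 : FreeGroup.mk (FreeGroup.invRev w ++ v) = 1 := by
    rw [FreeGroup.one_eq_mk]
    apply FreeGroup.reduce.exact
    rw [← hu, h2]; rfl
  rw [← FreeGroup.mul_mk, ← FreeGroup.inv_mk, inv_mul_eq_one] at h3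
  have := FreeGroup.reduce.sound h3
  rw [hv.reduce_eq, hw.reduce_eq] at this
  exact this.symm

variable [Encodable α]

/-- A well-ordering key on words, refining length. -/
def magKey (l : List α) : ℕ ×ₗ ℕ := toLex (l.length, Encodable.encode l)

theorem magKey_injective : Function.Injective (magKey (α := α)) := by
  intro l m h
  have : (l.length, Encodable.encode l) = (m.length, Encodable.encode m) := h
  simpa using (Prod.ext_iff.1 this).2

/-- Comparison of power series at the first differing coefficient. -/
def magLt (f g : List α → ℤ) : Prop := ∃ l, (∀ m, magKey m < magKey l → f m = g m) ∧ f l < g l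

theorem magLt_irrefl (f : List α → ℤ) : ¬ magLt f f := fun ⟨_, _, h⟩ => lt_irrefl _ h

theorem magLt_trans {f g h : List α → ℤ} (h1 : magLt f g) (h2 : magLt g h) : magLt f h := by
  obtain ⟨l, hl, hl'⟩ := h1
  obtain ⟨m, hm, hm'⟩ := h2
  rcases lt_trichotomy (magKey l) (magKey m) with h | h | h
  · exact ⟨l, fun k hk => (hl k hk).trans (hm k (hk.trans h)), by rw [← hm l h]; exact hl'⟩
  · obtain rfl := magKey_injective h
    exact ⟨l, fun k hk => (hl k hk).trans (hm k hk), hl'.trans hm'⟩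
  · exact ⟨m, fun k hk => (hl k (hk.trans h)).trans (hm k hk), by rw [hl m h]; exact hm'⟩

theorem magLt_total {f g : List α → ℤ} (h : f ≠ g) : magLt f g ∨ magLt g f := by
  have hne : {l | f l ≠ g l}.Nonempty := by
    by_contra hh
    apply h; funext l
    by_contra hl
    exact hh ⟨l, hl⟩
  obtain ⟨l, hl, hmin⟩ := (InvImage.wf (magKey (α := α)) wellFounded_lt).has_min _ hne
  have : ∀ m, magKey m < magKey l → f m = g m := by
    intro m hm
    by_contra hh
    exact hmin m hh hm
  rcases lt_or_gt_of_ne (show f l ≠ g l from hl) with h | h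
  · exact Or.inl ⟨l, this, h⟩
  · exact Or.inr ⟨l, fun m hm => (this m hm).symm, h⟩

theorem magKey_lt {l m : List α} (h : l.length < m.length) : magKey l < magKey m :=
  Prod.Lex.toLex_lt_toLex.2 (Or.inl h)

theorem magLt_TL {f g : List α → ℤ} (c : α × Bool) (h : magLt f g) :
    magLt (magTL c f) (magTL c g) := by
  obtain ⟨l, hl, hl'⟩ := h
  have key : ∀ m, magKey m ≤ magKey l → magL c.1 f m = magL c.1 g m := by
    intro m hm
    simp only [magL]
    split_ifs with h
    · apply hl
      refine lt_of_lt_of_le (magKey_lt ?_) hm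
      cases m <;> simp_all
    · rfl
  refine ⟨l, fun m hm => ?_, ?_⟩
  · rw [magTL, magTL, hl m hm, key m hm.le]
  · rw [magTL, magTL, key l le_rfl]; omega

theorem magLt_TR {f g : List α → ℤ} (c : α × Bool) (h : magLt f g) :
    magLt (magTR c f) (magTR c g) := by
  obtain ⟨l, hl, hl'⟩ := h
  have key : ∀ m, magKey m ≤ magKey l → magR c.1 f m = magR c.1 g m := by
    intro m hm
    simp only [magR]
    split_ifs with h
    · apply hl
      refine lt_of_lt_of_le (magKey_lt ?_) hm
      have : m ≠ [] := by rintro rfl; simp at h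
      have := List.length_pos_iff.2 this
      simp; omega
    · rfl
  refine ⟨l, fun m hm => ?_, ?_⟩
  · rw [magTR, magTR, hl m hm, key m hm.le]
  · rw [magTR, magTR, key l le_rfl]; omega

theorem magLt_TL_iff {f g : List α → ℤ} (c : α × Bool) :
    magLt (magTL c f) (magTL c g) ↔ magLt f g := by
  refine ⟨fun h => ?_, magLt_TL c⟩
  have := magLt_TL (c.1, !c.2) h
  have hc : ∀ f : List α → ℤ, magTL (c.1, !c.2) (magTL c f) = f := fun f => by
    simpa using magTL_cancel c.1 (!c.2) f
  rwa [hc, hc] at this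

theorem magLt_TR_iff {f g : List α → ℤ} (c : α × Bool) :
    magLt (magTR c f) (magTR c g) ↔ magLt f g := by
  refine ⟨fun h => ?_, magLt_TR c⟩
  have := magLt_TR (c.1, !c.2) h
  have hc : ∀ f : List α → ℤ, magTR (c.1, !c.2) (magTR c f) = f := fun f => by
    simpa using magTR_cancel c.1 (!c.2) f
  rwa [hc, hc] at this

theorem magLt_same (c : α × Bool) (u u' : List (α × Bool)) :
    magLt (magnus (c :: u)) (magnus (c :: u')) ↔ magLt (magnus (u ++ [c])) (magnus (u' ++ [c])) := by
  rw [magnus_concat, magnus_concat, magLt_TR_iff, magnus, magnus, magLt_TL_iff]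

theorem magLt_inv (c : α × Bool) (u u' : List (α × Bool)) :
    magLt (magnus (c :: u)) (magnus (u' ++ [(c.1, !c.2)])) ↔
      magLt (magnus (u ++ [c])) (magnus ((c.1, !c.2) :: u')) := by
  have h1 : magnus (u ++ [c]) = magTR c (magTL (c.1, !c.2) (magnus (c :: u))) := by
    rw [magnus_concat]
    conv_rhs => rw [magnus]
    congr 1
    have := magTL_cancel c.1 (!c.2) (magnus u)
    simpa using this.symm
  have h2 : magnus ((c.1, !c.2) :: u') =
      magTR c (magTL (c.1, !c.2) (magnus (u' ++ [(c.1, !c.2)]))) := by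
    rw [magnus_concat, magTL_magTR, magnus]
    exact (magTR_cancel c.1 c.2 _).symm
  rw [h1, h2, magLt_TR_iff, magLt_TL_iff]

end

section

open Finset

theorem isReduced_rotate {α : Type} {d : List (α × Bool)} (hd : FreeGroup.IsCyclicallyReduced d)
    (t : ℕ) (ht : t ≤ d.length) : FreeGroup.IsReduced (d.rotate t) := by
  have h := (hd.flatten_replicate 2).isReduced
  rw [List.rotate_eq_drop_append_take ht]
  have h' : (List.replicate 2 d).flatten = d.take t ++ (d.drop t ++ d.take t) ++ d.drop t := by
    symm
    simp only [List.replicate, List.flatten_cons, List.flatten_nil, List.append_nil]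
    rw [List.append_assoc, List.append_assoc, List.take_append_drop, ← List.append_assoc,
      List.take_append_drop]
  rw [h'] at h
  exact h.left_of_append.right_of_append

theorem exists_height {r : ℕ} (w : List (Fin r × Bool)) (hw : FreeGroup.IsReduced w)
    (hg : GoodWord w) :
    ∃ (n : ℕ) (c : Fin (n+1) → Fin r × Bool) (g : List (Fin r × Bool)) (H : Fin (n+1) → ℕ),
      n + 1 ≤ w.length ∧
      FreeGroup.mk w = FreeGroup.mk g * FreeGroup.mk (List.ofFn c) * (FreeGroup.mk g)⁻¹ ∧
      Function.Injective H ∧ (∀ t, H 0 ≤ H t) ∧ (∀ t, c (t+1) ≠ cinv (c t)) ∧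
      (∀ t t', c t = c t' → (H t < H t' ↔ H (t+1) < H (t'+1))) ∧
      (∀ t t', c t' = cinv (c t) → (H t < H (t'+1) ↔ H (t+1) < H t')) := by
  classical
  obtain ⟨hne, hrot⟩ := hg
  have hcyc := FreeGroup.reduceCyclically.isCyclicallyReduced hw
  have hconj := FreeGroup.reduceCyclically.conj_conjugator_reduceCyclically w
  set d := FreeGroup.reduceCyclically w with hd
  set g := FreeGroup.reduceCyclically.conjugator w
  obtain ⟨n, hn⟩ : ∃ n, d.length = n + 1 := ⟨d.length - 1, by
    have := List.length_pos_iff.2 hne; omega⟩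
  have hle : n + 1 ≤ w.length := by
    have := congrArg List.length hconj
    simp at this; omega
  have hrotS : ∀ t : Fin (n+1), d.rotate ((t + 1 : Fin (n+1)) : ℕ) = (d.rotate t).rotate 1 := by
    intro t
    have h1 : ((t + 1 : Fin (n+1)) : ℕ) = (t + 1) % d.length := by
      rw [hn]
      cases n with
      | zero => simp [Nat.mod_one]
      | succ n => rw [Fin.val_add]; rfl
    rw [List.rotate_rotate, h1, List.rotate_mod]
  have hsplit : ∀ t : Fin (n+1), ∃ u, d.rotate t = d[(t:ℕ)]'(by omega) :: u ∧
      d.rotate ((t + 1 : Fin (n+1)) : ℕ) = u ++ [d[(t:ℕ)]'(by omega)] := by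
    intro t
    rw [hrotS]
    match h : d.rotate t with
    | [] => simp at h; exact absurd h hne
    | a :: u =>
      have ha : (d.rotate t)[0]'(by simp; omega) = a := by simp [h]
      rw [List.getElem_rotate] at ha
      have : (0 + (t:ℕ)) % d.length = t := by rw [zero_add, Nat.mod_eq_of_lt]; omega
      simp only [this] at ha
      rw [ha]
      exact ⟨u, rfl, by simp⟩
  have hinj : ∀ t t' : Fin (n+1), d.rotate t = d.rotate t' → t = t' := by
    have key : ∀ t t' : Fin (n+1), t < t' → d.rotate t ≠ d.rotate t' := by
      intro t t' h he
      have h1 : (t':ℕ) = (t' - t) + t := by omega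
      rw [h1, ← List.rotate_rotate] at he
      exact hrot (t' - t) (by omega) (by omega) (List.rotate_injective _ he).symm
    intro t t' h
    rcases lt_trichotomy t t' with h' | h' | h'
    · exact absurd h (key _ _ h')
    · exact h'
    · exact absurd h.symm (key _ _ h')
  set μ : Fin (n+1) → List (Fin r) → ℤ := fun t => magnus (d.rotate t) with hμ
  have hμi : ∀ t t', μ t = μ t' → t = t' := fun t t' h =>
    hinj t t' (magnus_injective (isReduced_rotate hcyc _ (by omega))
      (isReduced_rotate hcyc _ (by omega)) h)
  set H₀ : Fin (n+1) → ℕ := fun t => (univ.filter fun s => magLt (μ s) (μ t)).card with hH₀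
  have hlt : ∀ t t', magLt (μ t) (μ t') → H₀ t < H₀ t' := by
    intro t t' h
    apply card_lt_card
    refine ⟨fun s hs => ?_, fun hs => ?_⟩
    · simp at hs ⊢; exact magLt_trans hs h
    · have := @hs t (by simp [h])
      simp at this; exact magLt_irrefl _ this
  have hiff : ∀ t t', H₀ t < H₀ t' ↔ magLt (μ t) (μ t') := by
    intro t t'
    refine ⟨fun h => ?_, hlt t t'⟩
    have hne : μ t ≠ μ t' := fun h' => by rw [hμi _ _ h'] at h; exact lt_irrefl _ h
    rcases magLt_total hne with h' | h'
    · exact h'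
    · exact absurd (hlt _ _ h') (by omega)
  have hdn : ∀ t : Fin (n+1), (t:ℕ) < d.length := fun t => by rw [hn]; exact t.2
  obtain ⟨t₀, -, ht₀⟩ := exists_min_image univ H₀ ⟨0, mem_univ _⟩
  have hofn : List.ofFn (fun t : Fin (n+1) => d[((t + t₀ : Fin (n+1)):ℕ)]'(hdn _)) =
      d.rotate t₀ := by
    apply List.ext_getElem
    · simp [hn]
    · intro i h1 h2
      rw [List.getElem_rotate]
      simp only [List.getElem_ofFn, Fin.val_add, hn]
  refine ⟨n, fun t => d[((t + t₀ : Fin (n+1)):ℕ)]'(hdn _), g ++ d.take t₀, fun t => H₀ (t + t₀),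
    hle, ?_, ?_, ?_, ?_, ?_, ?_⟩
  · rw [hofn, List.rotate_eq_drop_append_take (by omega)]
    conv_lhs => rw [← hconj, ← List.take_append_drop t₀ d]
    simp only [← FreeGroup.mul_mk, ← FreeGroup.inv_mk]
    group
  · intro t t' h
    have h1 : t + t₀ = t' + t₀ := by
      by_contra hne
      rcases magLt_total (fun h' => hne (hμi _ _ h')) with h' | h'
      · exact absurd (hlt _ _ h') (by simp at h; omega)
      · exact absurd (hlt _ _ h') (by simp at h; omega)
    exact add_right_cancel h1
  · intro t
    simp only [zero_add]; exact ht₀ _ (mem_univ _)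
  · intro t h
    dsimp only at h
    simp only [add_right_comm t 1 t₀] at h
    obtain ⟨u, hu, hu'⟩ := hsplit (t + t₀)
    obtain ⟨v, hv, hv'⟩ := hsplit (t + t₀ + 1)
    rw [hu', h] at hv
    cases u with
    | nil =>
      simp at hv
      exact cinv_ne _ hv.1.symm
    | cons b u =>
      simp at hv
      have hr := isReduced_rotate hcyc ((t + t₀ : Fin (n+1)):ℕ) (hdn _).le
      rw [hu, hv.1] at hr
      have := (List.isChain_cons_cons.1 hr).1
      simp [cinv] at this
  · intro t t' h
    dsimp only at h
    simp only [add_right_comm _ 1 t₀]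
    rw [hiff, hiff]
    obtain ⟨u, hu, hu'⟩ := hsplit (t + t₀)
    obtain ⟨v, hv, hv'⟩ := hsplit (t' + t₀)
    simp only [hμ]
    rw [hu, hu', hv, hv', ← h]
    exact magLt_same _ _ _
  · intro t t' h
    dsimp only at h
    simp only [add_right_comm _ 1 t₀]
    rw [hiff, hiff]
    obtain ⟨u, hu, hu'⟩ := hsplit (t + t₀)
    obtain ⟨v, hv, hv'⟩ := hsplit (t' + t₀)
    simp only [hμ]
    rw [hu, hu', hv, hv', h]
    exact magLt_inv _ _ _

end

section

open Finset

/-- The labelled edge `(a, p, q)`, meaning that the generator `a` maps `p` to `q`, prescribed by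
a step from `p` to `q` along a letter. -/
def edg {r : ℕ} {V : Type} (c : Fin r × Bool) (p q : V) : Fin r × V × V :=
  if c.2 then (c.1, p, q) else (c.1, q, p)

/-- A set of labelled edges is consistent if each label is a partial injection. -/
def ConsE {r : ℕ} {V : Type} (E : Finset (Fin r × V × V)) : Prop :=
  ∀ a p q p' q', (a, p, q) ∈ E → (a, p', q') ∈ E → (p = p' ↔ q = q')

theorem edg_eq {r : ℕ} {V : Type} {c c' : Fin r × Bool} {p q p' q' : V}
    (h : edg c p q = edg c' p' q') :
    (c' = c ∧ p' = p ∧ q' = q) ∨ (c' = cinv c ∧ p' = q ∧ q' = p) := by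
  obtain ⟨a, b⟩ := c
  obtain ⟨a', b'⟩ := c'
  cases b <;> cases b' <;> simp [edg, cinv] at h ⊢ <;> simp [h]

theorem ConsE.iff {r : ℕ} {V : Type} {E : Finset (Fin r × V × V)} (h : ConsE E)
    {c : Fin r × Bool} {p q p' q' : V} (h1 : edg c p q ∈ E) (h2 : edg c p' q' ∈ E) :
    p = p' ↔ q = q' := by
  obtain ⟨a, b⟩ := c
  cases b
  · exact (h a q p q' p' h1 h2).symm
  · exact h a p q p' q' h1 h2

theorem ConsE.mono {r : ℕ} {V : Type} {E F : Finset (Fin r × V × V)} (h : ConsE F) (hEF : E ⊆ F) :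
    ConsE E := fun a p q p' q' h1 h2 => h a p q p' q' (hEF h1) (hEF h2)

section
variable {r n : ℕ} {V ι : Type} [DecidableEq V] [Fintype ι] [DecidableEq ι]

/-- The edges traversed by the inner steps of the strands. -/
def innerE (c : Fin (n+1) → Fin r × Bool) (v : ι → Fin (n+1) → V) : Finset (Fin r × V × V) :=
  (univ.filter fun x : ι × Fin (n+1) => x.2 ≠ Fin.last n).image
    fun x => edg (c x.2) (v x.1 x.2) (v x.1 (x.2+1))

/-- The edges traversed by the final steps of the strands. -/
def lastE (c : Fin (n+1) → Fin r × Bool) (v : ι → Fin (n+1) → V) (y : ι → V) :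
    Finset (Fin r × V × V) :=
  univ.image fun i => edg (c (Fin.last n)) (v i (Fin.last n)) (y i)

theorem mem_innerE {c : Fin (n+1) → Fin r × Bool} {v : ι → Fin (n+1) → V} {d : Fin r × Bool}
    {p q : V} (h : edg d p q ∈ innerE c v) : ∃ i t, t ≠ Fin.last n ∧
      ((c t = d ∧ v i t = p ∧ v i (t+1) = q) ∨ (c t = cinv d ∧ v i t = q ∧ v i (t+1) = p)) := by
  simp only [innerE, mem_image, mem_filter, mem_univ, true_and] at h
  obtain ⟨⟨i, t⟩, ht, h⟩ := h
  exact ⟨i, t, ht, edg_eq h.symm⟩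

theorem innerE_mem (c : Fin (n+1) → Fin r × Bool) (v : ι → Fin (n+1) → V) (i : ι) (t : Fin (n+1))
    (ht : t ≠ Fin.last n) : edg (c t) (v i t) (v i (t+1)) ∈ innerE c v := by
  simp only [innerE, mem_image, mem_filter, mem_univ, true_and]
  exact ⟨(i, t), ht, rfl⟩

theorem lastE_mem (c : Fin (n+1) → Fin r × Bool) (v : ι → Fin (n+1) → V) (y : ι → V) (i : ι) :
    edg (c (Fin.last n)) (v i (Fin.last n)) (y i) ∈ lastE c v y := by
  simp only [lastE, mem_image, mem_univ, true_and]
  exact ⟨i, rfl⟩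

theorem strand_unique {c : Fin (n+1) → Fin r × Bool} {v : ι → Fin (n+1) → V}
    (hx : Function.Injective fun i => v i 0) (hcons : ConsE (innerE c v)) {i i' : ι}
    {t : Fin (n+1)} (h : v i t = v i' t) : i = i' := by
  induction t using Fin.induction with
  | zero => exact hx h
  | succ t ih =>
    apply ih
    have ht : t.castSucc ≠ Fin.last n := Fin.castSucc_ne_last t
    have h1 := innerE_mem c v i t.castSucc ht
    have h2 := innerE_mem c v i' t.castSucc ht
    rw [Fin.coeSucc_eq_succ] at h1 h2
    exact (hcons.iff h1 h2).2 h

theorem card_vertices_le (c : Fin (n+1) → Fin r × Bool) (H : Fin (n+1) → ℕ)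
    (hinj : Function.Injective H) (hmin : ∀ t, H 0 ≤ H t) (hred : ∀ t, c (t+1) ≠ cinv (c t))
    (hs : ∀ t t', c t = c t' → (H t < H t' ↔ H (t+1) < H (t'+1)))
    (hi : ∀ t t', c t' = cinv (c t) → (H t < H (t'+1) ↔ H (t+1) < H t'))
    (v : ι → Fin (n+1) → V) (z y : ι → V) (hx : Function.Injective fun i => v i 0)
    (hz : Function.Injective z) (hxz : ∀ i i', v i 0 ≠ z i') (hy : ∀ i, y i = v i 0 ∨ y i = z i)
    (hcons : ConsE (innerE c v ∪ lastE c v y))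
    (hfree : ∀ i, (∃ p, edg (c (Fin.last n)) p (v i 0) ∈ innerE c v) ∨
      ∃ p, edg (c (Fin.last n)) p (z i) ∈ innerE c v) :
    #((univ.image fun x : ι × Fin (n+1) => v x.1 x.2) ∪ univ.image z) ≤
      #(innerE c v ∪ lastE c v y) := by
  classical
  have hlast : Fin.last n + 1 = 0 := by simp
  set s := c (Fin.last n) with hsdef
  set E := innerE c v with hE
  have hcE : ConsE E := hcons.mono subset_union_left
  have hs' : ∀ t t', c t = c t' → (H t ≤ H t' ↔ H (t+1) ≤ H (t'+1)) := by
    intro t t' h; have := hs t' t h.symm; omega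
  have hi' : ∀ t t', c t' = cinv (c t) → (H (t'+1) ≤ H t ↔ H t' ≤ H (t+1)) := by
    intro t t' h; have := hi t t' h; omega
  set vtop : ι × Fin (n+1) → Prop := fun x => ∀ i' t', v i' t' = v x.1 x.2 → H t' ≤ H x.2
    with hvtop
  set etop : ι × Fin (n+1) → Prop := fun x => x.2 ≠ Fin.last n ∧ ∀ i' t', t' ≠ Fin.last n →
    (c t' = c x.2 → v i' t' = v x.1 x.2 → v i' (t'+1) = v x.1 (x.2+1) → H t' ≤ H x.2) ∧
    (c t' = cinv (c x.2) → v i' t' = v x.1 (x.2+1) → v i' (t'+1) = v x.1 x.2 → H (t'+1) ≤ H x.2)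
    with hetop
  -- distinct top strands lie on distinct edges
  have hT : #(univ.filter etop) ≤ #E := by
    apply card_le_card_of_injOn (fun x => edg (c x.2) (v x.1 x.2) (v x.1 (x.2+1)))
    · intro x hx
      exact innerE_mem c v _ _ (mem_filter.1 (mem_coe.1 hx)).2.1
    · rintro ⟨i, t⟩ hx' ⟨i', t'⟩ hx'' he
      obtain ⟨h1, h2⟩ := (mem_filter.1 (mem_coe.1 hx')).2
      obtain ⟨h1', h2'⟩ := (mem_filter.1 (mem_coe.1 hx'')).2
      dsimp only at h1 h2 h1' h2' he
      rcases edg_eq he with ⟨ha, hb, hc⟩ | ⟨ha, hb, hc⟩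
      · have e1 := (h2 i' t' h1').1 ha hb hc
        have e2 := (h2' i t h1).1 ha.symm hb.symm hc.symm
        obtain rfl := hinj (le_antisymm e1 e2)
        rw [strand_unique hx hcE hb]
      · have ha' : c t = cinv (c t') := by rw [ha, cinv_cinv]
        have e1 := (h2 i' t' h1').2 ha hb hc
        have e2 := (h2' i t h1).2 ha' hc.symm hb.symm
        rw [hi' t t' ha] at e1
        have := hinj (le_antisymm e2 e1)
        exact absurd (this ▸ ha) (hred t)
  have hV : #(univ.image fun x : ι × Fin (n+1) => v x.1 x.2) ≤ #(univ.filter vtop) := by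
    have : (univ.image fun x : ι × Fin (n+1) => v x.1 x.2) ⊆
        (univ.filter vtop).image fun x => v x.1 x.2 := by
      intro p hp
      obtain ⟨x, -, hx⟩ := mem_image.1 hp
      obtain ⟨x₀, h0, hmax⟩ := exists_max_image
        (univ.filter fun x : ι × Fin (n+1) => v x.1 x.2 = p) (fun x => H x.2)
        ⟨x, by simp [hx]⟩
      have h0' := (mem_filter.1 h0).2
      refine mem_image.2 ⟨x₀, mem_filter.2 ⟨mem_univ _, ?_⟩, h0'⟩
      intro i' t' h
      exact hmax (i', t') (by simp [h, h0'])
    exact (card_le_card this).trans card_image_le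
  have hve : ∀ i t, t ≠ Fin.last n → vtop (i, t) → etop (i, t) := by
    intro i t ht h
    exact ⟨ht, fun i' t' ht' => ⟨fun _ h2 _ => h _ _ h2, fun _ _ h3 => h _ _ h3⟩⟩
  have hprev : ∀ i t, t ≠ Fin.last n → vtop (i, t+1) → etop (i, t) := by
    intro i t ht h
    refine ⟨ht, fun i' t' ht' => ⟨fun h1 h2 h3 => ?_, fun h1 h2 h3 => ?_⟩⟩
    · rw [hs' _ _ h1]; exact h _ _ h3
    · rw [hi' _ _ h1]; exact h _ _ h2
  have hextra : ∀ i, ¬ vtop (i, 0) → ∃ t, etop (i, t) ∧ ¬ vtop (i, t) := by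
    intro i h0
    by_contra hcon
    push Not at hcon
    have hno : ∀ t : Fin (n+1), ¬ vtop (i, t) := by
      intro t
      induction t using Fin.induction with
      | zero => exact h0
      | succ t ih =>
        intro hh
        rw [← Fin.coeSucc_eq_succ] at hh
        exact ih (hcon _ (hprev _ _ (Fin.castSucc_ne_last t) hh))
    obtain ⟨tm, -, htm⟩ := exists_max_image (univ : Finset (Fin (n+1))) H ⟨0, mem_univ _⟩
    exact hno tm fun i' t' _ => htm t' (mem_univ _)
  have hran : ∀ i p, edg s p (v i 0) ∈ E → ¬ vtop (i, 0) := by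
    intro i p hp hv
    obtain ⟨i', t', ht', ⟨h1, h2, h3⟩ | ⟨h1, h2, h3⟩⟩ := mem_innerE hp
    · have := hinj (le_antisymm (hv _ _ h3) (hmin _))
      dsimp only at this
      rw [← hlast] at this
      exact ht' (add_right_cancel this)
    · have := hinj (le_antisymm (hv _ _ h2) (hmin _))
      dsimp only at this
      rw [this, hsdef] at h1
      have h4 := hred (Fin.last n)
      rw [hlast] at h4
      exact h4 h1
  have hdom : ∀ i q, edg s (v i (Fin.last n)) q ∈ E → ¬ vtop (i, Fin.last n) := by
    intro i q hq hv
    obtain ⟨i', t', ht', ⟨h1, h2, h3⟩ | ⟨h1, h2, h3⟩⟩ := mem_innerE hq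
    · have e1 := hv _ _ h2
      rw [hs' _ _ h1, hlast] at e1
      have := hinj (le_antisymm e1 (hmin _))
      rw [← hlast] at this
      exact ht' (add_right_cancel this)
    · have e1 := hv _ _ h3
      dsimp only at e1
      have h1' : c (Fin.last n) = cinv (c t') := by rw [h1, cinv_cinv]
      have e2 := hi' _ _ h1'
      rw [hlast] at e2
      have := hinj (le_antisymm e1 (e2.1 (hmin _)))
      rw [← this] at h1'
      exact hred _ h1'
  -- classes of strands
  set dom : ι → Prop := fun i => ∃ q, edg s (v i (Fin.last n)) q ∈ E with hdomdef
  set A := univ.filter fun i => dom i ∧ y i = v i 0 with hA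
  set B := univ.filter fun i => ¬ dom i ∧ y i = z i with hB
  set C := univ.filter fun i => ¬ dom i ∧ y i = v i 0 with hC
  have hxy : ∀ i, v i 0 ≠ z i := fun i => hxz i i
  have hdy : ∀ i, dom i → edg s (v i (Fin.last n)) (y i) ∈ E := by
    rintro i ⟨q, hq⟩
    have := (hcons.iff (mem_union_left _ hq) (mem_union_right _ (lastE_mem c v y i))).1 rfl
    rwa [← this]
  have hnd : ∀ i, ¬ dom i → ∀ p, edg s p (y i) ∉ E := by
    intro i h p hp
    have := (hcons.iff (mem_union_left _ hp) (mem_union_right _ (lastE_mem c v y i))).2 rfl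
    exact h ⟨y i, this ▸ hp⟩
  have hABtop : ∀ i ∈ A ∪ B, ¬ vtop (i, 0) := by
    intro i hi
    rcases mem_union.1 hi with h | h
    · obtain ⟨h1, h2⟩ := (mem_filter.1 h).2
      have := hdy i h1
      rw [h2] at this
      exact hran _ _ this
    · obtain ⟨h1, h2⟩ := (mem_filter.1 h).2
      rcases hfree i with ⟨p, hp⟩ | ⟨p, hp⟩
      · exact hran _ _ hp
      · exact absurd (h2 ▸ hp) (hnd i h1 p)
  have hAB : Disjoint A B := by
    rw [Finset.disjoint_left]
    intro i h1 h2
    exact (mem_filter.1 h2).2.1 (mem_filter.1 h1).2.1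
  have hBC : Disjoint B C := by
    rw [Finset.disjoint_left]
    intro i h1 h2
    exact hxy i ((mem_filter.1 h2).2.2.symm.trans (mem_filter.1 h1).2.2)
  -- counting top positions
  have hcount : #(univ.filter vtop) + #A ≤ #E + #C := by
    have h1 : #(univ.filter vtop) ≤ #(univ.filter fun x => vtop x ∧ etop x) + #(B ∪ C) := by
      have : univ.filter vtop ⊆ (univ.filter fun x => vtop x ∧ etop x) ∪
          (B ∪ C).image fun i => (i, Fin.last n) := by
        rintro ⟨i, t⟩ h
        have h := (mem_filter.1 h).2
        by_cases ht : t = Fin.last n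
        · subst ht
          refine mem_union_right _ (mem_image.2 ⟨i, ?_, rfl⟩)
          have hd : ¬ dom i := fun ⟨q, hq⟩ => hdom _ _ hq h
          rcases hy i with h' | h'
          · exact mem_union_right _ (mem_filter.2 ⟨mem_univ _, hd, h'⟩)
          · exact mem_union_left _ (mem_filter.2 ⟨mem_univ _, hd, h'⟩)
        · exact mem_union_left _ (mem_filter.2 ⟨mem_univ _, h, hve _ _ ht h⟩)
      refine (card_le_card this).trans ((card_union_le _ _).trans ?_)
      exact Nat.add_le_add_left card_image_le _
    have h2 : #(A ∪ B) ≤ #(univ.filter fun x => etop x ∧ ¬ vtop x) := by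
      have : A ∪ B ⊆ (univ.filter fun x => etop x ∧ ¬ vtop x).image Prod.fst := by
        intro i hi
        obtain ⟨t, ht⟩ := hextra i (hABtop i hi)
        exact mem_image.2 ⟨(i, t), mem_filter.2 ⟨mem_univ _, ht⟩, rfl⟩
      exact (card_le_card this).trans card_image_le
    have h3 : #(univ.filter fun x => vtop x ∧ etop x) + #(univ.filter fun x => etop x ∧ ¬ vtop x)
        = #(univ.filter etop) := by
      rw [← card_union_of_disjoint]
      · congr 1; ext x; simp; tauto
      · rw [Finset.disjoint_left]
        intro x h h'
        exact (mem_filter.1 h').2.2 (mem_filter.1 h).2.1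
    rw [card_union_of_disjoint hAB] at h2
    rw [card_union_of_disjoint hBC] at h1
    omega
  have hzv : #((univ.image fun x : ι × Fin (n+1) => v x.1 x.2) ∪ univ.image z) ≤
      #(univ.image fun x : ι × Fin (n+1) => v x.1 x.2) + #(A ∪ B) := by
    have : (univ.image fun x : ι × Fin (n+1) => v x.1 x.2) ∪ univ.image z ⊆
        (univ.image fun x : ι × Fin (n+1) => v x.1 x.2) ∪ (A ∪ B).image z := by
      intro p hp
      rcases mem_union.1 hp with h | h
      · exact mem_union_left _ h
      obtain ⟨i, -, rfl⟩ := mem_image.1 h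
      have hin : ∀ p, edg s p (z i) ∈ E →
          z i ∈ univ.image fun x : ι × Fin (n+1) => v x.1 x.2 := by
        intro p hp
        obtain ⟨i', t', ht', ⟨h1, h2, h3⟩ | ⟨h1, h2, h3⟩⟩ := mem_innerE hp
        · exact mem_image.2 ⟨(i', t'+1), mem_univ _, h3⟩
        · exact mem_image.2 ⟨(i', t'), mem_univ _, h2⟩
      by_cases hd : dom i
      · rcases hy i with h' | h'
        · exact mem_union_right _ (mem_image_of_mem _ (mem_union_left _
            (mem_filter.2 ⟨mem_univ _, hd, h'⟩)))
        · have := hdy i hd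
          rw [h'] at this
          exact mem_union_left _ (hin _ this)
      · rcases hy i with h' | h'
        · rcases hfree i with ⟨p, hp⟩ | ⟨p, hp⟩
          · exact absurd (h' ▸ hp) (hnd i hd p)
          · exact mem_union_left _ (hin _ hp)
        · exact mem_union_right _ (mem_image_of_mem _ (mem_union_right _
            (mem_filter.2 ⟨mem_univ _, hd, h'⟩)))
    refine (card_le_card this).trans ((card_union_le _ _).trans ?_)
    exact Nat.add_le_add_left card_image_le _
  have hEplus : #E + #(B ∪ C) ≤ #(E ∪ lastE c v y) := by
    have hyinj : Function.Injective y := by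
      intro i i' h
      rcases hy i with h1 | h1 <;> rcases hy i' with h2 | h2 <;> rw [h1, h2] at h
      · exact hx h
      · exact absurd h (hxz _ _)
      · exact absurd h.symm (hxz _ _)
      · exact hz h
    have hinjE : Set.InjOn (fun i => edg s (v i (Fin.last n)) (y i)) (B ∪ C : Finset ι) := by
      intro i _ i' _ h
      rcases edg_eq h with ⟨_, _, h3⟩ | ⟨h1, _, _⟩
      · exact (hyinj h3).symm
      · exact absurd h1.symm (cinv_ne _)
    rw [← card_image_of_injOn hinjE, ← card_union_of_disjoint]
    · apply card_le_card
      apply union_subset_union_right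
      intro e he
      obtain ⟨i, _, rfl⟩ := mem_image.1 he
      exact lastE_mem c v y i
    · rw [Finset.disjoint_left]
      intro e he he'
      obtain ⟨i, hi, rfl⟩ := mem_image.1 he'
      have hd : ¬ dom i := by
        rcases mem_union.1 hi with h | h <;> exact (mem_filter.1 h).2.1
      exact hnd i hd _ he
  rw [card_union_of_disjoint hAB] at hzv
  rw [card_union_of_disjoint hBC] at hEplus
  omega

end

end

section

open Finset

section
variable {V : Type} [Fintype V] [DecidableEq V]

theorem card_perm_extending (R : Finset (V × V))
    (hR : ∀ e ∈ R, ∀ e' ∈ R, (e.1 = e'.1 ↔ e.2 = e'.2)) :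
    #(univ.filter fun τ : Equiv.Perm V => ∀ e ∈ R, τ e.1 = e.2) =
      (Fintype.card V - #R).factorial := by
  classical
  set D := R.image Prod.fst with hD
  have hinj1 : Set.InjOn Prod.fst (R : Set (V × V)) := by
    intro e he e' he' h
    exact Prod.ext h ((hR e he e' he').1 h)
  have hDc : #D = #R := card_image_of_injOn hinj1
  set f : V → V := fun p => if h : ∃ q, (p, q) ∈ R then h.choose else p with hf
  have hfR : ∀ e ∈ R, f e.1 = e.2 := by
    intro e he
    have h : ∃ q, (e.1, q) ∈ R := ⟨e.2, he⟩
    simp only [hf, dif_pos h]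
    exact (hR _ h.choose_spec _ he).1 rfl
  have hfs : Set.InjOn f (D : Set V) := by
    intro p hp p' hp' h
    obtain ⟨e, he, rfl⟩ := mem_image.1 (mem_coe.1 hp)
    obtain ⟨e', he', rfl⟩ := mem_image.1 (mem_coe.1 hp')
    rw [hfR e he, hfR e' he'] at h
    exact (hR e he e' he').2 h
  obtain ⟨g, hg⟩ := Finset.exists_equiv_extend_of_card_eq (t := (univ : Finset V))
    (by simp) (subset_univ (D.image f)) hfs
  set τ₀ : Equiv.Perm V := g.trans (Equiv.subtypeUnivEquiv (fun x => mem_univ x)) with hτ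
  have hτ₀ : ∀ e ∈ R, τ₀ e.1 = e.2 := by
    intro e he
    have := hg e.1 (mem_image_of_mem _ he)
    rw [← hfR e he, ← this]; rfl
  have h1 : #(univ.filter fun τ : Equiv.Perm V => ∀ e ∈ R, τ e.1 = e.2) =
      #(univ.filter fun τ : Equiv.Perm V => ∀ p, ¬ (p ∉ D) → τ p = p) := by
    apply card_bij' (fun τ _ => τ₀⁻¹ * τ) (fun τ _ => τ₀ * τ)
    · intro τ hτ
      simp only [mem_filter, mem_univ, true_and, not_not] at hτ ⊢
      intro p hp
      obtain ⟨e, he, rfl⟩ := mem_image.1 hp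
      rw [Equiv.Perm.mul_apply, hτ e he, ← hτ₀ e he]; simp
    · intro τ hτ
      simp only [mem_filter, mem_univ, true_and, not_not] at hτ ⊢
      intro e he
      rw [Equiv.Perm.mul_apply, hτ e.1 (mem_image_of_mem _ he), hτ₀ e he]
    · intro τ _; simp
    · intro τ _; simp
  rw [h1, ← Fintype.card_subtype,
    ← Fintype.card_congr (Equiv.Perm.subtypeEquivSubtypePerm (fun p => p ∉ D)),
    Fintype.card_perm, Fintype.card_subtype]
  congr 1
  rw [← hDc, ← Finset.card_compl]
  congr 1; ext; simp

/-- The number of tuples of permutations satisfying all the prescriptions in `E`. -/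
def cntE {r : ℕ} (E : Finset (Fin r × V × V)) : ℕ :=
  #(univ.filter fun σ : Fin r → Equiv.Perm V => ∀ e ∈ E, σ e.1 e.2.1 = e.2.2)

theorem cntE_eq_zero {r : ℕ} (E : Finset (Fin r × V × V)) (hE : ¬ ConsE E) : cntE E = 0 := by
  rw [cntE, card_eq_zero, filter_eq_empty_iff]
  intro σ _ h
  apply hE
  intro a p q p' q' h1 h2
  have e1 := h _ h1
  have e2 := h _ h2
  dsimp only at e1 e2
  rw [← e1, ← e2]
  exact (Equiv.apply_eq_iff_eq _).symm

theorem cntE_eq {r : ℕ} (E : Finset (Fin r × V × V)) (hE : ConsE E) :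
    cntE E = ∏ a, (Fintype.card V - #(E.filter fun e => e.1 = a)).factorial := by
  classical
  have h1 : (univ.filter fun σ : Fin r → Equiv.Perm V => ∀ e ∈ E, σ e.1 e.2.1 = e.2.2) =
      Fintype.piFinset fun a => univ.filter fun τ : Equiv.Perm V =>
        ∀ e ∈ (E.filter fun e => e.1 = a).image Prod.snd, τ e.1 = e.2 := by
    ext σ
    simp only [mem_filter, mem_univ, true_and, Fintype.mem_piFinset, mem_image]
    constructor
    · rintro h a e ⟨e', ⟨he', rfl⟩, rfl⟩
      exact h e' he'
    · intro h e he
      exact h e.1 e.2 ⟨e, ⟨he, rfl⟩, rfl⟩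
  rw [cntE, h1, Fintype.card_piFinset]
  refine prod_congr rfl fun a _ => ?_
  rw [card_perm_extending]
  · rw [card_image_of_injOn]
    intro e he e' he' h
    exact Prod.ext ((mem_filter.1 (mem_coe.1 he)).2.trans (mem_filter.1 (mem_coe.1 he')).2.symm) h
  · intro e he e' he'
    obtain ⟨⟨b, p, q⟩, hx, rfl⟩ := mem_image.1 he
    obtain ⟨⟨b', p', q'⟩, hx', rfl⟩ := mem_image.1 he'
    obtain ⟨hE1, hb⟩ := mem_filter.1 hx
    obtain ⟨hE2, hb'⟩ := mem_filter.1 hx'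
    dsimp only at hb hb'
    subst hb hb'
    exact hE _ _ _ _ _ hE1 hE2

theorem sum_card_label {r : ℕ} (E : Finset (Fin r × V × V)) :
    ∑ a, #(E.filter fun e => e.1 = a) = #E :=
  (card_eq_sum_card_fiberwise (fun _ _ => mem_univ _)).symm

theorem cntE_le {r : ℕ} (E : Finset (Fin r × V × V)) (m : ℕ) (hm : #E ≤ m)
    (hN : 2 * m ≤ Fintype.card V) (hN0 : 0 < Fintype.card V) :
    (cntE E : ℝ) ≤ ((Fintype.card V).factorial : ℝ)^r * (2 / (Fintype.card V : ℝ))^(#E) := by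
  set N := Fintype.card V
  by_cases hE : ConsE E
  · have h1 : ∀ e, e ≤ m → ((N - e).factorial : ℝ) ≤ (N.factorial : ℝ) * (2 / (N:ℝ))^e := by
      intro e he
      have h2 : (N - e).factorial * N.descFactorial e = N.factorial :=
        Nat.factorial_mul_descFactorial (by omega)
      have h3 := Nat.pow_sub_le_descFactorial N e
      have h4 : ((N:ℝ)/2)^e ≤ (N.descFactorial e : ℝ) := by
        refine le_trans ?_ (show (((N + 1 - e)^e : ℕ) : ℝ) ≤ _ by exact_mod_cast h3)
        push_cast
        apply pow_le_pow_left₀ (by positivity)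
        rw [Nat.cast_sub (by omega)]
        have : (2 * e : ℝ) ≤ N := by exact_mod_cast (show 2 * e ≤ N by omega)
        push_cast; linarith
      have h5 : (0:ℝ) < ((N:ℝ)/2)^e := by positivity
      have h6 : (2 / (N:ℝ))^e = (((N:ℝ)/2)^e)⁻¹ := by rw [← inv_pow, inv_div]
      rw [h6, ← div_eq_mul_inv, le_div_iff₀ h5]
      calc ((N - e).factorial : ℝ) * ((N:ℝ)/2)^e ≤ ((N - e).factorial : ℝ) * (N.descFactorial e : ℝ) := by gcongr
        _ = _ := by exact_mod_cast h2
    rw [cntE_eq E hE, Nat.cast_prod, ← sum_card_label E, ← prod_pow_eq_pow_sum]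
    calc ∏ a, ((N - #(E.filter fun e => e.1 = a)).factorial : ℝ)
        ≤ ∏ a : Fin r, ((N.factorial : ℝ) * (2 / (N:ℝ))^(#(E.filter fun e => e.1 = a))) := by
          apply prod_le_prod
          · intros; positivity
          · intro a _; exact h1 _ ((card_filter_le _ _).trans hm)
      _ = _ := by rw [prod_mul_distrib]; simp
  · rw [cntE_eq_zero E hE]; simp; positivity

end

end

section

open Finset

noncomputable section
set_option linter.unusedSectionVars false
variable {r : ℕ} {V : Type} [Fintype V] [DecidableEq V]

/-- The permutation attached to a letter. -/
def letPerm (σ : Fin r → Equiv.Perm V) (c : Fin r × Bool) : Equiv.Perm V :=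
  if c.2 then σ c.1 else (σ c.1)⁻¹

theorem letPerm_cinv (σ : Fin r → Equiv.Perm V) (c : Fin r × Bool) : letPerm σ (cinv c) = (letPerm σ c)⁻¹ := by
  obtain ⟨a, b⟩ := c
  cases b <;> simp [letPerm, cinv]

theorem letPerm_eq_iff (σ : Fin r → Equiv.Perm V) (c : Fin r × Bool) (p q : V) :
    letPerm σ c p = q ↔ σ (edg c p q).1 (edg c p q).2.1 = (edg c p q).2.2 := by
  obtain ⟨a, b⟩ := c
  cases b
  · simp only [letPerm, edg, Bool.false_eq_true, if_false, Equiv.Perm.inv_eq_iff_eq]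
    exact eq_comm
  · simp [letPerm, edg]

/-- The permutation obtained by applying the letters of a word from first to last. -/
def Wp (σ : Fin r → Equiv.Perm V) : List (Fin r × Bool) → Equiv.Perm V
  | [] => 1
  | c :: w => Wp σ w * letPerm σ c

theorem Wp_append (σ : Fin r → Equiv.Perm V) (w w' : List (Fin r × Bool)) :
    Wp σ (w ++ w') = Wp σ w' * Wp σ w := by
  induction w with
  | nil => simp [Wp]
  | cons c w ih => rw [List.cons_append, Wp, ih, Wp, mul_assoc]

theorem Wp_eq_lift (σ : Fin r → Equiv.Perm V) (w : List (Fin r × Bool)) :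
    Wp σ w = (FreeGroup.lift (fun a => MulOpposite.op (σ a)) (FreeGroup.mk w)).unop := by
  induction w with
  | nil => simp [Wp, ← FreeGroup.one_eq_mk]
  | cons c w ih =>
    rw [Wp, ih, ← List.singleton_append, ← FreeGroup.mul_mk, map_mul, MulOpposite.unop_mul]
    congr 1
    obtain ⟨a, b⟩ := c
    cases b <;> simp [letPerm]

/-- The signed count attached to a permutation. -/
def Psi (j : ℕ) (τ : Equiv.Perm V) : ℝ :=
  ∑ e : (Fin j × Bool) ↪ V, ∏ i, ((if τ (e (i, false)) = e (i, false) then (1:ℝ) else 0) -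
    (if τ (e (i, false)) = e (i, true) then 1 else 0))

theorem Psi_conj (j : ℕ) (τ ρ : Equiv.Perm V) : Psi j (ρ⁻¹ * τ * ρ) = Psi j τ := by
  rw [Psi, Psi]
  refine Fintype.sum_equiv ⟨fun e => e.trans ρ.toEmbedding, fun e => e.trans ρ⁻¹.toEmbedding,
    fun e => by ext; simp, fun e => by ext; simp⟩ _ _ fun e => ?_
  refine prod_congr rfl fun i _ => ?_
  simp only [Equiv.Perm.mul_apply, Equiv.Perm.inv_eq_iff_eq, Equiv.coe_fn_mk,
    Function.Embedding.trans_apply, Equiv.coe_toEmbedding]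

theorem Psi_abs_le (j : ℕ) (τ : Equiv.Perm V) :
    |Psi j τ| ≤ ((Fintype.card V).descFactorial (2 * j) : ℝ) := by
  rw [Psi]
  refine (abs_sum_le_sum_abs _ _).trans ?_
  refine (sum_le_sum (g := fun _ => (1:ℝ)) fun e _ => ?_).trans ?_
  · rw [abs_prod]
    refine prod_le_one (fun _ _ => abs_nonneg _) fun i _ => ?_
    split_ifs <;> simp_all
  · rw [sum_const, card_univ, Fintype.card_embedding_eq]
    simp [mul_comm]

theorem Psi_Wp_conj (j : ℕ) (σ : Fin r → Equiv.Perm V) (w g c : List (Fin r × Bool))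
    (h : FreeGroup.mk w = FreeGroup.mk g * FreeGroup.mk c * (FreeGroup.mk g)⁻¹) :
    Psi j (Wp σ w) = Psi j (Wp σ c) := by
  have : Wp σ w = (Wp σ g)⁻¹ * Wp σ c * Wp σ g := by
    rw [Wp_eq_lift, h, Wp_eq_lift, Wp_eq_lift, map_mul, map_mul, map_inv, MulOpposite.unop_mul,
      MulOpposite.unop_mul, MulOpposite.unop_inv, mul_assoc]
  rw [this, Psi_conj]

variable {j n : ℕ}

/-- Index set of the vertices of the strands together with the alternative targets. -/
abbrev StrandIdx (j n : ℕ) : Type := (Fin j × Fin (n+1)) ⊕ Fin j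

/-- The chosen targets of the last steps. -/
def tgt (S : Finset (Fin j)) (i : Fin j) : StrandIdx j n := if i ∈ S then .inr i else .inl (i, 0)

/-- The edges prescribed by a vertex labelling and a choice of targets. -/
def strandE (c : Fin (n+1) → Fin r × Bool) (f : StrandIdx j n → V) (S : Finset (Fin j)) :
    Finset (Fin r × V × V) :=
  innerE c (fun i t => f (.inl (i, t))) ∪
    lastE c (fun i t => f (.inl (i, t))) (fun i => f (tgt S i))

/-- The labelling is injective on starting points and alternative targets. -/
def goodF (f : StrandIdx j n → V) : Prop :=
  Function.Injective fun x : Fin j × Bool =>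
    f (if x.2 then .inr x.1 else .inl (x.1, 0))

theorem strandE_sat (c : Fin (n+1) → Fin r × Bool) (f : StrandIdx j n → V) (S : Finset (Fin j))
    (σ : Fin r → Equiv.Perm V) :
    (∀ e ∈ strandE c f S, σ e.1 e.2.1 = e.2.2) ↔
      (∀ i t, t ≠ Fin.last n → letPerm σ (c t) (f (.inl (i, t))) = f (.inl (i, t+1))) ∧
      ∀ i, letPerm σ (c (Fin.last n)) (f (.inl (i, Fin.last n))) = f (tgt S i) := by
  simp only [letPerm_eq_iff]
  constructor
  · intro h
    exact ⟨fun i t ht => h _ (mem_union_left _ (innerE_mem c _ i t ht)),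
      fun i => h _ (mem_union_right _ (lastE_mem c _ _ i))⟩
  · rintro ⟨h1, h2⟩ e he
    rcases mem_union.1 he with he | he
    · simp only [innerE, mem_image, mem_filter, mem_univ, true_and] at he
      obtain ⟨x, hx, rfl⟩ := he
      exact h1 x.1 x.2 hx
    · simp only [lastE, mem_image, mem_univ, true_and] at he
      obtain ⟨i, rfl⟩ := he
      exact h2 i

/-- The permutation taking the start of a strand to its position at a given time. -/
def wk (σ : Fin r → Equiv.Perm V) (c : Fin (n+1) → Fin r × Bool) (t : ℕ) : Equiv.Perm V :=
  Wp σ ((List.ofFn c).take t)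

theorem wk_succ (σ : Fin r → Equiv.Perm V) (c : Fin (n+1) → Fin r × Bool) (t : Fin (n+1)) :
    wk σ c (t + 1) = letPerm σ (c t) * wk σ c t := by
  have h : (t : ℕ) < (List.ofFn c).length := by rw [List.length_ofFn]; exact t.2
  rw [wk, wk, ← List.take_append_getElem h, Wp_append, List.getElem_ofFn]
  simp [Wp]

open Classical in
theorem Psi_expand (c : Fin (n+1) → Fin r × Bool) (σ : Fin r → Equiv.Perm V) :
    Psi j (Wp σ (List.ofFn c)) = ∑ f ∈ univ.filter (goodF (j := j) (n := n) (V := V)),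
      ∑ S : Finset (Fin j), (-1:ℝ)^(#S) *
        (if ∀ e ∈ strandE c f S, σ e.1 e.2.1 = e.2.2 then 1 else 0) := by
  have h1 : ∀ f : StrandIdx j n → V, ∑ S : Finset (Fin j), (-1:ℝ)^(#S) *
        (if ∀ e ∈ strandE c f S, σ e.1 e.2.1 = e.2.2 then 1 else 0) =
      if (∀ i t, t ≠ Fin.last n → letPerm σ (c t) (f (.inl (i, t))) = f (.inl (i, t+1))) then
        ∏ i, ((if letPerm σ (c (Fin.last n)) (f (.inl (i, Fin.last n))) = f (.inl (i, 0))
          then (1:ℝ) else 0) -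
          (if letPerm σ (c (Fin.last n)) (f (.inl (i, Fin.last n))) = f (.inr i) then 1 else 0))
      else 0 := by
    intro f
    simp only [strandE_sat]
    split_ifs with h
    · simp only [sub_eq_neg_add]
      rw [Finset.prod_add, powerset_univ]
      refine sum_congr rfl fun S _ => ?_
      have : ∀ i, (if letPerm σ (c (Fin.last n)) (f (.inl (i, Fin.last n))) = f (tgt S i)
          then (1:ℝ) else 0) = S.piecewise
          (fun i => if letPerm σ (c (Fin.last n)) (f (.inl (i, Fin.last n))) = f (.inr i)
            then (1:ℝ) else 0)
          (fun i => if letPerm σ (c (Fin.last n)) (f (.inl (i, Fin.last n))) = f (.inl (i, 0))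
            then (1:ℝ) else 0) i := by
        intro i
        by_cases hi : i ∈ S <;> simp [tgt, hi]
      rw [prod_neg, mul_assoc]
      congr 1
      have h2 := Finset.prod_piecewise univ S
          (fun i => if letPerm σ (c (Fin.last n)) (f (.inl (i, Fin.last n))) = f (.inr i)
            then (1:ℝ) else 0)
          (fun i => if letPerm σ (c (Fin.last n)) (f (.inl (i, Fin.last n))) = f (.inl (i, 0))
            then (1:ℝ) else 0)
      rw [Finset.univ_inter] at h2
      rw [← h2, ← prod_congr rfl fun i _ => this i, Finset.prod_boole]
      simp only [mem_univ, true_implies]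
      exact if_congr (and_iff_right h) rfl rfl
    · refine sum_eq_zero fun S _ => ?_
      rw [if_neg (fun hh => h hh.1), mul_zero]
  simp only [h1]
  rw [← sum_filter, Psi, filter_filter]
  have hw : Wp σ (List.ofFn c) = letPerm σ (c (Fin.last n)) * wk σ c n := by
    have := wk_succ σ c (Fin.last n)
    rw [Fin.val_last] at this
    rw [← this, wk, List.take_of_length_le (by simp)]
  refine sum_bij' (fun e _ => Sum.elim (fun x => wk σ c x.2 (e (x.1, false)))
    (fun i => e (i, true))) (fun f hf => ⟨_, (mem_filter.1 hf).2.1⟩) ?_ ?_ ?_ ?_ ?_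
  · intro e _
    refine mem_filter.2 ⟨mem_univ _, ?_, ?_⟩
    · have : (fun x : Fin j × Bool => Sum.elim (fun x : Fin j × Fin (n+1) =>
          wk σ c x.2 (e (x.1, false))) (fun i => e (i, true))
          (if x.2 then .inr x.1 else .inl (x.1, 0))) = e := by
        funext ⟨i, b⟩
        cases b <;> simp [wk, Wp]
      rw [goodF, this]; exact e.injective
    · intro i t ht
      have : ((t + 1 : Fin (n+1)) : ℕ) = t + 1 := Fin.val_add_one_of_lt (Fin.lt_last_iff_ne_last.2 ht)
      simp [this, wk_succ]
  · intro f hf; exact mem_univ _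
  · intro e _
    ext ⟨i, b⟩
    cases b <;> simp [wk, Wp]
  · intro f hf
    obtain ⟨-, h2, h3⟩ := mem_filter.1 hf
    funext x
    rcases x with ⟨i, t⟩ | i
    · simp only [Sum.elim_inl, Function.Embedding.coeFn_mk]
      induction t using Fin.induction with
      | zero => rfl
      | succ t ih =>
        have := h3 i t.castSucc (Fin.castSucc_ne_last t)
        rw [Fin.coeSucc_eq_succ] at this
        rw [← this, ← ih]
        have h4 := wk_succ σ c t.castSucc
        simp only [Fin.val_castSucc] at h4
        simp [h4]
    · rfl
  · intro e _
    refine prod_congr rfl fun i _ => ?_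
    rw [hw]; rfl

open Classical in
theorem sum_Psi (c : Fin (n+1) → Fin r × Bool) :
    ∑ σ : Fin r → Equiv.Perm V, Psi j (Wp σ (List.ofFn c)) =
      ∑ f ∈ univ.filter (goodF (j := j) (n := n) (V := V)),
        ∑ S : Finset (Fin j), (-1:ℝ)^(#S) * (cntE (strandE c f S) : ℝ) := by
  simp only [Psi_expand]
  rw [sum_comm]
  refine sum_congr rfl fun f _ => ?_
  rw [sum_comm]
  refine sum_congr rfl fun S _ => ?_
  rw [← mul_sum, cntE]
  congr 1
  simp

end

end

section

open Finset

noncomputable section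
set_option linter.unusedSectionVars false
variable {r : ℕ} {V : Type} [Fintype V] [DecidableEq V]

/-- Left multiplication by an involution of the permutation attached to a letter. -/
def letMul (s : Fin r × Bool) (ρ : Equiv.Perm V) (σ : Fin r → Equiv.Perm V) :
    Fin r → Equiv.Perm V :=
  Function.update σ s.1 (if s.2 then ρ * σ s.1 else σ s.1 * ρ)

theorem letMul_letMul (s : Fin r × Bool) (ρ : Equiv.Perm V) (hρ : ρ * ρ = 1)
    (σ : Fin r → Equiv.Perm V) : letMul s ρ (letMul s ρ σ) = σ := by
  obtain ⟨a, b⟩ := s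
  funext a'
  by_cases h : a' = a
  · subst h
    cases b
    · simp [letMul, mul_assoc, hρ]
    · simp [letMul, ← mul_assoc, hρ]
  · simp [letMul, h]

theorem letPerm_letMul (s : Fin r × Bool) (ρ : Equiv.Perm V) (hρ : ρ * ρ = 1)
    (σ : Fin r → Equiv.Perm V) : letPerm (letMul s ρ σ) s = ρ * letPerm σ s := by
  have : ρ⁻¹ = ρ := inv_eq_of_mul_eq_one_left hρ
  obtain ⟨a, b⟩ := s
  cases b
  · simp [letMul, letPerm, this]
  · simp [letMul, letPerm]

theorem letMul_sat_iff (s : Fin r × Bool) (ρ : Equiv.Perm V) (hρ : ρ * ρ = 1)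
    (σ : Fin r → Equiv.Perm V) (E E' : Finset (Fin r × V × V))
    (h1 : ∀ e ∈ E, e.1 ≠ s.1 → e ∈ E') (h2 : ∀ p q, edg s p q ∈ E → edg s p (ρ q) ∈ E')
    (h : ∀ e ∈ E', (letMul s ρ σ) e.1 e.2.1 = e.2.2) : ∀ e ∈ E, σ e.1 e.2.1 = e.2.2 := by
  intro e he
  by_cases hes : e.1 = s.1
  · obtain ⟨p, q, rfl⟩ : ∃ p q, e = edg s p q := by
      obtain ⟨a, b⟩ := s
      obtain ⟨a', p, q⟩ := e
      obtain rfl : a' = a := hes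
      cases b
      · exact ⟨q, p, rfl⟩
      · exact ⟨p, q, rfl⟩
    have := h _ (h2 p q he)
    rw [← letPerm_eq_iff, letPerm_letMul _ _ hρ, Equiv.Perm.mul_apply, ρ.apply_eq_iff_eq] at this
    exact (letPerm_eq_iff _ _ _ _).1 this
  · have := h _ (h1 e he hes)
    rwa [letMul, Function.update_of_ne hes] at this

theorem cntE_le_of_letMul (s : Fin r × Bool) (ρ : Equiv.Perm V) (hρ : ρ * ρ = 1)
    (E E' : Finset (Fin r × V × V))
    (h1 : ∀ e ∈ E, e.1 ≠ s.1 → e ∈ E') (h2 : ∀ p q, edg s p q ∈ E → edg s p (ρ q) ∈ E') :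
    cntE E' ≤ cntE E := by
  refine card_le_card_of_injOn (letMul s ρ) (fun σ hσ => ?_) (fun σ _ τ _ h => ?_)
  · simp only [coe_filter, mem_univ, true_and, Set.mem_ofPred_eq] at hσ ⊢
    refine letMul_sat_iff s ρ hρ _ E E' h1 h2 ?_
    rwa [letMul_letMul _ _ hρ]
  · rw [← letMul_letMul s ρ hρ σ, h, letMul_letMul _ _ hρ]

variable {j n : ℕ}

/-- The symmetric difference with a singleton. -/
def flip1 (i : Fin j) (S : Finset (Fin j)) : Finset (Fin j) :=
  if i ∈ S then S.erase i else insert i S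

theorem flip1_flip1 (i : Fin j) (S : Finset (Fin j)) : flip1 i (flip1 i S) = S := by
  by_cases h : i ∈ S
  · simp [flip1, h]
  · simp [flip1, h]

theorem neg_one_pow_flip1 (i : Fin j) (S : Finset (Fin j)) :
    (-1:ℝ)^(#(flip1 i S)) = -(-1)^(#S) := by
  by_cases h : i ∈ S
  · rw [flip1, if_pos h]
    have := card_erase_add_one h
    rw [← this, pow_succ]; ring
  · rw [flip1, if_neg h, card_insert_of_notMem h, pow_succ]; ring

theorem tgt_flip1_of_ne (i i' : Fin j) (h : i' ≠ i) (S : Finset (Fin j)) :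
    tgt (n := n) (flip1 i S) i' = tgt S i' := by
  by_cases hi : i ∈ S <;> simp [tgt, flip1, hi, h]

theorem goodF_iff (f : StrandIdx j n → V) : goodF f ↔
    (Function.Injective fun i => f (.inl (i, 0))) ∧ (Function.Injective fun i => f (.inr i)) ∧
      ∀ i i', f (.inl (i, 0)) ≠ f (.inr i') := by
  constructor
  · intro h
    refine ⟨fun i i' hi => ?_, fun i i' hi => ?_, fun i i' hi => ?_⟩
    · have := @h (i, false) (i', false) (by simpa using hi)
      simpa using this
    · have := @h (i, true) (i', true) (by simpa using hi)
      simpa using this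
    · have := @h (i, false) (i', true) (by simpa using hi)
      simp at this
  · rintro ⟨h1, h2, h3⟩ ⟨i, b⟩ ⟨i', b'⟩ h
    cases b <;> cases b' <;> simp at h ⊢
    · exact h1 h
    · exact h3 _ _ h
    · exact h3 _ _ h.symm
    · exact h2 h

theorem cntE_flip1_le (c : Fin (n+1) → Fin r × Bool) (f : StrandIdx j n → V) (hf : goodF f)
    (i : Fin j)
    (h1 : ∀ p, edg (c (Fin.last n)) p (f (.inl (i, 0))) ∉ innerE c fun i t => f (.inl (i, t)))
    (h2 : ∀ p, edg (c (Fin.last n)) p (f (.inr i)) ∉ innerE c fun i t => f (.inl (i, t)))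
    (S : Finset (Fin j)) : cntE (strandE c f S) ≤ cntE (strandE c f (flip1 i S)) := by
  obtain ⟨g1, g2, g3⟩ := (goodF_iff f).1 hf
  set ρ := Equiv.swap (f (.inl (i, 0))) (f (.inr i)) with hρ
  have hlast : ∀ i', ρ (f (tgt (flip1 i S) i')) = f (tgt S i') := by
    intro i'
    by_cases hi : i' = i
    · subst hi
      by_cases hS : i' ∈ S <;> simp [tgt, flip1, hS, hρ]
    · rw [tgt_flip1_of_ne _ _ hi]
      by_cases hS : i' ∈ S
      · simp only [tgt, hS, if_true]
        exact Equiv.swap_apply_of_ne_of_ne (g3 _ _).symm (g2.ne hi)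
      · simp only [tgt, hS, if_false]
        exact Equiv.swap_apply_of_ne_of_ne (g1.ne hi) (g3 _ _)
  have hedge : ∀ i', edg (c (Fin.last n)) (f (.inl (i', Fin.last n))) (f (tgt S i')) ∈
      strandE c f S := fun i' => mem_union_right _
        (lastE_mem c (fun i t => f (.inl (i, t))) (fun i => f (tgt S i)) i')
  refine cntE_le_of_letMul (c (Fin.last n)) ρ (Equiv.swap_mul_self _ _) _ _ ?_ ?_
  · intro e he hes
    rcases mem_union.1 he with he | he
    · exact mem_union_left _ he
    · exfalso
      simp only [lastE, mem_image, mem_univ, true_and] at he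
      obtain ⟨i', rfl⟩ := he
      apply hes
      simp only [edg]
      split_ifs <;> rfl
  · intro p q he
    rcases mem_union.1 he with he | he
    · refine mem_union_left _ ?_
      rwa [hρ, Equiv.swap_apply_of_ne_of_ne]
      · rintro rfl; exact h1 p he
      · rintro rfl; exact h2 p he
    · simp only [lastE, mem_image, mem_univ, true_and] at he
      obtain ⟨i', he⟩ := he
      rcases edg_eq he with ⟨-, rfl, rfl⟩ | ⟨h, -, -⟩
      · rw [hlast]; exact hedge i'
      · exact absurd h.symm (cinv_ne _)

theorem sum_flip1_eq_zero (c : Fin (n+1) → Fin r × Bool) (f : StrandIdx j n → V) (hf : goodF f)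
    (i : Fin j)
    (h1 : ∀ p, edg (c (Fin.last n)) p (f (.inl (i, 0))) ∉ innerE c fun i t => f (.inl (i, t)))
    (h2 : ∀ p, edg (c (Fin.last n)) p (f (.inr i)) ∉ innerE c fun i t => f (.inl (i, t))) :
    ∑ S : Finset (Fin j), (-1:ℝ)^(#S) * (cntE (strandE c f S) : ℝ) = 0 := by
  refine sum_involution (fun S _ => flip1 i S) (fun S _ => ?_) (fun S _ _ h => ?_)
    (fun _ _ => mem_univ _) (fun S _ => flip1_flip1 i S)
  · have e : cntE (strandE c f (flip1 i S)) = cntE (strandE c f S) := by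
      refine le_antisymm ?_ (cntE_flip1_le c f hf i h1 h2 S)
      have := cntE_flip1_le c f hf i h1 h2 (flip1 i S)
      rwa [flip1_flip1] at this
    rw [e, neg_one_pow_flip1]; ring
  · by_cases hi : i ∈ S
    · rw [flip1, if_pos hi] at h
      exact erase_eq_self.1 h hi
    · rw [flip1, if_neg hi] at h
      exact hi (insert_eq_self.1 h)

theorem card_strandE_le (c : Fin (n+1) → Fin r × Bool) (f : StrandIdx j n → V)
    (S : Finset (Fin j)) : #(strandE c f S) ≤ j * (n + 1) + j := by
  refine (card_union_le _ _).trans (add_le_add ?_ ?_)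
  · refine card_image_le.trans ((card_filter_le _ _).trans ?_)
    simp
  · refine card_image_le.trans ?_
    simp

theorem abs_strand_sum_le (c : Fin (n+1) → Fin r × Bool) (H : Fin (n+1) → ℕ)
    (hinj : Function.Injective H) (hmin : ∀ t, H 0 ≤ H t) (hred : ∀ t, c (t+1) ≠ cinv (c t))
    (hs : ∀ t t', c t = c t' → (H t < H t' ↔ H (t+1) < H (t'+1)))
    (hi : ∀ t t', c t' = cinv (c t) → (H t < H (t'+1) ↔ H (t+1) < H t'))
    (f : StrandIdx j n → V) (hf : goodF f) (hV : 2 * (j * (n + 1) + j) ≤ Fintype.card V)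
    (hV2 : 2 ≤ Fintype.card V) :
    |∑ S : Finset (Fin j), (-1:ℝ)^(#S) * (cntE (strandE c f S) : ℝ)| ≤
      2^j * ((Fintype.card V).factorial ^ r * (2 / Fintype.card V : ℝ)^(#(univ.image f))) := by
  have hV0 : (0:ℝ) < Fintype.card V := by exact_mod_cast (by omega : 0 < Fintype.card V)
  obtain ⟨g1, g2, g3⟩ := (goodF_iff f).1 hf
  by_cases hfree : ∀ i, (∃ p, edg (c (Fin.last n)) p (f (.inl (i, 0))) ∈
      innerE c fun i t => f (.inl (i, t))) ∨
      ∃ p, edg (c (Fin.last n)) p (f (.inr i)) ∈ innerE c fun i t => f (.inl (i, t))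
  · refine (abs_sum_le_sum_abs _ _).trans ((sum_le_sum fun S _ => ?_).trans
      (b := ∑ _S : Finset (Fin j), ((Fintype.card V).factorial ^ r *
        (2 / Fintype.card V : ℝ)^(#(univ.image f)))) ?_)
    · rw [abs_mul, abs_pow, abs_neg, abs_one, one_pow, one_mul, Nat.abs_cast]
      by_cases hc : ConsE (strandE c f S)
      · refine (cntE_le _ _ (card_strandE_le c f S) hV (by omega)).trans ?_
        refine mul_le_mul_of_nonneg_left ?_ (by positivity)
        refine pow_le_pow_of_le_one (by positivity) ?_ ?_
        · rw [div_le_one hV0]; exact_mod_cast hV2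
        · have := card_vertices_le c H hinj hmin hred hs hi (fun i t => f (.inl (i, t)))
            (fun i => f (.inr i)) (fun i => f (tgt S i)) g1 g2 g3
            (fun i => by by_cases hS : i ∈ S <;> simp [tgt, hS]) hc hfree
          refine le_trans (card_le_card ?_) this
          intro v hv
          obtain ⟨x, -, rfl⟩ := mem_image.1 hv
          rcases x with x | x
          · exact mem_union_left _ (mem_image.2 ⟨x, mem_univ _, rfl⟩)
          · exact mem_union_right _ (mem_image.2 ⟨x, mem_univ _, rfl⟩)
      · rw [cntE_eq_zero _ hc, Nat.cast_zero]; positivity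
    · simp
  · push Not at hfree
    obtain ⟨i, h1, h2⟩ := hfree
    rw [sum_flip1_eq_zero c f hf i h1 h2, abs_zero]
    positivity

theorem sum_pow_card_image_le {I : Type} [Fintype I] [DecidableEq I] (hV : 0 < Fintype.card V) :
    ∑ f : I → V, ((Fintype.card V : ℝ)⁻¹)^(#(univ.image f)) ≤
      ∑ m ∈ range (Fintype.card I + 1), (m : ℝ) ^ Fintype.card I := by
  have hV0 : (0:ℝ) < Fintype.card V := by exact_mod_cast hV
  have h1 : ∀ f : I → V, #(univ.image f) ∈ range (Fintype.card I + 1) := fun f =>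
    mem_range.2 (Nat.lt_succ_of_le card_image_le)
  rw [← sum_fiberwise_of_maps_to (fun f _ => h1 f)]
  refine sum_le_sum fun m _ => ?_
  have h2 : #(univ.filter fun f : I → V => #(univ.image f) = m) ≤
      Fintype.card V ^ m * m ^ Fintype.card I := by
    have : (univ.filter fun f : I → V => #(univ.image f) = m) ⊆
        (univ : Finset ((Fin m → V) × (I → Fin m))).image fun x => x.1 ∘ x.2 := by
      intro f hf
      have hf := (mem_filter.1 hf).2
      let e := (univ.image f).equivFinOfCardEq hf
      refine mem_image.2 ⟨(fun x => (e.symm x).1, fun x => e ⟨f x, mem_image_of_mem _ (mem_univ _)⟩),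
        mem_univ _, ?_⟩
      funext x
      simp
    refine (card_le_card this).trans (card_image_le.trans ?_)
    simp
  rw [sum_congr rfl (g := fun _ => ((Fintype.card V : ℝ)⁻¹)^m)
    (fun f hf => by rw [(mem_filter.1 hf).2]), sum_const, nsmul_eq_mul]
  calc _ ≤ ((Fintype.card V ^ m * m ^ Fintype.card I : ℕ) : ℝ) * ((Fintype.card V : ℝ)⁻¹)^m := by
        gcongr
    _ = _ := by
        push_cast
        rw [mul_right_comm, ← mul_pow, mul_inv_cancel₀ hV0.ne', one_pow, one_mul]

end

theorem exists_sum_Psi_le {r n : ℕ} (j : ℕ) (c : Fin (n+1) → Fin r × Bool) (H : Fin (n+1) → ℕ)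
    (hinj : Function.Injective H) (hmin : ∀ t, H 0 ≤ H t) (hred : ∀ t, c (t+1) ≠ cinv (c t))
    (hs : ∀ t t', c t = c t' → (H t < H t' ↔ H (t+1) < H (t'+1)))
    (hi : ∀ t t', c t' = cinv (c t) → (H t < H (t'+1) ↔ H (t+1) < H t')) :
    ∃ C : ℝ, ∀ N : ℕ, 2 * (j * (n + 1) + j) ≤ N → 2 ≤ N →
      |∑ σ : Fin r → Equiv.Perm (Fin N), Psi j (Wp σ (List.ofFn c))| ≤
        C * (N.factorial : ℝ) ^ r := by
  refine ⟨2^j * 2^(Fintype.card (StrandIdx j n)) *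
    ∑ m ∈ range (Fintype.card (StrandIdx j n) + 1), (m : ℝ) ^ Fintype.card (StrandIdx j n),
    fun N hN hN2 => ?_⟩
  classical
  rw [sum_Psi]
  refine (abs_sum_le_sum_abs _ _).trans ?_
  refine (sum_le_sum (g := fun f => (N.factorial : ℝ)^r * (2^j * 2^(Fintype.card (StrandIdx j n)) *
    ((Fintype.card (Fin N) : ℝ)⁻¹)^(#(univ.image f)))) fun f hf => ?_).trans ?_
  · refine (abs_strand_sum_le c H hinj hmin hred hs hi f (mem_filter.1 hf).2 (by simpa using hN)
      (by simpa using hN2)).trans ?_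
    rw [div_eq_mul_inv, mul_pow, Fintype.card_fin, mul_left_comm, mul_assoc ((2:ℝ)^j)]
    gcongr
    · norm_num
    · exact card_image_le
  · rw [← mul_sum, mul_comm _ ((N.factorial : ℝ)^r)]
    refine mul_le_mul_of_nonneg_left ?_ (by positivity)
    rw [← mul_sum]
    refine mul_le_mul_of_nonneg_left ?_ (by positivity)
    refine (sum_le_sum_of_subset_of_nonneg (subset_univ _) fun _ _ _ => by positivity).trans ?_
    exact sum_pow_card_image_le (by simp; omega)

end

section

open Finset

noncomputable section
set_option linter.unusedSectionVars false
variable {r j n : ℕ} {I V W : Type} [DecidableEq V] [DecidableEq W]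

theorem edg_map (c : Fin r × Bool) (f : I → V) (p q : I) :
    edg c (f p) (f q) = Prod.map id (Prod.map f f) (edg c p q) := by
  obtain ⟨a, b⟩ := c
  cases b <;> rfl

theorem strandE_eq_image (c : Fin (n+1) → Fin r × Bool) (f : StrandIdx j n → V)
    (S : Finset (Fin j)) :
    strandE c f S = (strandE c id S).image (Prod.map id (Prod.map f f)) := by
  rw [strandE, strandE, image_union, innerE, innerE, lastE, lastE, image_image, image_image]
  congr 1
  · exact image_congr fun x _ => edg_map _ f _ _
  · exact image_congr fun x _ => edg_map _ f _ _

theorem card_image_eq_of_ker {A B C : Type} [DecidableEq B] [DecidableEq C] (s : Finset A)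
    (F : A → B) (G : A → C) (h : ∀ x y, F x = F y ↔ G x = G y) :
    #(s.image F) = #(s.image G) := by
  classical
  refine card_bij' (fun b hb => G (mem_image.1 hb).choose)
    (fun b hb => F (mem_image.1 hb).choose) ?_ ?_ ?_ ?_
  · intro b hb; exact mem_image_of_mem _ (mem_image.1 hb).choose_spec.1
  · intro b hb; exact mem_image_of_mem _ (mem_image.1 hb).choose_spec.1
  · intro b hb
    have h1 := (mem_image.1 hb).choose_spec
    have h2 := (mem_image.1 (mem_image_of_mem G h1.1)).choose_spec
    exact ((h _ _).2 h2.2).trans h1.2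
  · intro b hb
    have h1 := (mem_image.1 hb).choose_spec
    have h2 := (mem_image.1 (mem_image_of_mem F h1.1)).choose_spec
    exact ((h _ _).1 h2.2).trans h1.2

theorem consE_strandE_iff (c : Fin (n+1) → Fin r × Bool) (f : StrandIdx j n → V)
    (S : Finset (Fin j)) : ConsE (strandE c f S) ↔
      ∀ e ∈ strandE c (id : StrandIdx j n → _) S, ∀ e' ∈ strandE c (id : StrandIdx j n → _) S,
        e.1 = e'.1 → (f e.2.1 = f e'.2.1 ↔ f e.2.2 = f e'.2.2) := by
  rw [strandE_eq_image]
  constructor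
  · intro h e he e' he' hee
    refine h e.1 _ _ _ _ (mem_image_of_mem _ he) ?_
    rw [hee]
    exact mem_image_of_mem _ he'
  · intro h a p q p' q' h1 h2
    obtain ⟨e, he, h1⟩ := mem_image.1 h1
    obtain ⟨e', he', h2⟩ := mem_image.1 h2
    simp only [Prod.map, Prod.mk.injEq, id] at h1 h2
    obtain ⟨h3, rfl, rfl⟩ := h1
    obtain ⟨h4, rfl, rfl⟩ := h2
    exact h e he e' he' (h3.trans h4.symm)

section
variable (c : Fin (n+1) → Fin r × Bool) (f : StrandIdx j n → V) (g : StrandIdx j n → W)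

theorem consE_strandE_congr (h : ∀ x y, f x = f y ↔ g x = g y)
    (S : Finset (Fin j)) :
    ConsE (strandE c f S) ↔ ConsE (strandE c g S) := by
  simp only [consE_strandE_iff, h]

theorem card_label_congr (h : ∀ x y, f x = f y ↔ g x = g y)
    (S : Finset (Fin j)) (a : Fin r) :
    #((strandE c f S).filter fun e => e.1 = a) = #((strandE c g S).filter fun e => e.1 = a) := by
  rw [strandE_eq_image c f, strandE_eq_image c g, filter_image, filter_image]
  refine card_image_eq_of_ker _ _ _ fun x y => ?_
  simp [Prod.map, h]

theorem goodF_congr (h : ∀ x y, f x = f y ↔ g x = g y) : goodF f ↔ goodF g := by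
  constructor
  · intro hf x y hxy; exact hf ((h _ _).2 hxy)
  · intro hf x y hxy; exact hf ((h _ _).1 hxy)

end

/-- Two functions have the same kernel. -/
def SameKer (f : I → V) (g : I → W) : Prop := ∀ x y, f x = f y ↔ g x = g y

theorem SameKer.symm {f : I → V} {g : I → W} (h : SameKer f g) : SameKer g f :=
  fun x y => (h x y).symm

theorem SameKer.trans {U : Type} {f : I → V} {g : I → W} {k : I → U} (h : SameKer f g)
    (h' : SameKer g k) : SameKer f k := fun x y => (h x y).trans (h' x y)

theorem exists_sameKer (f : I → V) : ∃ g : I → I, SameKer f g := by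
  classical
  rcases isEmpty_or_nonempty I with hI | hI
  · exact ⟨id, fun x => isEmptyElim x⟩
  · refine ⟨fun x => Function.invFun f (f x), fun x y => ⟨fun h => by simp only [h], fun h => ?_⟩⟩
    have h1 := Function.invFun_eq (f := f) ⟨x, rfl⟩
    have h2 := Function.invFun_eq (f := f) ⟨y, rfl⟩
    simp only at h
    rw [← h1, h, h2]

open Classical in
theorem card_sameKer [Fintype I] [DecidableEq I] [Fintype V] (g : I → W) :
    #(univ.filter fun f : I → V => SameKer f g) =
      (Fintype.card V).descFactorial (#(univ.image g)) := by
  have : (Fintype.card V).descFactorial (#(univ.image g)) =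
      Fintype.card (↥(univ.image g) ↪ V) := by
    rw [Fintype.card_embedding_eq, Fintype.card_coe]
  rw [this, ← card_univ]
  refine card_bij' (fun f hf => ⟨fun y => f (mem_image.1 y.2).choose, fun y z hyz => ?_⟩)
    (fun e _ => fun x => e ⟨g x, mem_image_of_mem _ (mem_univ _)⟩) ?_ ?_ ?_ ?_
  · have hf := (mem_filter.1 hf).2
    have h1 := (mem_image.1 y.2).choose_spec.2
    have h2 := (mem_image.1 z.2).choose_spec.2
    exact Subtype.ext (h1.symm.trans (((hf _ _).1 hyz).trans h2))
  · intro f _; exact mem_univ _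
  · intro e _
    refine mem_filter.2 ⟨mem_univ _, fun x y => ?_⟩
    simp
  · intro f hf
    have hf := (mem_filter.1 hf).2
    funext x
    have h1 := (mem_image.1 (mem_image_of_mem g (mem_univ x))).choose_spec.2
    exact (hf _ _).2 h1
  · intro e _
    refine Function.Embedding.ext fun y => ?_
    exact congrArg e (Subtype.ext (mem_image.1 y.2).choose_spec.2)

open Classical in
/-- The number of self-maps of the index set with the same kernel. -/
def kerMult [Fintype I] [DecidableEq I] (g : I → I) : ℕ := #(univ.filter fun g' : I → I => SameKer g g')

open Classical in
theorem sum_eq_sum_sameKer [Fintype I] [DecidableEq I] [Fintype V] (T : (I → V) → ℝ) :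
    ∑ f, T f = ∑ g : I → I, (kerMult g : ℝ)⁻¹ *
      ∑ f ∈ univ.filter (fun f : I → V => SameKer f g), T f := by
  simp only [mul_sum, sum_filter, mul_ite, mul_zero]
  rw [sum_comm]
  refine sum_congr rfl fun f _ => ?_
  rw [← sum_filter]
  obtain ⟨g0, h0⟩ := exists_sameKer f
  have h1 : ∀ g ∈ univ.filter (fun g : I → I => SameKer f g),
      (kerMult g : ℝ)⁻¹ * T f = (kerMult g0 : ℝ)⁻¹ * T f := by
    intro g hg
    have hg := (mem_filter.1 hg).2
    have : kerMult g = kerMult g0 := by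
      rw [kerMult, kerMult]
      congr 1
      ext g'
      simp only [mem_filter, mem_univ, true_and]
      exact ⟨fun h => h0.symm.trans (hg.trans h), fun h => hg.symm.trans (h0.trans h)⟩
    rw [this]
  have h2 : #(univ.filter (fun g : I → I => SameKer f g)) = kerMult g0 := by
    rw [kerMult]
    congr 1
    ext g'
    simp only [mem_filter, mem_univ, true_and]
    exact ⟨fun h => h0.symm.trans h, fun h => h0.trans h⟩
  rw [sum_congr rfl h1, sum_const, nsmul_eq_mul, h2, ← mul_assoc, mul_inv_cancel₀, one_mul]
  have : g0 ∈ univ.filter (fun g : I → I => SameKer g0 g) :=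
    mem_filter.2 ⟨mem_univ _, fun _ _ => Iff.rfl⟩
  exact_mod_cast (card_pos.2 ⟨_, this⟩).ne'

open Polynomial in
theorem exists_poly_sum_Psi (j : ℕ) (c : Fin (n+1) → Fin r × Bool) (E : ℕ)
    (hE : j * (n + 1) + j ≤ E) : ∃ p : ℝ[X], ∀ N, E ≤ N →
      (∑ σ : Fin r → Equiv.Perm (Fin N), Psi j (Wp σ (List.ofFn c))) *
        ((N.descFactorial E : ℝ)) ^ r = (N.factorial : ℝ) ^ r * p.eval (N : ℝ) := by
  classical
  refine ⟨∑ g : StrandIdx j n → StrandIdx j n, C ((kerMult g : ℝ)⁻¹) *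
    (descPochhammer ℝ (#(univ.image g)) * (if goodF g then ∑ S : Finset (Fin j), C ((-1:ℝ)^(#S)) *
      (if ConsE (strandE c g S) then
        ∏ a, (descPochhammer ℝ (E - #((strandE c g S).filter fun e => e.1 = a))).comp
          (X - ((#((strandE c g S).filter fun e => e.1 = a) : ℕ) : ℝ[X])) else 0) else 0)),
    fun N hN => ?_⟩
  rw [sum_Psi, sum_filter, sum_eq_sum_sameKer, sum_mul, eval_finsetSum, mul_sum]
  refine sum_congr rfl fun g _ => ?_
  rw [eval_mul, eval_C, mul_left_comm, mul_assoc]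
  congr 1
  rw [eval_mul, descPochhammer_eval_eq_descFactorial]
  have hk := card_sameKer (V := Fin N) g
  rw [Fintype.card_fin] at hk
  rw [← hk, sum_mul, mul_left_comm, ← nsmul_eq_mul, ← sum_const]
  refine sum_congr rfl fun f hf => ?_
  have hf := (mem_filter.1 hf).2
  have hg := goodF_congr f g hf
  by_cases hgood : goodF g
  · rw [if_pos hgood, if_pos (hg.2 hgood), eval_finsetSum, mul_sum, sum_mul]
    refine sum_congr rfl fun S _ => ?_
    rw [eval_mul, eval_C, mul_left_comm, mul_assoc]
    congr 1
    have hc := consE_strandE_congr c f g hf S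
    by_cases hcons : ConsE (strandE c g S)
    · rw [if_pos hcons, cntE_eq _ (hc.2 hcons), eval_prod, Nat.cast_prod]
      have hr : ∀ x : ℝ, x ^ r = ∏ _a : Fin r, x := by simp
      rw [hr, hr, ← prod_mul_distrib, ← prod_mul_distrib]
      refine prod_congr rfl fun a _ => ?_
      rw [card_label_congr c f g hf S a, Fintype.card_fin]
      set e := #((strandE c g S).filter fun e => e.1 = a)
      have heE : e ≤ E := (card_filter_le _ _).trans ((card_strandE_le c g S).trans hE)
      have h1 := Nat.factorial_mul_descFactorial (heE.trans hN)
      have h2 := congrArg (eval (N : ℝ)) (descPochhammer_mul (R := ℝ) e (E - e))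
      rw [eval_mul, Nat.add_sub_cancel' heE, descPochhammer_eval_eq_descFactorial,
        descPochhammer_eval_eq_descFactorial] at h2
      rw [← h2, ← h1]
      push_cast
      ring
    · rw [if_neg hcons, cntE_eq_zero _ (fun h => hcons (hc.1 h))]
      simp
  · rw [if_neg hgood, if_neg (fun h => hgood (hg.1 h))]
    simp

open Polynomial in
theorem natDegree_le_of_abs_eval_le (p : ℝ[X]) (C : ℝ) (k M : ℕ)
    (h : ∀ N : ℕ, M ≤ N → |p.eval (N : ℝ)| ≤ C * (N : ℝ) ^ k) : p.natDegree ≤ k := by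
  by_contra! hlt
  have h1 := p.abs_div_tendsto_atTop_atTop_of_degree_gt (X ^ k)
    (by rw [degree_X_pow, degree_eq_natDegree (by rintro rfl; simp at hlt)]; exact_mod_cast hlt)
    (pow_ne_zero _ X_ne_zero)
  have h2 := (h1.comp tendsto_natCast_atTop_atTop).eventually_gt_atTop C
  obtain ⟨N, hN, hN1, hN2⟩ := (h2.and ((Filter.eventually_ge_atTop M).and
    (Filter.eventually_ge_atTop 1))).exists
  have hN0 : (0:ℝ) < (N:ℝ)^k := by positivity
  have h3 := h N hN1
  simp only [Function.comp, eval_pow, eval_X, abs_div, abs_of_pos hN0] at hN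
  rw [lt_div_iff₀ hN0] at hN
  linarith

open Polynomial in
/-- Normalised expectations of `Psi` along a good word are rational with numerator of controlled
degree. -/
theorem exists_poly_sum_Psi_word (j : ℕ) (w : List (Fin r × Bool)) (hw : FreeGroup.IsReduced w)
    (hg : GoodWord w) (E : ℕ) (hE : j * (w.length + 1) ≤ E) : ∃ p : ℝ[X], p.natDegree ≤ r * E ∧
      ∀ N, E ≤ N → (∑ σ : Fin r → Equiv.Perm (Fin N), Psi j (Wp σ w)) *
        ((N.descFactorial E : ℝ)) ^ r = (N.factorial : ℝ) ^ r * p.eval (N : ℝ) := by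
  obtain ⟨n, c, g, H, hn, hconj, hinj, hmin, hred, hs, hi⟩ := exists_height w hw hg
  have hP : ∀ (N : ℕ) (σ : Fin r → Equiv.Perm (Fin N)), Psi j (Wp σ w) =
    Psi j (Wp σ (List.ofFn c)) := fun N σ => Psi_Wp_conj j σ w g _ hconj
  have hE' : j * (n + 1) + j ≤ E := by
    refine le_trans ?_ hE
    rw [← Nat.mul_succ]
    exact Nat.mul_le_mul_left _ (by omega)
  obtain ⟨p, hp⟩ := exists_poly_sum_Psi j c E hE'
  obtain ⟨C, hC⟩ := exists_sum_Psi_le j c H hinj hmin hred hs hi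
  refine ⟨p, ?_, fun N hN => by simp only [hP]; exact hp N hN⟩
  refine natDegree_le_of_abs_eval_le p C _ (2 * E + 2) fun N hN => ?_
  have h1 := hC N (by omega) (by omega)
  have h2 := hp N (by omega)
  have h3 : (0:ℝ) < (N.factorial : ℝ) ^ r := by positivity
  have h4 : (N.descFactorial E : ℝ)^r ≤ (N:ℝ)^(r * E) := by
    rw [mul_comm r E, pow_mul]
    gcongr
    exact_mod_cast Nat.descFactorial_le_pow N E
  have h5 : (0:ℝ) ≤ (N.descFactorial E : ℝ)^r := by positivity
  have hC0 : 0 ≤ C := by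
    have := (abs_nonneg _).trans h1
    exact nonneg_of_mul_nonneg_left this h3
  have h6 := congrArg abs h2
  rw [abs_mul, abs_mul, abs_of_nonneg h5, abs_of_pos h3] at h6
  have h7 : (N.factorial : ℝ)^r * |p.eval (N:ℝ)| ≤ (N.factorial:ℝ)^r * (C * (N:ℝ)^(r*E)) := by
    rw [← h6]
    calc _ ≤ C * (N.factorial : ℝ)^r * (N:ℝ)^(r*E) := by gcongr
      _ = _ := by ring
  exact le_of_mul_le_mul_left h7 h3

end

end

section

open Finset Matrix

noncomputable section
set_option linter.unusedSectionVars false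
variable {j : ℕ} {V : Type} [Fintype V] [DecidableEq V]

/-- The real matrix of the action of a permutation on tuples. -/
def actR (j : ℕ) (τ : Equiv.Perm V) : Matrix (Fin j ↪ V) (Fin j ↪ V) ℝ :=
  Matrix.of fun x y => if y = x.trans τ.toEmbedding then 1 else 0

theorem actR_mulVec (τ : Equiv.Perm V) (f : (Fin j ↪ V) → ℝ) (x : Fin j ↪ V) :
    (actR j τ *ᵥ f) x = f (x.trans τ.toEmbedding) := by
  simp [actR, mulVec, dotProduct]

theorem actR_mul (σ τ : Equiv.Perm V) : actR j σ * actR j τ = actR j (τ * σ) := by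
  ext x z
  simp only [actR, mul_apply, of_apply, ite_mul, one_mul, zero_mul, sum_ite_eq', mem_univ, if_true]
  rfl

theorem actR_one : actR j (1 : Equiv.Perm V) = 1 := by
  ext x y
  have : x.trans (Equiv.toEmbedding (1 : Equiv.Perm V)) = x := rfl
  simp only [actR, of_apply, this, Matrix.one_apply, eq_comm]

theorem actR_transpose (τ : Equiv.Perm V) : (actR j τ)ᵀ = actR j τ⁻¹ := by
  ext x y
  simp only [actR, transpose_apply, of_apply]
  refine if_congr ?_ rfl rfl
  constructor
  · rintro rfl; ext i; simp
  · rintro rfl; ext i; simp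

/-- The product test vector attached to pairs of points. -/
def aVec (e : (Fin j × Bool) ↪ V) (y : Fin j ↪ V) : ℝ :=
  ∏ i, ((if y i = e (i, false) then (1:ℝ) else 0) - (if y i = e (i, true) then 1 else 0))

/-- Selecting one point in each pair. -/
def sel (e : (Fin j × Bool) ↪ V) (b : Fin j → Bool) : Fin j ↪ V :=
  ⟨fun i => e (i, b i), fun i i' h => by simpa using (congrArg Prod.fst (e.injective h))⟩

theorem sel_apply (e : (Fin j × Bool) ↪ V) (b : Fin j → Bool) (i : Fin j) :
    sel e b i = e (i, b i) := rfl

/-- The sign of a selection. -/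
def selSgn (b : Fin j → Bool) : ℝ := ∏ i, if b i then -1 else 1

theorem aVec_eq_sum (e : (Fin j × Bool) ↪ V) (y : Fin j ↪ V) :
    aVec e y = ∑ b : Fin j → Bool, if y = sel e b then selSgn b else 0 := by
  have : ∀ i, ((if y i = e (i, false) then (1:ℝ) else 0) - (if y i = e (i, true) then 1 else 0)) =
      ∑ c : Bool, (if c then (-1:ℝ) else 1) * (if y i = e (i, c) then 1 else 0) := by
    intro i
    rw [Fintype.sum_bool]
    simp only [if_true, Bool.false_eq_true, if_false]; ring
  rw [aVec]
  simp only [this]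
  rw [Finset.prod_univ_sum, Fintype.piFinset_univ]
  refine sum_congr rfl fun b _ => ?_
  rw [prod_mul_distrib, Finset.prod_boole, selSgn]
  have : (∀ i ∈ univ, y i = e (i, b i)) ↔ y = sel e b := by
    constructor
    · intro h; ext i; exact h i (mem_univ _)
    · rintro rfl i _; rfl
  simp only [this]
  split_ifs <;> simp

theorem aVec_dotProduct (e : (Fin j × Bool) ↪ V) (G : (Fin j ↪ V) → ℝ) :
    aVec e ⬝ᵥ G = ∑ b : Fin j → Bool, selSgn b * G (sel e b) := by
  simp only [dotProduct, aVec_eq_sum, sum_mul, ite_mul, zero_mul]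
  rw [sum_comm]
  simp

/-- Exchanging the points in some of the pairs. -/
def flipW (b : Fin j → Bool) : (Fin j × Bool) ≃ (Fin j × Bool) where
  toFun x := (x.1, xor x.2 (b x.1))
  invFun x := (x.1, xor x.2 (b x.1))
  left_inv x := by simp
  right_inv x := by simp

theorem aVec_flipW (b : Fin j → Bool) (e : (Fin j × Bool) ↪ V) (y : Fin j ↪ V) :
    aVec ((flipW b).toEmbedding.trans e) y = selSgn b * aVec e y := by
  rw [aVec, aVec, selSgn, ← prod_mul_distrib]
  refine prod_congr rfl fun i _ => ?_
  cases h : b i <;> simp [flipW, h]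

theorem sel_flipW (b : Fin j → Bool) (e : (Fin j × Bool) ↪ V) :
    sel ((flipW b).toEmbedding.trans e) (fun _ => false) = sel e b := by
  ext i
  simp [sel_apply, flipW]

theorem sum_aVec_form (K : Matrix (Fin j ↪ V) (Fin j ↪ V) ℝ) :
    ∑ e : (Fin j × Bool) ↪ V, aVec e ⬝ᵥ (K *ᵥ aVec e) =
      2 ^ j * ∑ e : (Fin j × Bool) ↪ V, (K *ᵥ aVec e) (sel e fun _ => false) := by
  simp only [aVec_dotProduct]
  rw [sum_comm]
  have : ∀ b : Fin j → Bool, ∑ e : (Fin j × Bool) ↪ V, selSgn b * (K *ᵥ aVec e) (sel e b) =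
      ∑ e : (Fin j × Bool) ↪ V, (K *ᵥ aVec e) (sel e fun _ => false) := by
    intro b
    refine Fintype.sum_equiv (Equiv.embeddingCongr (flipW b).symm (Equiv.refl V)) _ _ fun e => ?_
    have h : Equiv.embeddingCongr (flipW b).symm (Equiv.refl V) e =
      (flipW b).toEmbedding.trans e := by ext x; simp
    rw [h, sel_flipW]
    simp only [mulVec, dotProduct, aVec_flipW, mul_sum]
    exact sum_congr rfl fun _ _ => by ring
  simp [this]

theorem sum_aVec_actR (τ : Equiv.Perm V) :
    ∑ e : (Fin j × Bool) ↪ V, (actR j τ *ᵥ aVec e) (sel e fun _ => false) = Psi j τ := by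
  rw [Psi]
  refine sum_congr rfl fun e _ => ?_
  rw [actR_mulVec]
  rfl

/-- All one-coordinate marginals vanish. -/
def ZeroMarg (f : (Fin j ↪ V) → ℝ) : Prop :=
  ∀ (i : Fin j) (x0 : Fin j ↪ V), ∑ x ∈ univ.filter (fun x : Fin j ↪ V => ∀ i', i' ≠ i → x i' = x0 i'), f x = 0

theorem ZeroMarg.sum_erase {f : (Fin j ↪ V) → ℝ} (hf : ZeroMarg f) (i : Fin j)
    (u : Fin j → V → ℝ) : ∑ x, f x * ∏ i' ∈ univ.erase i, u i' (x i') = 0 := by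
  classical
  rw [← sum_fiberwise (s := univ) (g := fun (x : Fin j ↪ V) (t : {i' // i' ≠ i}) => x t)]
  refine sum_eq_zero fun k _ => ?_
  by_cases hk : ∃ x0 : Fin j ↪ V, (fun t : {i' // i' ≠ i} => x0 t) = k
  · obtain ⟨x0, rfl⟩ := hk
    have : ∀ x ∈ univ.filter (fun x : Fin j ↪ V => (fun t : {i' // i' ≠ i} => x t) =
        fun t : {i' // i' ≠ i} => x0 t), f x * ∏ i' ∈ univ.erase i, u i' (x i') =
        f x * ∏ i' ∈ univ.erase i, u i' (x0 i') := by
      intro x hx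
      have hx := (mem_filter.1 hx).2
      congr 1
      refine prod_congr rfl fun i' hi' => ?_
      rw [show x i' = x0 i' from congrFun hx ⟨i', ne_of_mem_erase hi'⟩]
    rw [sum_congr rfl this, ← sum_mul]
    have h2 := hf i x0
    convert zero_mul _ using 2
    rw [← h2]
    refine sum_congr (filter_congr fun x _ => ?_) fun _ _ => rfl
    rw [funext_iff]
    simp
  · refine sum_eq_zero fun x hx => ?_
    exact absurd ⟨x, (mem_filter.1 hx).2⟩ hk

theorem ZeroMarg.sum_shift {f : (Fin j ↪ V) → ℝ} (hf : ZeroMarg f) (u : Fin j → V → ℝ)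
    (T : Finset (Fin j)) :
    ∑ x, f x * ∏ i, u i (x i) = ∑ x, f x * ∏ i, (u i (x i) - if i ∈ T then 1 else 0) := by
  induction T using Finset.induction_on with
  | empty => simp
  | insert i T hi ih =>
    rw [ih]
    have h := hf.sum_erase i fun i' v => u i' v - if i' ∈ T then 1 else 0
    refine sub_eq_zero.1 (Eq.trans ?_ h)
    rw [← sum_sub_distrib]
    refine sum_congr rfl fun x _ => ?_
    rw [← mul_sub]
    congr 1
    rw [← mul_prod_erase univ _ (mem_univ i), ← mul_prod_erase univ _ (mem_univ i)]
    have : ∏ i' ∈ univ.erase i, (u i' (x i') - if i' ∈ insert i T then 1 else 0) =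
        ∏ i' ∈ univ.erase i, (u i' (x i') - if i' ∈ T then 1 else 0) := by
      refine prod_congr rfl fun i' hi' => ?_
      simp [ne_of_mem_erase hi']
    rw [this]
    simp only [hi, if_false, mem_insert_self, if_true]
    ring

theorem card_embedding_extending {W : Type} [Fintype W] [DecidableEq W] (D : Finset W) (y : W → V)
    (hy : Set.InjOn y D) :
    #(univ.filter fun e : W ↪ V => ∀ d ∈ D, e d = y d) =
      (Fintype.card V - #D).descFactorial (Fintype.card W - #D) := by
  have h1 : Fintype.card {w // w ∉ D} = Fintype.card W - #D := by
    rw [Fintype.card_subtype_compl, Fintype.card_coe]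
  have h2 : Fintype.card {v // v ∉ D.image y} = Fintype.card V - #D := by
    rw [Fintype.card_subtype_compl, Fintype.card_coe, card_image_of_injOn hy]
  rw [← h1, ← h2, ← Fintype.card_embedding_eq, ← card_univ]
  refine card_bij' (fun e he => ⟨fun w => ⟨e w, fun hw => ?_⟩, fun w w' h => ?_⟩)
    (fun g _ => ⟨fun w => if h : w ∈ D then y w else g ⟨w, h⟩, fun w w' h => ?_⟩) ?_ ?_ ?_ ?_
  · obtain ⟨d, hd, hde⟩ := mem_image.1 hw
    have := (mem_filter.1 he).2 d hd
    rw [← this] at hde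
    exact w.2 (e.injective hde ▸ hd)
  · exact Subtype.ext (e.injective (congrArg Subtype.val h))
  · simp only at h
    by_cases hw : w ∈ D <;> by_cases hw' : w' ∈ D <;> simp only [hw, hw', dif_pos, dif_neg,
      not_false_eq_true] at h
    · exact hy hw hw' h
    · exact absurd (mem_image_of_mem y hw) (h ▸ (g ⟨w', hw'⟩).2)
    · exact absurd (mem_image_of_mem y hw') (h ▸ (g ⟨w, hw⟩).2)
    · simpa using g.injective (Subtype.ext h)
  · intro e _; exact mem_univ _
  · intro g _
    refine mem_filter.2 ⟨mem_univ _, fun d hd => ?_⟩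
    exact dif_pos hd
  · intro e he
    refine Function.Embedding.ext fun w => ?_
    by_cases hw : w ∈ D
    · exact (dif_pos hw).trans ((mem_filter.1 he).2 w hw).symm
    · exact dif_neg hw
  · intro g _
    exact Function.Embedding.ext fun w => Subtype.ext (dif_neg w.2)

/-- The pairs of tuples `(x, z)` that are selected, by the constant choice and by `b`, from some
family of pairs. -/
def Compat (b : Fin j → Bool) (x z : Fin j ↪ V) : Prop :=
  ∀ i, if b i then ∀ i', z i ≠ x i' else z i = x i

/-- The number of families of pairs with prescribed selections. -/
def compatMult (V : Type) [Fintype V] (b : Fin j → Bool) : ℕ :=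
  (Fintype.card V - #(univ.filter fun x : Fin j × Bool => x.2 = true → b x.1 = true)).descFactorial
    (Fintype.card (Fin j × Bool) - #(univ.filter fun x : Fin j × Bool => x.2 = true → b x.1 = true))

open Classical in
theorem card_sel_eq (b : Fin j → Bool) (x z : Fin j ↪ V) :
    #(univ.filter fun e : (Fin j × Bool) ↪ V => sel e (fun _ => false) = x ∧ sel e b = z) =
      if Compat b x z then compatMult V b else 0 := by
  split_ifs with h
  · rw [compatMult, ← card_embedding_extending _ (fun w => if w.2 then z w.1 else x w.1)]
    · congr 1
      ext e
      simp only [mem_filter, mem_univ, true_and]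
      constructor
      · rintro ⟨rfl, rfl⟩ ⟨i, c⟩ hd
        cases c
        · simp [sel_apply]
        · simp at hd
          simp [sel_apply, hd]
      · intro he
        refine ⟨?_, ?_⟩
        · ext i; exact he (i, false) (by simp)
        · ext i
          have := h i
          cases hb : b i
          · simp only [hb, Bool.false_eq_true, if_false] at this
            have h2 := he (i, false) (by simp)
            simp [sel_apply, hb, this, h2]
          · have h2 := he (i, true) (by simp [hb])
            simp [sel_apply, hb, h2]
    · rintro ⟨i, c⟩ h1 ⟨i', c'⟩ h2 h3
      simp only [coe_filter, mem_univ, true_and, Set.mem_ofPred_eq] at h1 h2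
      have hi := h i
      have hi' := h i'
      cases c <;> cases c' <;> simp at h1 h2 h3 ⊢
      · exact h3
      · simp only [h2, if_true] at hi'
        exact hi' i h3.symm
      · simp only [h1, if_true] at hi
        exact hi i' h3
      · exact h3
  · rw [card_eq_zero, filter_eq_empty_iff]
    rintro e - ⟨rfl, rfl⟩
    apply h
    intro i
    cases hb : b i <;> simp [sel_apply, hb]

open Classical in
theorem ZeroMarg.sum_compat {f : (Fin j ↪ V) → ℝ} (hf : ZeroMarg f) (b : Fin j → Bool)
    (x : Fin j ↪ V) : ∑ z, f z * (if Compat b x z then 1 else 0) =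
      selSgn b * ∑ z, f z * (if (∀ i, b i = false → z i = x i) ∧ univ.map z = univ.map x
        then 1 else 0) := by
  obtain ⟨U, hU⟩ : ∃ U : Fin j → V → ℝ, ∀ i v, U i v =
      if (if b i then ∀ i', v ≠ x i' else v = x i) then 1 else 0 := ⟨_, fun _ _ => rfl⟩
  have h1 : ∀ z : Fin j ↪ V, (if Compat b x z then (1:ℝ) else 0) = ∏ i, U i (z i) := by
    intro z
    simp only [hU]
    rw [Finset.prod_boole]
    simp [Compat]
  simp only [h1]
  rw [hf.sum_shift _ (univ.filter fun i => b i = true), mul_sum]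
  refine sum_congr rfl fun z _ => ?_
  rw [mul_left_comm]
  congr 1
  have h2 : ∀ i, (U i (z i) - if i ∈ univ.filter fun i => b i = true then 1 else 0) =
      (if b i then -1 else 1) *
        (if (if b i then ∃ i', z i = x i' else z i = x i) then 1 else 0) := by
    intro i
    rw [hU]
    cases h : b i
    · simp [h]
    · by_cases h' : ∃ i', z i = x i'
      · have : ¬ ∀ i', z i ≠ x i' := by push Not; exact h'
        simp [h, h', this]
      · have : ∀ i', z i ≠ x i' := by push Not at h'; exact h'
        simp [h, this]
  simp only [h2]
  rw [prod_mul_distrib, selSgn]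
  congr 1
  refine Finset.prod_boole.trans ?_
  refine @if_congr _ _ _ (_) (_) _ _ _ _ ?_ rfl rfl
  simp only [mem_univ, true_implies]
  constructor
  · intro h
    refine ⟨fun i hi => by have := h i; simpa [hi] using this, ?_⟩
    refine eq_of_subset_of_card_le ?_ (by simp)
    intro v hv
    obtain ⟨i, -, rfl⟩ := mem_map.1 hv
    have := h i
    cases hb : b i
    · simp only [hb, Bool.false_eq_true, if_false] at this
      rw [this]; exact mem_map_of_mem _ (mem_univ _)
    · simp only [hb, if_true] at this
      obtain ⟨i', hi'⟩ := this
      rw [hi']; exact mem_map_of_mem _ (mem_univ _)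
  · rintro ⟨h3, h4⟩ i
    cases hb : b i
    · simpa using h3 i hb
    · have : z i ∈ univ.map x := h4 ▸ mem_map_of_mem _ (mem_univ _)
      obtain ⟨i', -, hi'⟩ := mem_map.1 this
      simpa using ⟨i', hi'.symm⟩

theorem selSgn_mul_self (b : Fin j → Bool) : selSgn b * selSgn b = 1 := by
  rw [selSgn, ← prod_mul_distrib]
  refine prod_eq_one fun i _ => ?_
  split_ifs <;> norm_num

theorem sum_mul_ker_nonneg {X K : Type} [Fintype X] [DecidableEq K] (f : X → ℝ) (π : X → K) :
    0 ≤ ∑ x, f x * ∑ z, f z * (if π z = π x then 1 else 0) := by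
  have : ∑ x, f x * ∑ z, f z * (if π z = π x then 1 else 0) =
      ∑ k ∈ univ.image π, (∑ x ∈ univ.filter (fun x => π x = k), f x) ^ 2 := by
    rw [← sum_fiberwise_of_maps_to (g := π) (t := univ.image π)
      (fun x _ => mem_image_of_mem _ (mem_univ x))]
    refine sum_congr rfl fun k _ => ?_
    rw [sq, sum_mul]
    refine sum_congr rfl fun x hx => ?_
    rw [(mem_filter.1 hx).2, sum_filter]
    simp
  rw [this]
  exact sum_nonneg fun _ _ => sq_nonneg _

theorem ZeroMarg.sum_sq_lower {f : (Fin j ↪ V) → ℝ} (hf : ZeroMarg f) :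
    2 ^ j * ((Fintype.card V - j).descFactorial j : ℝ) * (f ⬝ᵥ f) ≤
      ∑ e : (Fin j × Bool) ↪ V, (aVec e ⬝ᵥ f) ^ 2 := by
  classical
  have h1 : ∀ e : (Fin j × Bool) ↪ V, (aVec e ⬝ᵥ f) ^ 2 =
      aVec e ⬝ᵥ (vecMulVec f f *ᵥ aVec e) := by
    intro e
    rw [vecMulVec_mulVec, dotProduct_smul, dotProduct_comm f, sq]
    simp
  have h2 : ∀ e : (Fin j × Bool) ↪ V, (vecMulVec f f *ᵥ aVec e) (sel e fun _ => false) =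
      ∑ b, selSgn b * (f (sel e fun _ => false) * f (sel e b)) := by
    intro e
    rw [vecMulVec_mulVec, dotProduct_comm f, aVec_dotProduct]
    simp only [Pi.smul_apply, MulOpposite.smul_eq_mul_unop, MulOpposite.unop_op, mul_sum]
    exact sum_congr rfl fun _ _ => by ring
  simp only [h1]
  rw [sum_aVec_form, mul_assoc]
  refine mul_le_mul_of_nonneg_left ?_ (by positivity)
  simp only [h2]
  rw [sum_comm]
  have h3 : ∀ b : Fin j → Bool, ∑ e : (Fin j × Bool) ↪ V,
      selSgn b * (f (sel e fun _ => false) * f (sel e b)) = (compatMult V b : ℝ) *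
      ∑ x, f x * ∑ z, f z * (if (∀ i, b i = false → z i = x i) ∧ univ.map z = univ.map x
        then 1 else 0) := by
    intro b
    have h4 : ∑ e : (Fin j × Bool) ↪ V, f (sel e fun _ => false) * f (sel e b) =
        ∑ x, ∑ z, (f x * f z) * #(univ.filter fun e : (Fin j × Bool) ↪ V =>
          sel e (fun _ => false) = x ∧ sel e b = z) := by
      simp only [card_filter, Nat.cast_sum, mul_sum, Nat.cast_ite, Nat.cast_one, Nat.cast_zero,
        mul_ite, mul_one, mul_zero]
      rw [sum_congr rfl fun x _ => sum_comm, sum_comm]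
      refine sum_congr rfl fun e _ => ?_
      simp [ite_and]
    rw [← mul_sum, h4]
    simp only [card_sel_eq]
    have h5 : ∀ x z : Fin j ↪ V, f x * f z * ((if Compat b x z then compatMult V b else 0 : ℕ) : ℝ) =
        compatMult V b * (f x * (f z * (if Compat b x z then 1 else 0))) := by
      intro x z
      split_ifs <;> simp
      ring
    simp only [h5, ← mul_sum, hf.sum_compat]
    simp only [mul_left_comm _ (selSgn b), ← mul_sum]
    rw [← mul_assoc, selSgn_mul_self, one_mul]
  simp only [h3]
  have h6 : ∀ b : Fin j → Bool, 0 ≤ (compatMult V b : ℝ) *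
      ∑ x, f x * ∑ z, f z * (if (∀ i, b i = false → z i = x i) ∧ univ.map z = univ.map x
        then 1 else 0) := by
    intro b
    refine mul_nonneg (by positivity) ?_
    have := sum_mul_ker_nonneg f (fun x : Fin j ↪ V =>
      ((fun i : {i // b i = false} => x i), univ.map x))
    simpa only [Prod.mk.injEq, funext_iff, Subtype.forall] using this
  refine le_trans (le_of_eq ?_) (single_le_sum (fun b _ => h6 b) (mem_univ fun _ => false))
  have h7 : compatMult V (fun _ : Fin j => false) = (Fintype.card V - j).descFactorial j := by
    have : #(univ.filter fun x : Fin j × Bool => x.2 = true → false = true) = j := by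
      have : (univ.filter fun x : Fin j × Bool => x.2 = true → false = true) =
          univ ×ˢ {false} := by
        ext ⟨i, c⟩; cases c <;> simp
      rw [this]; simp
    rw [compatMult, this]
    congr 1
    simp; omega
  rw [h7]
  congr 1
  refine sum_congr rfl fun x _ => ?_
  congr 1
  rw [sum_eq_single x]
  · simp
  · intro z _ hz
    rw [if_neg, mul_zero]
    exact fun h => hz (by ext i; exact h.1 i rfl)
  · simp

end

end

section

open Finset Matrix Polynomial

noncomputable section
set_option linter.unusedSectionVars false

section symm
variable {X : Type} [Fintype X] [DecidableEq X]

theorem aeval_mulVec_of_eigen (M : Matrix X X ℝ) (v : X → ℝ) (t : ℝ) (h : M *ᵥ v = t • v)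
    (p : ℝ[X]) : aeval M p *ᵥ v = p.eval t • v := by
  have hpow : ∀ n : ℕ, M ^ n *ᵥ v = t ^ n • v := by
    intro n
    induction n with
    | zero => simp
    | succ n ih => rw [pow_succ, ← mulVec_mulVec, h, mulVec_smul, ih, smul_smul, pow_succ']
  induction p using Polynomial.induction_on' with
  | add p q hp hq => rw [map_add, add_mulVec, hp, hq, eval_add, add_smul]
  | monomial n c =>
    rw [aeval_monomial, Algebra.algebraMap_eq_smul_one, smul_mul_assoc, one_mul, smul_mulVec, hpow, smul_smul,
      eval_monomial]

theorem transpose_aeval_of_symm (M : Matrix X X ℝ) (h : Mᵀ = M) (p : ℝ[X]) :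
    (aeval M p)ᵀ = aeval M p := by
  induction p using Polynomial.induction_on' with
  | add p q hp hq => rw [map_add, transpose_add, hp, hq]
  | monomial n c =>
    rw [aeval_monomial, Algebra.algebraMap_eq_smul_one, smul_mul_assoc, one_mul, transpose_smul,
      transpose_pow, h]

theorem dotProduct_mulVec_symm (P : Matrix X X ℝ) (h : Pᵀ = P) (v w : X → ℝ) :
    v ⬝ᵥ (P *ᵥ w) = (P *ᵥ v) ⬝ᵥ w := by
  rw [dotProduct_mulVec, ← mulVec_transpose, h]

theorem exists_eigenbasis (M : Matrix X X ℝ) (h : Mᵀ = M) : ∃ (b : X → X → ℝ) (t : X → ℝ),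
    (∀ i, b i ≠ 0 ∧ M *ᵥ b i = t i • b i) ∧ ∀ v : X → ℝ, ∑ i, (b i ⬝ᵥ v) ^ 2 = v ⬝ᵥ v := by
  have hM : M.IsHermitian := by rw [IsHermitian, conjTranspose_eq_transpose_of_trivial, h]
  refine ⟨fun i => hM.eigenvectorBasis i, hM.eigenvalues, fun i => ⟨?_, ?_⟩, ?_⟩
  · intro h0
    have := hM.eigenvectorBasis.orthonormal.ne_zero i
    exact this (by ext x; exact congrFun h0 x)
  · exact hM.mulVec_eigenvectorBasis i
  · intro v
    have := hM.eigenvectorBasis.sum_sq_norm_inner_right (WithLp.toLp 2 v)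
    rw [EuclideanSpace.norm_sq_eq] at this
    simp only [Real.norm_eq_abs, sq_abs] at this
    simp only [dotProduct]
    rw [show ∑ x, v x * v x = ∑ x, v x ^ 2 from sum_congr rfl fun _ _ => (sq _).symm, ← this]
    refine sum_congr rfl fun i _ => ?_
    congr 1
    rw [PiLp.inner_apply]
    exact sum_congr rfl fun x _ => by simp [mul_comm]

theorem dotProduct_aeval_le (M : Matrix X X ℝ) (h : Mᵀ = M) (g : ℝ[X])
    (hg : ∀ (t : ℝ) (v : X → ℝ), v ≠ 0 → M *ᵥ v = t • v → |g.eval t| ≤ 1) (v : X → ℝ) :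
    (aeval M g *ᵥ v) ⬝ᵥ (aeval M g *ᵥ v) ≤ v ⬝ᵥ v := by
  obtain ⟨b, t, hb, hp⟩ := exists_eigenbasis M h
  rw [← hp v, ← hp (aeval M g *ᵥ v)]
  refine sum_le_sum fun i _ => ?_
  rw [dotProduct_mulVec_symm _ (transpose_aeval_of_symm M h g),
    aeval_mulVec_of_eigen M _ _ (hb i).2, smul_dotProduct, smul_eq_mul, mul_pow]
  have h1 : g.eval (t i) ^ 2 ≤ 1 := (sq_le_one_iff_abs_le_one _).2 (hg _ _ (hb i).1 (hb i).2)
  nlinarith [sq_nonneg (b i ⬝ᵥ v)]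

theorem le_dotProduct_aeval (M : Matrix X X ℝ) (h : Mᵀ = M) (g : ℝ[X]) (f : X → ℝ) (t : ℝ)
    (hf : M *ᵥ f = t • f) (v : X → ℝ) :
    g.eval t ^ 2 * (f ⬝ᵥ v) ^ 2 ≤ (f ⬝ᵥ f) * ((aeval M g *ᵥ v) ⬝ᵥ (aeval M g *ᵥ v)) := by
  have h1 : f ⬝ᵥ (aeval M g *ᵥ v) = g.eval t * (f ⬝ᵥ v) := by
    rw [dotProduct_mulVec_symm _ (transpose_aeval_of_symm M h g), aeval_mulVec_of_eigen M _ _ hf,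
      smul_dotProduct, smul_eq_mul]
  rw [← mul_pow, ← h1]
  have := Finset.sum_mul_sq_le_sq_mul_sq univ f (aeval M g *ᵥ v)
  simpa only [dotProduct, sq] using this

end symm

variable {j r : ℕ} {V : Type} [Fintype V] [DecidableEq V]

/-- The real adjacency matrix of the Schreier graph on tuples. -/
def adjR (j : ℕ) (σ : Fin r → Equiv.Perm V) : Matrix (Fin j ↪ V) (Fin j ↪ V) ℝ :=
  ∑ c : Fin r × Bool, actR j (letPerm σ c)

theorem adjR_mulVec (σ : Fin r → Equiv.Perm V) (f : (Fin j ↪ V) → ℝ) (x : Fin j ↪ V) :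
    (adjR j σ *ᵥ f) x = ∑ c : Fin r × Bool, f (x.trans (letPerm σ c).toEmbedding) := by
  rw [adjR, sum_mulVec, Finset.sum_apply]
  exact sum_congr rfl fun c _ => actR_mulVec _ _ _

theorem adjR_transpose (σ : Fin r → Equiv.Perm V) : (adjR j σ)ᵀ = adjR j σ := by
  rw [adjR, transpose_sum]
  refine Fintype.sum_equiv (Function.Involutive.toPerm cinv cinv_cinv) _ _ fun c => ?_
  rw [actR_transpose, ← letPerm_cinv]
  rfl

theorem actR_letPerm_mul_cinv (σ : Fin r → Equiv.Perm V) (c : Fin r × Bool) :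
    actR j (letPerm σ c) * actR j (letPerm σ (cinv c)) = 1 := by
  rw [actR_mul, letPerm_cinv, inv_mul_cancel, actR_one]

theorem prod_actR_letPerm (σ : Fin r → Equiv.Perm V) (w : List (Fin r × Bool)) :
    (w.map fun c => actR j (letPerm σ c)).prod = actR j (Wp σ w) := by
  induction w with
  | nil => simp [Wp, actR_one]
  | cons c w ih => rw [List.map_cons, List.prod_cons, ih, actR_mul, Wp]

theorem adjR_eigenvalue_le (σ : Fin r → Equiv.Perm V) (t : ℝ) (f : (Fin j ↪ V) → ℝ) (hf : f ≠ 0)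
    (h : adjR j σ *ᵥ f = t • f) : |t| ≤ 2 * r := by
  obtain ⟨y, hy⟩ := Function.ne_iff.1 hf
  obtain ⟨x, -, hx⟩ := exists_max_image univ (fun x => |f x|) ⟨y, mem_univ _⟩
  have hpos : 0 < |f x| := lt_of_lt_of_le (abs_pos.2 hy) (hx y (mem_univ _))
  have h1 := congrFun h x
  rw [adjR_mulVec, Pi.smul_apply, smul_eq_mul] at h1
  have h2 : |t| * |f x| ≤ 2 * r * |f x| := by
    rw [← abs_mul, ← h1]
    refine (abs_sum_le_sum_abs _ _).trans ((sum_le_sum fun c _ => hx _ (mem_univ _)).trans ?_)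
    simp [mul_comm]
  exact le_of_mul_le_mul_right h2 hpos

/-- The linear statistic attached to coefficients `a`. -/
def qSum (j : ℕ) (a : ℕ → ℝ) (q : ℕ) (σ : Fin r → Equiv.Perm V) : ℝ :=
  ∑ m ∈ range (q + 1), a m * ∑ w ∈ rWords r m, Psi j (Wp σ w)

theorem aeval_adjR_mulVec (a : ℕ → ℝ) (q : ℕ) (p : ℝ[X])
    (ha : ∀ (R : Type) [Ring R] [Algebra ℝ R] (u : Fin r × Bool → R),
      (∀ c, u c * u (cinv c) = 1) → aeval (∑ c, u c) p = ∑ m ∈ range (q + 1), a m • sph u m)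
    (σ : Fin r → Equiv.Perm V) (v : (Fin j ↪ V) → ℝ) (x : Fin j ↪ V) :
    (aeval (adjR j σ) p *ᵥ v) x = ∑ m ∈ range (q + 1), a m *
      ∑ w ∈ rWords r m, (actR j (Wp σ w) *ᵥ v) x := by
  have h1 := ha (Matrix (Fin j ↪ V) (Fin j ↪ V) ℝ) (fun c => actR j (letPerm σ c))
      (actR_letPerm_mul_cinv σ)
  rw [adjR, h1, sum_mulVec, Finset.sum_apply]
  refine sum_congr rfl fun m _ => ?_
  rw [sph_eq, smul_mulVec, Pi.smul_apply, smul_eq_mul, sum_mulVec, Finset.sum_apply]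
  congr 1
  exact sum_congr rfl fun w _ => by rw [prod_actR_letPerm]

theorem sum_aVec_aeval (a : ℕ → ℝ) (q : ℕ) (p : ℝ[X])
    (ha : ∀ (R : Type) [Ring R] [Algebra ℝ R] (u : Fin r × Bool → R),
      (∀ c, u c * u (cinv c) = 1) → aeval (∑ c, u c) p = ∑ m ∈ range (q + 1), a m • sph u m)
    (σ : Fin r → Equiv.Perm V) :
    ∑ e : (Fin j × Bool) ↪ V, aVec e ⬝ᵥ (aeval (adjR j σ) p *ᵥ aVec e) =
      2 ^ j * qSum j a q σ := by
  have h1 : ∑ e : (Fin j × Bool) ↪ V, (aeval (adjR j σ) p *ᵥ aVec e) (sel e fun _ => false) =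
      ∑ e : (Fin j × Bool) ↪ V, ∑ m ∈ range (q + 1), a m *
        ∑ w ∈ rWords r m, (actR j (Wp σ w) *ᵥ aVec e) (sel e fun _ => false) :=
    sum_congr rfl fun e _ => aeval_adjR_mulVec a q p ha σ _ _
  have h2 : ∑ e : (Fin j × Bool) ↪ V, ∑ m ∈ range (q + 1), a m *
        ∑ w ∈ rWords r m, (actR j (Wp σ w) *ᵥ aVec e) (sel e fun _ => false) = qSum j a q σ := by
    rw [sum_comm]
    unfold qSum
    refine sum_congr rfl fun m _ => ?_
    rw [← mul_sum, sum_comm]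
    refine congrArg (a m * ·) (sum_congr rfl fun w _ => sum_aVec_actR _)
  rw [sum_aVec_form, h1, h2]

theorem dotProduct_aeval_sq {X : Type} [Fintype X] [DecidableEq X] (M : Matrix X X ℝ)
    (h : Mᵀ = M) (g : ℝ[X]) (v : X → ℝ) :
    v ⬝ᵥ (aeval M (g ^ 2) *ᵥ v) = (aeval M g *ᵥ v) ⬝ᵥ (aeval M g *ᵥ v) := by
  rw [sq, map_mul, ← mulVec_mulVec, dotProduct_mulVec_symm _ (transpose_aeval_of_symm M h g)]

theorem sum_aVec_dotProduct_self :
    ∑ e : (Fin j × Bool) ↪ V, aVec e ⬝ᵥ aVec e =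
      2 ^ j * Psi j (1 : Equiv.Perm V) := by
  rw [← sum_aVec_actR, ← sum_aVec_form, actR_one]
  simp

theorem qSum_nonneg (a : ℕ → ℝ) (q : ℕ) (g : ℝ[X])
    (ha : ∀ (R : Type) [Ring R] [Algebra ℝ R] (u : Fin r × Bool → R),
      (∀ c, u c * u (cinv c) = 1) →
        aeval (∑ c, u c) (g ^ 2) = ∑ m ∈ range (q + 1), a m • sph u m)
    (σ : Fin r → Equiv.Perm V) : 0 ≤ qSum j a q σ := by
  have h := sum_aVec_aeval (j := j) a q (g ^ 2) ha σ
  have h2 : 0 ≤ (2:ℝ) ^ j * qSum j a q σ := by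
    rw [← h]
    refine sum_nonneg fun e _ => ?_
    rw [dotProduct_aeval_sq _ (adjR_transpose σ)]
    exact sum_nonneg fun _ _ => mul_self_nonneg _
  exact nonneg_of_mul_nonneg_right h2 (by positivity)

theorem qSum_le (a : ℕ → ℝ) (q : ℕ) (g : ℝ[X]) (hg : ∀ t : ℝ, |t| ≤ 2 * r → |g.eval t| ≤ 1)
    (ha : ∀ (R : Type) [Ring R] [Algebra ℝ R] (u : Fin r × Bool → R),
      (∀ c, u c * u (cinv c) = 1) →
        aeval (∑ c, u c) (g ^ 2) = ∑ m ∈ range (q + 1), a m • sph u m)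
    (σ : Fin r → Equiv.Perm V) :
    qSum j a q σ ≤ ((Fintype.card V).descFactorial (2 * j) : ℝ) := by
  have h := sum_aVec_aeval (j := j) a q (g ^ 2) ha σ
  have h2 : (2:ℝ) ^ j * qSum j a q σ ≤ 2 ^ j * Psi j (1 : Equiv.Perm V) := by
    rw [← h, ← sum_aVec_dotProduct_self]
    refine sum_le_sum fun e _ => ?_
    rw [dotProduct_aeval_sq _ (adjR_transpose σ)]
    exact dotProduct_aeval_le _ (adjR_transpose σ) g
      (fun t v hv h => hg t (adjR_eigenvalue_le σ t v hv h)) _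
  exact (le_of_mul_le_mul_left h2 (by positivity)).trans
    ((le_abs_self _).trans (Psi_abs_le j _))

theorem le_qSum (a : ℕ → ℝ) (q : ℕ) (g : ℝ[X])
    (ha : ∀ (R : Type) [Ring R] [Algebra ℝ R] (u : Fin r × Bool → R),
      (∀ c, u c * u (cinv c) = 1) →
        aeval (∑ c, u c) (g ^ 2) = ∑ m ∈ range (q + 1), a m • sph u m)
    (σ : Fin r → Equiv.Perm V) (f : (Fin j ↪ V) → ℝ) (hf0 : f ≠ 0) (hf : ZeroMarg f) (t : ℝ)
    (ht : adjR j σ *ᵥ f = t • f) :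
    g.eval t ^ 2 * ((Fintype.card V - j).descFactorial j : ℝ) ≤ qSum j a q σ := by
  have h := sum_aVec_aeval (j := j) a q (g ^ 2) ha σ
  have hpos : 0 < f ⬝ᵥ f := by
    obtain ⟨y, hy⟩ := Function.ne_iff.1 hf0
    exact sum_pos' (fun _ _ => mul_self_nonneg _) ⟨y, mem_univ _, mul_self_pos.2 hy⟩
  have h1 : g.eval t ^ 2 * ∑ e : (Fin j × Bool) ↪ V, (aVec e ⬝ᵥ f) ^ 2 ≤
      (f ⬝ᵥ f) * (2 ^ j * qSum j a q σ) := by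
    rw [← h, mul_sum, mul_sum]
    refine sum_le_sum fun e _ => ?_
    rw [dotProduct_aeval_sq _ (adjR_transpose σ), dotProduct_comm (aVec e) f]
    exact le_dotProduct_aeval _ (adjR_transpose σ) g f t ht _
  have h2 := mul_le_mul_of_nonneg_left hf.sum_sq_lower (sq_nonneg (g.eval t))
  have h3 : (2 ^ j * (f ⬝ᵥ f)) * (g.eval t ^ 2 * ((Fintype.card V - j).descFactorial j : ℝ)) ≤
      (2 ^ j * (f ⬝ᵥ f)) * qSum j a q σ := by
    calc _ = g.eval t ^ 2 * (2 ^ j * ((Fintype.card V - j).descFactorial j : ℝ) * (f ⬝ᵥ f)) := by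
          ring
      _ ≤ _ := h2
      _ ≤ _ := h1
      _ = _ := by ring
  exact le_of_mul_le_mul_left h3 (by positivity)

end

end

section

open Finset Matrix Polynomial

noncomputable section
set_option linter.unusedSectionVars false
variable {r : ℕ} {V : Type} [Fintype V] [DecidableEq V]

/-- Forgetting a coordinate. -/
def dropCoord {k : ℕ} (i : Fin (k + 1)) (x : Fin (k + 1) ↪ V) : Fin k ↪ V :=
  i.succAboveEmb.trans x

theorem exists_zeroMarg_eigen (σ : Fin r → Equiv.Perm V) (t : ℝ) (k : ℕ) :
    ∀ f : (Fin k ↪ V) → ℝ, f ≠ 0 → ∑ x, f x = 0 → adjR k σ *ᵥ f = t • f →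
      ∃ j, 1 ≤ j ∧ j ≤ k ∧ ∃ f' : (Fin j ↪ V) → ℝ, f' ≠ 0 ∧ ZeroMarg f' ∧
        adjR j σ *ᵥ f' = t • f' := by
  induction k with
  | zero =>
    intro f h0 hs _
    refine absurd (funext fun x => ?_) h0
    rw [Fintype.sum_eq_single x fun y hy => absurd (Subsingleton.elim y x) hy] at hs
    exact hs
  | succ k ih =>
    intro f h0 hs ht
    by_cases hz : ZeroMarg f
    · exact ⟨k + 1, by omega, le_rfl, f, h0, hz, ht⟩
    obtain ⟨i, x0, hx⟩ : ∃ (i : Fin (k + 1)) (x0 : Fin (k + 1) ↪ V),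
        ∑ x ∈ univ.filter (fun x : Fin (k + 1) ↪ V => ∀ i', i' ≠ i → x i' = x0 i'), f x ≠ 0 := by
      simpa only [ZeroMarg, not_forall] using hz
    suffices H : (fun y => ∑ x ∈ univ.filter (fun x => dropCoord i x = y), f x) ≠ 0 ∧
        ∑ y, ∑ x ∈ univ.filter (fun x => dropCoord i x = y), f x = 0 ∧
        adjR k σ *ᵥ (fun y => ∑ x ∈ univ.filter (fun x => dropCoord i x = y), f x) =
          t • fun y => ∑ x ∈ univ.filter (fun x => dropCoord i x = y), f x by
      obtain ⟨j, h1, h2, h3⟩ := ih _ H.1 H.2.1 H.2.2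
      exact ⟨j, h1, by omega, h3⟩
    refine ⟨Function.ne_iff.2 ⟨dropCoord i x0, ?_⟩, ?_, ?_⟩
    · change ∑ x ∈ univ.filter (fun x => dropCoord i x = dropCoord i x0), f x ≠ 0
      convert hx using 2
      refine filter_congr fun x _ => ?_
      constructor
      · intro h i' hi'
        obtain ⟨i'', rfl⟩ := Fin.exists_succAbove_eq hi'
        exact DFunLike.congr_fun h i''
      · intro h
        ext i'
        exact h _ (Fin.succAbove_ne i i')
    · rw [sum_fiberwise, hs]
    · ext y
      have h1 : ∀ c : Fin r × Bool, ∑ x ∈ univ.filter (fun x =>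
          dropCoord i x = y.trans (letPerm σ c).toEmbedding), f x =
          ∑ x ∈ univ.filter (fun x => dropCoord i x = y),
            f (x.trans (letPerm σ c).toEmbedding) := by
        intro c
        symm
        refine sum_equiv (Equiv.embeddingCongr (Equiv.refl _) (letPerm σ c)) (fun x => ?_)
          fun x _ => ?_
        · simp only [mem_filter, mem_univ, true_and]
          constructor
          · rintro rfl; rfl
          · intro h
            ext i'
            have := DFunLike.congr_fun h i'
            exact (letPerm σ c).injective this
        · rfl
      rw [adjR_mulVec]
      simp only [h1]
      rw [sum_comm]
      simp only [← adjR_mulVec, ht, Pi.smul_apply, smul_eq_mul, mul_sum]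

section norm
variable {X : Type} [Fintype X] [DecidableEq X]

theorem sum_mulVec_of_const (M : Matrix X X ℝ) (hM : Mᵀ = M) (d : ℝ)
    (h1 : M *ᵥ (fun _ => 1) = fun _ => d) (v : X → ℝ) : ∑ x, (M *ᵥ v) x = d * ∑ x, v x := by
  have := dotProduct_mulVec_symm M hM (fun _ => 1) v
  rw [h1] at this
  simpa [dotProduct, mul_sum] using this

theorem mulVec_sq_le_of_eigen (M : Matrix X X ℝ) (hM : Mᵀ = M) (d : ℝ)
    (h1 : M *ᵥ (fun _ => 1) = fun _ => d) (B : ℝ) (hB : 0 < B)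
    (h : ∀ (t : ℝ) (f : X → ℝ), f ≠ 0 → ∑ x, f x = 0 → M *ᵥ f = t • f → |t| ≤ B)
    (v : X → ℝ) (hv : ∑ x, v x = 0) : (M *ᵥ v) ⬝ᵥ (M *ᵥ v) ≤ B ^ 2 * (v ⬝ᵥ v) := by
  obtain ⟨M', hM'⟩ : ∃ M' : Matrix X X ℝ,
      M' = M - Matrix.of fun _ _ => d / Fintype.card X := ⟨_, rfl⟩
  have hs : M'ᵀ = M' := by
    rw [hM', transpose_sub, hM]; rfl
  have ha : ∀ w : X → ℝ, M' *ᵥ w = M *ᵥ w - fun _ => d / Fintype.card X * ∑ x, w x := by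
    intro w
    rw [hM', sub_mulVec]
    congr 1
    ext x
    simp [mulVec, dotProduct, mul_sum]
  have h2 : M' *ᵥ (fun _ => 1) = fun _ => 0 := by
    rw [ha, h1]
    ext x
    have : (Fintype.card X : ℝ) ≠ 0 := by
      have : Nonempty X := ⟨x⟩
      exact_mod_cast Fintype.card_ne_zero
    simp [this]
  have h3 := dotProduct_aeval_le M' hs (Polynomial.C B⁻¹ * Polynomial.X) ?_ v
  · simp only [map_mul, aeval_C, aeval_X, Algebra.algebraMap_eq_smul_one, smul_mul_assoc, one_mul,
      smul_mulVec, ha, hv, mul_zero] at h3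
    rw [show (fun _ : X => (0:ℝ)) = 0 from rfl, sub_zero, smul_dotProduct, dotProduct_smul] at h3
    simp only [smul_eq_mul] at h3
    field_simp at h3
    exact h3
  · intro t w hw ht
    rw [eval_mul, eval_C, eval_X, abs_mul, abs_inv, abs_of_pos hB, inv_mul_le_iff₀ hB, mul_one]
    have h4 := sum_mulVec_of_const M' hs 0 h2 w
    rw [ht, zero_mul] at h4
    simp only [Pi.smul_apply, smul_eq_mul, ← mul_sum] at h4
    rcases mul_eq_zero.1 h4 with h5 | h5
    · rw [h5, abs_zero]; exact hB.le
    · refine h t w hw h5 ?_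
      rw [← ht, ha, h5, mul_zero]
      exact (sub_zero _).symm

theorem norm_sq_toEuclideanLin_map (M : Matrix X X ℝ) (v : EuclideanSpace ℂ X) :
    ‖Matrix.toEuclideanLin (M.map (Complex.ofReal)) v‖ ^ 2 =
      (M *ᵥ fun x => (v x).re) ⬝ᵥ (M *ᵥ fun x => (v x).re) +
      (M *ᵥ fun x => (v x).im) ⬝ᵥ (M *ᵥ fun x => (v x).im) := by
  rw [EuclideanSpace.norm_sq_eq, dotProduct, dotProduct, ← sum_add_distrib]
  refine sum_congr rfl fun x _ => ?_
  rw [← Complex.normSq_eq_norm_sq, Complex.normSq_apply]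
  simp [Matrix.toLpLin_apply, mulVec, dotProduct]

theorem norm_sq_eq_re_im (v : EuclideanSpace ℂ X) :
    ‖v‖ ^ 2 = (fun x => (v x).re) ⬝ᵥ (fun x => (v x).re) +
      (fun x => (v x).im) ⬝ᵥ (fun x => (v x).im) := by
  rw [EuclideanSpace.norm_sq_eq, dotProduct, dotProduct, ← sum_add_distrib]
  refine sum_congr rfl fun x _ => ?_
  rw [← Complex.normSq_eq_norm_sq, Complex.normSq_apply]

theorem ratio_le_of_real (M : Matrix X X ℝ) (B : ℝ) (hB : 0 ≤ B)
    (h : ∀ v : X → ℝ, ∑ x, v x = 0 → (M *ᵥ v) ⬝ᵥ (M *ᵥ v) ≤ B ^ 2 * (v ⬝ᵥ v)) (c : ℝ)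
    (hc : ∃ v : EuclideanSpace ℂ X, v ≠ 0 ∧ (∑ i, v i) = 0 ∧
      c = ‖Matrix.toEuclideanLin (M.map (Complex.ofReal)) v‖ / ‖v‖) : c ≤ B := by
  obtain ⟨v, hv, hs, rfl⟩ := hc
  rw [div_le_iff₀ (norm_pos_iff.2 hv)]
  refine le_of_sq_le_sq ?_ (by positivity)
  rw [norm_sq_toEuclideanLin_map, mul_pow, norm_sq_eq_re_im, mul_add]
  refine add_le_add (h _ ?_) (h _ ?_)
  · rw [← Complex.re_sum, hs]; rfl
  · rw [← Complex.im_sum, hs]; rfl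

end norm
end

end

section

open Finset Matrix Polynomial

noncomputable section
set_option linter.unusedSectionVars false

/-- The real form of the norm on the complement of the constants. -/
theorem restNormC_map_le {X : Type} [Fintype X] [DecidableEq X] (M : Matrix X X ℝ) (B : ℝ)
    (hB : 0 ≤ B)
    (h : ∀ v : X → ℝ, ∑ x, v x = 0 → (M *ᵥ v) ⬝ᵥ (M *ᵥ v) ≤ B ^ 2 * (v ⬝ᵥ v)) :
    restNormC (M.map Complex.ofReal) ≤ B :=
  Real.sSup_le (ratio_le_of_real M B hB h) hB

theorem mulVec_sq_le_restNormC {X : Type} [Fintype X] [DecidableEq X] (M : Matrix X X ℝ) (B : ℝ)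
    (hB : 0 ≤ B)
    (h : ∀ v : X → ℝ, ∑ x, v x = 0 → (M *ᵥ v) ⬝ᵥ (M *ᵥ v) ≤ B ^ 2 * (v ⬝ᵥ v))
    (v : X → ℝ) (hv : ∑ x, v x = 0) :
    (M *ᵥ v) ⬝ᵥ (M *ᵥ v) ≤ restNormC (M.map Complex.ofReal) ^ 2 * (v ⬝ᵥ v) := by
  by_cases h0 : v = 0
  · simp [h0]
  obtain ⟨v', hv'⟩ : ∃ v' : EuclideanSpace ℂ X, ∀ x, v' x = (v x : ℂ) :=
    ⟨WithLp.toLp 2 fun x => (v x : ℂ), fun _ => rfl⟩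
  have hne : v' ≠ 0 := by
    rintro rfl
    refine h0 (funext fun x => ?_)
    have := hv' x
    simpa using this.symm
  have h1 : ‖Matrix.toEuclideanLin (M.map Complex.ofReal) v'‖ / ‖v'‖ ≤
      restNormC (M.map Complex.ofReal) := by
    refine le_csSup ⟨B, ratio_le_of_real M B hB h⟩ ⟨v', hne, ?_, rfl⟩
    simp only [hv']
    rw [← Complex.ofReal_sum, hv, Complex.ofReal_zero]
  rw [div_le_iff₀ (norm_pos_iff.2 hne)] at h1
  have h2 := pow_le_pow_left₀ (norm_nonneg _) h1 2
  rw [norm_sq_toEuclideanLin_map, mul_pow, norm_sq_eq_re_im] at h2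
  simp only [hv', Complex.ofReal_re, Complex.ofReal_im] at h2
  have h3 : (fun _ : X => (0:ℝ)) = 0 := rfl
  simpa [h3] using h2

theorem restNormC_nonneg {X : Type} [Fintype X] [DecidableEq X] (A : Matrix X X ℂ) :
    0 ≤ restNormC A := by
  refine Real.sSup_nonneg ?_
  rintro c ⟨v, -, -, rfl⟩
  positivity

variable {r N k : ℕ}

theorem sum_actMat_eq (σ : Fin r → Equiv.Perm (Fin N)) :
    ∑ i : Fin r, (actMat (N := N) (k := k) (σ i) + actMat (N := N) (k := k) (σ i)⁻¹) =
      (adjR k σ).map Complex.ofReal := by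
  have h : ∀ τ : Equiv.Perm (Fin N), actMat (N := N) (k := k) τ =
      (actR k τ).map Complex.ofReal := by
    intro τ
    ext x y
    simp only [actMat, actR, of_apply, map_apply]
    split_ifs <;> simp
  have h2 : (adjR k σ).map Complex.ofReal =
      ∑ c : Fin r × Bool, (actR k (letPerm σ c)).map Complex.ofReal := by
    ext x y
    rw [adjR, map_apply, Matrix.sum_apply, Matrix.sum_apply, Complex.ofReal_sum]
    rfl
  rw [h2, Fintype.sum_prod_type]
  refine sum_congr rfl fun i _ => ?_
  rw [Fintype.sum_bool, h, h]
  simp [letPerm]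

theorem adjR_mulVec_const {V : Type} [Fintype V] [DecidableEq V] (σ : Fin r → Equiv.Perm V) :
    adjR k σ *ᵥ (fun _ => 1) = fun _ => 2 * (r : ℝ) := by
  ext x
  rw [adjR_mulVec]
  simp [mul_comm]

theorem adjR_mulVec_sq_le {V : Type} [Fintype V] [DecidableEq V] (hr : 1 ≤ r)
    (σ : Fin r → Equiv.Perm V) (v : (Fin k ↪ V) → ℝ) (hv : ∑ x, v x = 0) :
    (adjR k σ *ᵥ v) ⬝ᵥ (adjR k σ *ᵥ v) ≤ (2 * r) ^ 2 * (v ⬝ᵥ v) := by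
  have : (0:ℝ) < r := by exact_mod_cast hr
  exact mulVec_sq_le_of_eigen _ (adjR_transpose σ) _ (adjR_mulVec_const σ) _ (by positivity)
    (fun t f hf _ ht => adjR_eigenvalue_le σ t f hf ht) v hv

theorem exists_eigen_of_lt_restNormC (σ : Fin r → Equiv.Perm (Fin N)) (B : ℝ) (hB : 0 < B)
    (h : B < restNormC (∑ i : Fin r,
      (actMat (N := N) (k := k) (σ i) + actMat (N := N) (k := k) (σ i)⁻¹))) :
    ∃ j, 1 ≤ j ∧ j ≤ k ∧ ∃ (f : (Fin j ↪ Fin N) → ℝ) (t : ℝ), f ≠ 0 ∧ ZeroMarg f ∧ B < |t| ∧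
      adjR j σ *ᵥ f = t • f := by
  rw [sum_actMat_eq] at h
  by_contra hcon
  refine absurd (restNormC_map_le _ B hB.le fun v hv => ?_) (not_le.2 h)
  refine mulVec_sq_le_of_eigen _ (adjR_transpose σ) _ (adjR_mulVec_const σ) B hB ?_ v hv
  intro t f hf hs ht
  by_contra ht2
  obtain ⟨j, h1, h2, f', h3, h4, h5⟩ := exists_zeroMarg_eigen σ t k f hf hs ht
  exact hcon ⟨j, h1, h2, f', t, h3, h4, not_le.1 ht2, h5⟩

theorem pow_diag_le_restNormC (hr : 1 ≤ r) (σ : Fin r → Equiv.Perm (Fin N)) (p : ℕ)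
    (x : Fin k ↪ Fin N) :
    ((adjR k σ) ^ (2 * p)) x x ≤ restNormC (∑ i : Fin r,
      (actMat (N := N) (k := k) (σ i) + actMat (N := N) (k := k) (σ i)⁻¹)) ^ (2 * p) +
      (2 * r) ^ (2 * p) / Fintype.card (Fin k ↪ Fin N) := by
  rw [sum_actMat_eq]
  obtain ⟨R, hR⟩ : ∃ R, R = restNormC ((adjR k σ).map Complex.ofReal) := ⟨_, rfl⟩
  obtain ⟨M, hM⟩ : ∃ M, M = adjR k σ := ⟨_, rfl⟩
  obtain ⟨D, hD⟩ : ∃ D : ℝ, D = Fintype.card (Fin k ↪ Fin N) := ⟨_, rfl⟩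
  have hD0 : 0 < D := by
    have : Nonempty (Fin k ↪ Fin N) := ⟨x⟩
    rw [hD]; exact_mod_cast Fintype.card_pos
  have h1 : ∀ v : (Fin k ↪ Fin N) → ℝ, ∑ x, v x = 0 →
      (M *ᵥ v) ⬝ᵥ (M *ᵥ v) ≤ R ^ 2 * (v ⬝ᵥ v) := by
    rw [hM, hR]
    exact mulVec_sq_le_restNormC _ (2 * r) (by positivity) (adjR_mulVec_sq_le hr σ)
  have hMs : Mᵀ = M := hM ▸ adjR_transpose σ
  have hMc : M *ᵥ (fun _ => 1) = fun _ => 2 * (r : ℝ) := hM ▸ adjR_mulVec_const σ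
  rw [← hR, ← hM, ← hD]
  have hpc : ∀ q : ℕ, M ^ q *ᵥ (fun _ => 1) = fun _ => (2 * (r : ℝ)) ^ q := by
    intro q
    induction q with
    | zero => simp
    | succ q ih =>
      rw [pow_succ, ← mulVec_mulVec, hMc]
      have : (fun _ : Fin k ↪ Fin N => 2 * (r : ℝ)) = (2 * (r : ℝ)) • fun _ => (1 : ℝ) := by
        ext; simp
      rw [this, mulVec_smul, ih]
      ext
      simp [pow_succ']
  have hps : ∀ q : ℕ, (M ^ q)ᵀ = M ^ q := fun q => by rw [transpose_pow, hMs]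
  have h2 : ∀ (v : (Fin k ↪ Fin N) → ℝ), ∑ x, v x = 0 → ∀ q : ℕ,
      ∑ x, (M ^ q *ᵥ v) x = 0 ∧ (M ^ q *ᵥ v) ⬝ᵥ (M ^ q *ᵥ v) ≤ R ^ (2 * q) * (v ⬝ᵥ v) := by
    intro v hv q
    refine ⟨by rw [sum_mulVec_of_const _ (hps q) _ (hpc q), hv, mul_zero], ?_⟩
    induction q with
    | zero => simp
    | succ q ih =>
      rw [pow_succ', ← mulVec_mulVec]
      refine (h1 _ (by rw [sum_mulVec_of_const _ (hps q) _ (hpc q), hv, mul_zero])).trans ?_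
      calc R ^ 2 * ((M ^ q *ᵥ v) ⬝ᵥ (M ^ q *ᵥ v)) ≤ R ^ 2 * (R ^ (2 * q) * (v ⬝ᵥ v)) := by
            gcongr
        _ = _ := by ring
  obtain ⟨w, hw⟩ : ∃ w : (Fin k ↪ Fin N) → ℝ, w = Pi.single x 1 - fun _ => D⁻¹ := ⟨_, rfl⟩
  have hws : ∑ y, w y = 0 := by
    rw [hw]
    simp only [Pi.sub_apply, sum_sub_distrib, Finset.sum_pi_single', mem_univ, if_true, sum_const,
      card_univ, nsmul_eq_mul, ← hD]
    field_simp; ring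
  have hww : w ⬝ᵥ w ≤ 1 := by
    have h3 : w ⬝ᵥ w = 1 - D⁻¹ := by
      conv_lhs => rw [hw]
      rw [sub_dotProduct, ← hw, single_dotProduct]
      have : (fun _ => D⁻¹) ⬝ᵥ w = D⁻¹ * ∑ y, w y := by simp [dotProduct, mul_sum]
      rw [this, hws, hw]
      simp
    rw [h3]
    have := inv_pos.2 hD0
    linarith
  have h3 : M ^ p *ᵥ Pi.single x 1 = M ^ p *ᵥ w + fun _ => (2 * (r:ℝ)) ^ p * D⁻¹ := by
    rw [hw, mulVec_sub, sub_add]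
    have : (fun _ : Fin k ↪ Fin N => D⁻¹) = D⁻¹ • fun _ => (1:ℝ) := by ext; simp
    rw [this, mulVec_smul, hpc]
    have : (D⁻¹ • fun _ : Fin k ↪ Fin N => (2 * (r:ℝ)) ^ p) = fun _ => (2 * (r:ℝ)) ^ p * D⁻¹ := by
      ext; simp [mul_comm]
    rw [this, sub_self, sub_zero]
  have h4 : (M ^ (2 * p)) x x = (M ^ p *ᵥ Pi.single x 1) ⬝ᵥ (M ^ p *ᵥ Pi.single x 1) := by
    rw [← dotProduct_mulVec_symm _ (hps p), mulVec_mulVec, ← pow_add, ← two_mul]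
    simp
  obtain ⟨h5, h6⟩ := h2 w hws p
  have h7 : ∀ (u : (Fin k ↪ Fin N) → ℝ) (c : ℝ), ∑ y, u y = 0 →
      (u + fun _ => c) ⬝ᵥ (u + fun _ => c) = u ⬝ᵥ u + c ^ 2 * D := by
    intro u c hu
    simp only [dotProduct, Pi.add_apply]
    have : ∀ y, (u y + c) * (u y + c) = u y * u y + 2 * c * u y + c ^ 2 := fun y => by ring
    simp only [this, sum_add_distrib, ← mul_sum, hu, sum_const, card_univ, nsmul_eq_mul, ← hD]
    ring
  rw [h4, h3, h7 _ _ h5]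
  have h8 : ((2 * (r:ℝ)) ^ p * D⁻¹) ^ 2 * D = (2 * r) ^ (2 * p) / D := by
    field_simp
    rw [← pow_mul, mul_comm p 2]
  rw [h8]
  gcongr
  refine h6.trans (mul_le_of_le_one_right ?_ hww)
  rw [pow_mul]
  positivity

end

end

section

open Finset Matrix Polynomial

noncomputable section

theorem le_card_tuples {N k : ℕ} (hk : 1 ≤ k) (hkN : k ≤ N) :
    N ≤ Fintype.card (Fin k ↪ Fin N) := by
  obtain ⟨k, rfl⟩ := Nat.exists_eq_add_of_le' hk
  obtain ⟨N, rfl⟩ := Nat.exists_eq_add_of_le' (hk.trans hkN)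
  rw [Fintype.card_embedding_eq, Fintype.card_fin, Fintype.card_fin, Nat.succ_descFactorial_succ]
  have : 0 < N.descFactorial k := Nat.pos_of_ne_zero fun h => by
    rw [Nat.descFactorial_eq_zero_iff_lt] at h; omega
  exact Nat.le_mul_of_pos_right _ this

theorem exists_le_restNormC (r : ℕ) (hr : 1 ≤ r) (s : ℝ) (hs : 0 < s) (hs2 : s ^ 2 = 2 * r - 1)
    (ε : ℝ) (hε : 0 < ε) : ∃ N0 : ℕ, ∀ N ≥ N0, ∀ k, 1 ≤ k → k ≤ N →
      ∀ σ : Fin r → Equiv.Perm (Fin N), 2 * s - ε ≤ restNormC (∑ i : Fin r,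
        (actMat (N := N) (k := k) (σ i) + actMat (N := N) (k := k) (σ i)⁻¹)) := by
  by_cases hb : 2 * s - ε ≤ 0
  · exact ⟨0, fun N _ k _ _ σ => hb.trans (restNormC_nonneg _)⟩
  obtain ⟨b, hbe⟩ : ∃ b, b = 2 * s - ε := ⟨_, rfl⟩
  rw [← hbe] at hb ⊢
  push Not at hb
  obtain ⟨x, hx⟩ : ∃ x, x = b / (2 * s) := ⟨_, rfl⟩
  have hx0 : 0 < x := by rw [hx]; positivity
  have hx1 : x < 1 := by rw [hx, div_lt_one (by positivity)]; linarith
  obtain ⟨p, hp⟩ : ∃ p : ℕ, 2 * ((2 * p + 3 : ℝ) ^ 3 * x ^ (2 * p)) ≤ 1 := by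
    have h1 := tendsto_pow_const_mul_const_pow_of_abs_lt_one 3 (abs_lt.2 ⟨by linarith, hx1⟩)
    have h2 := h1.eventually (gt_mem_nhds (show (0:ℝ) < x ^ 3 / 2 by positivity))
    obtain ⟨n, hn⟩ := Filter.eventually_atTop.1 h2
    refine ⟨n, ?_⟩
    have h3 := hn (2 * n + 3) (by omega)
    push_cast at h3
    rw [pow_add, ← mul_assoc, lt_div_iff₀ two_pos] at h3
    have h4 : 0 < x ^ 3 := by positivity
    by_contra hcon
    push Not at hcon
    nlinarith
  obtain ⟨N0, hN0⟩ := exists_nat_gt ((2 * r : ℝ) ^ (2 * p) / b ^ (2 * p))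
  refine ⟨N0 + 1, fun N hN k hk hkN σ => ?_⟩
  have hcard := le_card_tuples hk hkN
  have hNr : ((N0 : ℝ)) ≤ (Fintype.card (Fin k ↪ Fin N) : ℝ) := by exact_mod_cast (by omega)
  have hNpos : (0:ℝ) < (Fintype.card (Fin k ↪ Fin N) : ℝ) := by exact_mod_cast (by omega)
  obtain ⟨y⟩ : Nonempty (Fin k ↪ Fin N) := Fintype.card_pos_iff.1 (by exact_mod_cast hNpos)
  by_contra hcon
  push Not at hcon
  have h1 := pow_diag_le_restNormC hr σ p y
  have h2 := pow_adj_diag_lower (fun c => actR k (letPerm σ c)) (actR_letPerm_mul_cinv σ)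
    (fun c x y => by simp only [actR, of_apply]; split_ifs <;> norm_num) s hs hs2 (2 * p) y
  have h3 := h2.trans h1
  have h4 := pow_le_pow_left₀ (restNormC_nonneg _) hcon.le (2 * p)
  have h5 : (2 * r : ℝ) ^ (2 * p) / (Fintype.card (Fin k ↪ Fin N) : ℝ) < b ^ (2 * p) := by
    rw [div_lt_iff₀ hNpos]
    rw [div_lt_iff₀ (by positivity)] at hN0
    refine hN0.trans_le ?_
    rw [mul_comm]
    gcongr
  have h6 : 2 * b ^ (2 * p) ≤ s ^ (2 * p) * ballot (2 * p) 0 := by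
    have h7 := ballot_lower p
    have h8 : b = x * (2 * s) := by rw [hx]; field_simp
    have h9 : b ^ (2 * p) = x ^ (2 * p) * (4 ^ p * s ^ (2 * p)) := by
      rw [h8, mul_pow, mul_pow, pow_mul 2 2 p]; norm_num
    rw [h9]
    have hsp : 0 < s ^ (2 * p) := by positivity
    have hxp : 0 < x ^ (2 * p) := by positivity
    have hbal : 0 ≤ ballot (2 * p) 0 := by
      by_contra hneg
      push Not at hneg
      have h10 : (0:ℝ) < 4 ^ p := by positivity
      have h11 : (0:ℝ) < (2 * p + 3) ^ 3 := by positivity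
      nlinarith
    calc 2 * (x ^ (2 * p) * (4 ^ p * s ^ (2 * p))) ≤
        2 * (x ^ (2 * p) * ((ballot (2 * p) 0 * (2 * p + 3) ^ 3) * s ^ (2 * p))) := by gcongr
      _ = (2 * ((2 * p + 3 : ℝ) ^ 3 * x ^ (2 * p))) * (s ^ (2 * p) * ballot (2 * p) 0) := by ring
      _ ≤ 1 * (s ^ (2 * p) * ballot (2 * p) 0) := by gcongr
      _ = _ := one_mul _
  linarith

end

end

section

open Finset Polynomial

noncomputable section
variable {r : ℕ}

open Classical in
/-- The part of the linear statistic coming from good words. -/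
def goodSum {V : Type} [Fintype V] [DecidableEq V] (j : ℕ) (a : ℕ → ℝ) (q : ℕ)
    (σ : Fin r → Equiv.Perm V) : ℝ :=
  ∑ m ∈ range (q + 1), a m * ∑ w ∈ (rWords r m).filter (fun w => GoodWord w), Psi j (Wp σ w)

theorem abs_qSum_sub_goodSum_le {V : Type} [Fintype V] [DecidableEq V] (hr : 1 ≤ r) (s : ℝ)
    (hs : 1 ≤ s) (hs2 : s ^ 2 = 2 * r - 1) (j q : ℕ) (a : ℕ → ℝ) (η : ℝ) (hη : 0 ≤ η)
    (ha : ∀ m, |a m| ≤ 2 * (q + 1) * η * (s ^ m)⁻¹) (σ : Fin r → Equiv.Perm V) :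
    |qSum j a q σ - goodSum j a q σ| ≤
      4 * (q + 1) ^ 4 * η * ((Fintype.card V).descFactorial (2 * j) : ℝ) := by
  classical
  obtain ⟨F, hF⟩ : ∃ F : ℝ, F = ((Fintype.card V).descFactorial (2 * j) : ℝ) := ⟨_, rfl⟩
  have hF0 : 0 ≤ F := by rw [hF]; positivity
  have hs0 : 0 < s := by linarith
  rw [← hF, qSum, goodSum, ← sum_sub_distrib]
  have h1 : ∀ m ∈ range (q + 1), |a m * ∑ w ∈ rWords r m, Psi j (Wp σ w) -
      a m * ∑ w ∈ (rWords r m).filter (fun w => GoodWord w), Psi j (Wp σ w)| ≤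
      4 * (q + 1) ^ 3 * η * F := by
    intro m hm
    have hm' : (m : ℝ) ≤ q := by exact_mod_cast Nat.lt_succ_iff.1 (mem_range.1 hm)
    rw [← mul_sub, ← sum_filter_add_sum_filter_not (rWords r m) (fun w => GoodWord w),
      add_sub_cancel_left, abs_mul]
    have h2 : |∑ w ∈ (rWords r m).filter (fun w => ¬ GoodWord w), Psi j (Wp σ w)| ≤
        2 * (m + 1) ^ 2 * s ^ m * F := by
      refine (abs_sum_le_sum_abs _ _).trans ((sum_le_sum fun w _ => Psi_abs_le j _).trans ?_)
      rw [sum_const, nsmul_eq_mul, ← hF]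
      gcongr
      convert card_bad_le r m hr s hs hs2
    calc _ ≤ (2 * (q + 1) * η * (s ^ m)⁻¹) * (2 * (m + 1) ^ 2 * s ^ m * F) := by
          gcongr
          exact ha m
      _ = 4 * (q + 1) * (m + 1) ^ 2 * η * F := by field_simp; ring
      _ ≤ 4 * (q + 1) * (q + 1) ^ 2 * η * F := by gcongr
      _ = _ := by ring
  refine (abs_sum_le_sum_abs _ _).trans ((sum_le_sum h1).trans (le_of_eq ?_))
  rw [sum_const, card_range, nsmul_eq_mul]
  push_cast
  ring

theorem exists_poly_sum_goodSum (j q : ℕ) (a : ℕ → ℝ) :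
    ∃ p : ℝ[X], p.natDegree ≤ r * (j * (q + 1)) ∧ ∀ N, j * (q + 1) ≤ N →
      (∑ σ : Fin r → Equiv.Perm (Fin N), goodSum j a q σ) *
        ((N.descFactorial (j * (q + 1)) : ℝ)) ^ r = (N.factorial : ℝ) ^ r * p.eval (N : ℝ) := by
  classical
  have h : ∀ w : List (Fin r × Bool), ∃ p : ℝ[X], p.natDegree ≤ r * (j * (q + 1)) ∧
      (w.length ≤ q → FreeGroup.IsReduced w → GoodWord w → ∀ N, j * (q + 1) ≤ N →
      (∑ σ : Fin r → Equiv.Perm (Fin N), Psi j (Wp σ w)) *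
        ((N.descFactorial (j * (q + 1)) : ℝ)) ^ r =
          (N.factorial : ℝ) ^ r * p.eval (N : ℝ)) := by
    intro w
    by_cases hw : w.length ≤ q ∧ FreeGroup.IsReduced w ∧ GoodWord w
    · obtain ⟨p, hp, hp2⟩ := exists_poly_sum_Psi_word j w hw.2.1 hw.2.2 (j * (q + 1))
        (Nat.mul_le_mul_left _ (by omega))
      exact ⟨p, hp, fun _ _ _ => hp2⟩
    · exact ⟨0, by simp, fun h1 h2 h3 => absurd ⟨h1, h2, h3⟩ hw⟩
  choose P hP1 hP2 using h
  refine ⟨∑ m ∈ range (q + 1), C (a m) *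
    ∑ w ∈ (rWords r m).filter (fun w => GoodWord w), P w, ?_, ?_⟩
  · refine natDegree_sum_le_of_forall_le _ _ fun m _ => ?_
    refine (natDegree_C_mul_le _ _).trans ?_
    exact natDegree_sum_le_of_forall_le _ _ fun w _ => hP1 w
  · intro N hN
    simp only [goodSum, eval_finsetSum, eval_mul, eval_C]
    rw [sum_comm, sum_mul, mul_sum]
    refine sum_congr rfl fun m hm => ?_
    rw [← mul_sum, sum_comm, mul_assoc, mul_left_comm ((N.factorial : ℝ) ^ r)]
    refine congrArg (a m * ·) ?_
    rw [sum_mul, mul_sum]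
    refine sum_congr rfl fun w hw => ?_
    obtain ⟨hw1, hw2⟩ := mem_filter.1 hw
    obtain ⟨hw3, hw4⟩ := mem_rWords.1 hw1
    exact hP2 w (by have := mem_range.1 hm; omega) hw4 hw2 N hN

theorem card_perm_tuple (N : ℕ) :
    (Fintype.card (Fin r → Equiv.Perm (Fin N)) : ℝ) = (N.factorial : ℝ) ^ r := by
  rw [Fintype.card_fun, Fintype.card_perm, Fintype.card_fin, Fintype.card_fin]
  push_cast
  rfl

theorem descFactorial_pow_lower (N E r : ℕ) (h : 2 * r * E ^ 2 ≤ N) (hE : E ≤ N) (hN : 0 < N) :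
    (N : ℝ) ^ (r * E) ≤ 2 * (N.descFactorial E : ℝ) ^ r := by
  have hN' : (0:ℝ) < N := by exact_mod_cast hN
  have h1 : ((N : ℝ) - E) ^ E ≤ N.descFactorial E := by
    have h2 := Nat.pow_sub_le_descFactorial N E
    have h3 : ((N + 1 - E : ℕ) : ℝ) ^ E ≤ N.descFactorial E := by exact_mod_cast h2
    refine le_trans ?_ h3
    have : (0:ℝ) ≤ N - E := sub_nonneg.2 (by exact_mod_cast hE)
    gcongr
    rw [Nat.cast_sub (by omega)]
    push_cast; linarith
  have h4 : (0:ℝ) ≤ N - E := sub_nonneg.2 (by exact_mod_cast hE)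
  have h5 : 1 / 2 ≤ (1 + -(E / N : ℝ)) ^ (r * E) := by
    refine le_trans ?_ (one_add_mul_le_pow ?_ _)
    · push_cast
      have h6 : (2 * r * E ^ 2 : ℝ) ≤ N := by exact_mod_cast h
      have h7 : (r * E * (E / N) : ℝ) ≤ 1 / 2 := by
        rw [mul_div_assoc', div_le_div_iff₀ hN' two_pos]
        linarith
      linarith
    · have : (E / N : ℝ) ≤ 1 := by
        rw [div_le_one hN']; exact_mod_cast hE
      linarith
  have h8 : ((N : ℝ) - E) = N * (1 + -(E / N : ℝ)) := by field_simp; ring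
  calc (N : ℝ) ^ (r * E) = 2 * (N ^ (r * E) * (1 / 2)) := by ring
    _ ≤ 2 * (N ^ (r * E) * (1 + -(E / N : ℝ)) ^ (r * E)) := by gcongr
    _ = 2 * (((N : ℝ) - E) ^ E) ^ r := by rw [← mul_pow, ← h8, ← pow_mul, mul_comm E r]
    _ ≤ _ := by gcongr

theorem sum_qSum_le (hr : 1 ≤ r) (s : ℝ) (hs : 1 ≤ s) (hs2 : s ^ 2 = 2 * r - 1) (j q : ℕ)
    (a : ℕ → ℝ) (η : ℝ) (hη : 0 ≤ η) (ha : ∀ m, |a m| ≤ 2 * (q + 1) * η * (s ^ m)⁻¹)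
    (hδ : 4 * (q + 1) ^ 4 * η ≤ 1)
    (h0 : ∀ (N : ℕ) (σ : Fin r → Equiv.Perm (Fin N)), 0 ≤ qSum j a q σ)
    (h1 : ∀ (N : ℕ) (σ : Fin r → Equiv.Perm (Fin N)),
      qSum j a q σ ≤ ((Fintype.card (Fin N)).descFactorial (2 * j) : ℝ)) (N : ℕ)
    (hN : 2 * (r * (j * (q + 1)) + 1) ^ 4 ≤ N) :
    ∑ σ : Fin r → Equiv.Perm (Fin N), qSum j a q σ ≤ (N.factorial : ℝ) ^ r *
      (16 * (r * (j * (q + 1)) + 1 : ℕ) * (2 * (r * (j * (q + 1)) + 1 : ℕ) ^ 4) ^ (2 * j) +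
        4 * (q + 1) ^ 4 * η * N ^ (2 * j)) := by
  obtain ⟨E, hE⟩ : ∃ E, E = j * (q + 1) := ⟨_, rfl⟩
  obtain ⟨δ, hδe⟩ : ∃ δ : ℝ, δ = 4 * (q + 1) ^ 4 * η := ⟨_, rfl⟩
  obtain ⟨d, hd⟩ : ∃ d, d = r * E + 1 := ⟨_, rfl⟩
  have hδ0 : 0 ≤ δ := by rw [hδe]; positivity
  have hEd : E < d := by
    rw [hd]; exact Nat.lt_succ_of_le (Nat.le_mul_of_pos_left _ (by omega))
  obtain ⟨p, hp1, hp2⟩ := exists_poly_sum_goodSum (r := r) j q a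
  have hbad : ∀ (M : ℕ) (σ : Fin r → Equiv.Perm (Fin M)),
      |qSum j a q σ - goodSum j a q σ| ≤ δ * (M : ℝ) ^ (2 * j) := by
    intro M σ
    refine (abs_qSum_sub_goodSum_le hr s hs hs2 j q a η hη ha σ).trans ?_
    rw [← hδe, Fintype.card_fin]
    gcongr
    exact_mod_cast Nat.descFactorial_le_pow _ _
  have hq : ∀ (M : ℕ) (σ : Fin r → Equiv.Perm (Fin M)), |qSum j a q σ| ≤ (M : ℝ) ^ (2 * j) := by
    intro M σ
    rw [abs_of_nonneg (h0 M σ)]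
    refine (h1 M σ).trans ?_
    rw [Fintype.card_fin]
    exact_mod_cast Nat.descFactorial_le_pow _ _
  rw [← hE] at hp1 hp2 hN ⊢
  rw [← hδe] at hδ ⊢
  rw [← hd] at hN ⊢
  have hpM : ∀ M : ℕ, E ≤ M → |p.eval (M : ℝ)| ≤ 2 * (M : ℝ) ^ (2 * j + (d - 1)) := by
    intro M hM
    have h2 : |∑ σ : Fin r → Equiv.Perm (Fin M), goodSum j a q σ| ≤
        (M.factorial : ℝ) ^ r * (2 * (M : ℝ) ^ (2 * j)) := by
      refine (abs_sum_le_sum_abs _ _).trans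
        ((sum_le_sum (g := fun _ => 2 * (M : ℝ) ^ (2 * j)) fun σ _ => ?_).trans (le_of_eq ?_))
      · have h3 := hbad M σ
        have h4 := hq M σ
        have h5 : δ * (M : ℝ) ^ (2 * j) ≤ 1 * (M : ℝ) ^ (2 * j) := by gcongr
        rw [abs_le] at h3 h4 ⊢
        constructor <;> linarith [h3.1, h3.2, h4.1, h4.2]
      · rw [sum_const, card_univ, nsmul_eq_mul, card_perm_tuple]
    have h3 := congrArg abs (hp2 M hM)
    have hfpos : (0:ℝ) < (M.factorial : ℝ) ^ r := by
      have := Nat.factorial_pos M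
      positivity
    rw [abs_mul, abs_mul, abs_of_pos hfpos, abs_of_nonneg
      (show (0:ℝ) ≤ (M.descFactorial E : ℝ) ^ r by positivity)] at h3
    refine le_of_mul_le_mul_left (h3.symm.trans_le ?_) hfpos
    have h4 : (M.descFactorial E : ℝ) ^ r ≤ (M : ℝ) ^ (d - 1) := by
      rw [hd, Nat.add_sub_cancel, mul_comm r E, pow_mul]
      gcongr
      exact_mod_cast Nat.descFactorial_le_pow _ _
    calc _ ≤ (M.factorial : ℝ) ^ r * (2 * (M : ℝ) ^ (2 * j)) * (M : ℝ) ^ (d - 1) := by gcongr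
      _ = _ := by rw [pow_add]; ring
  have hpN := interp_bound p d (2 * j) N (by omega) 2 (by norm_num) (fun i hi => by
    obtain ⟨hi1, hi2⟩ := mem_Icc.1 hi
    refine hpM _ ?_
    have := le_nodeM d i hi1 hi2
    nlinarith) hN
  have hdN : d ≤ N := by
    refine le_trans ?_ hN
    have : d ^ 1 ≤ d ^ 4 := Nat.pow_le_pow_right (by omega) (by norm_num)
    rw [pow_one] at this
    omega
  have hlow := descFactorial_pow_lower N E r (by
    refine le_trans ?_ hN
    have h2 : r * E ≤ d := by omega
    have h3 : r * E * E ≤ d * d := Nat.mul_le_mul h2 hEd.le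
    have h4 : d ^ 2 ≤ d ^ 4 := Nat.pow_le_pow_right (by omega) (by norm_num)
    nlinarith) (by omega) (by omega)
  have hgood : ∑ σ : Fin r → Equiv.Perm (Fin N), goodSum j a q σ ≤
      (N.factorial : ℝ) ^ r * (16 * d * (2 * (d : ℝ) ^ 4) ^ (2 * j)) := by
    have h2 := hp2 N (by omega)
    have hdf : (0:ℝ) < (N.descFactorial E : ℝ) ^ r := by
      have : 0 < N.descFactorial E := Nat.pos_of_ne_zero fun h => by
        rw [Nat.descFactorial_eq_zero_iff_lt] at h; omega
      positivity
    refine le_of_mul_le_mul_right (h2.trans_le ?_) hdf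
    rw [mul_assoc]
    refine mul_le_mul_of_nonneg_left ((le_abs_self _).trans (hpN.trans ?_)) (by positivity)
    rw [hd, Nat.add_sub_cancel, ← hd]
    calc 4 * 2 * (d : ℝ) * (2 * (d : ℝ) ^ 4) ^ (2 * j) * (N : ℝ) ^ (r * E) ≤
        4 * 2 * (d : ℝ) * (2 * (d : ℝ) ^ 4) ^ (2 * j) * (2 * (N.descFactorial E : ℝ) ^ r) := by
          gcongr
      _ = _ := by ring
  have hsum : ∑ σ : Fin r → Equiv.Perm (Fin N), qSum j a q σ ≤
      ∑ σ : Fin r → Equiv.Perm (Fin N), (goodSum j a q σ + δ * (N : ℝ) ^ (2 * j)) := by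
    refine sum_le_sum fun σ _ => ?_
    have := (abs_le.1 (hbad N σ)).2
    linarith
  rw [sum_add_distrib, sum_const, card_univ, nsmul_eq_mul, card_perm_tuple] at hsum
  rw [mul_add]
  linarith

end

end

section

open Finset Polynomial Matrix

noncomputable section
variable {r : ℕ}

/-- The adjacency matrix on `j`-tuples has a large eigenvalue with an eigenvector orthogonal to
functions of fewer coordinates. -/
def HasLargeEigen (B : ℝ) (N j : ℕ) (σ : Fin r → Equiv.Perm (Fin N)) : Prop :=
  ∃ (f : (Fin j ↪ Fin N) → ℝ) (t : ℝ), f ≠ 0 ∧ ZeroMarg f ∧ B < |t| ∧ adjR j σ *ᵥ f = t • f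

theorem half_pow_le_descFactorial (N j : ℕ) (h : 4 * j ≤ N) :
    ((N : ℝ) / 2) ^ j ≤ ((N - j).descFactorial j : ℝ) := by
  have h2 := Nat.pow_sub_le_descFactorial (N - j) j
  have h3 : ((N - j + 1 - j : ℕ) : ℝ) ^ j ≤ (N - j).descFactorial j := by exact_mod_cast h2
  refine le_trans ?_ h3
  gcongr
  have h4 : N ≤ 2 * (N - j + 1 - j) := by omega
  have h5 : (N : ℝ) ≤ 2 * (N - j + 1 - j : ℕ) := by exact_mod_cast h4
  linarith

open Classical in
theorem card_hasLargeEigen_le (hr : 1 ≤ r) (s : ℝ) (hs : 1 ≤ s) (hs2 : s ^ 2 = 2 * r - 1)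
    (ε κ : ℝ) (hκ : 0 < κ) (n : ℕ) (g : ℝ[X]) (hg : g.natDegree ≤ 2 * n)
    (hg1 : ∀ x : ℝ, |x| ≤ 2 * r → |g.eval x| ≤ 1)
    (hg2 : ∀ x : ℝ, |x| ≤ 2 * r → |x| ≤ 2 * s → |g.eval x| ≤ κ ^ n)
    (hg3 : ∀ x : ℝ, |x| ≤ 2 * r → 2 * s + ε ≤ |x| → 1 / 2 ≤ |g.eval x|)
    (hδ : 4 * (4 * n + 1 : ℝ) ^ 4 * κ ^ (2 * n) ≤ 1) (N j d : ℕ) (hj : 1 ≤ j)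
    (hd : r * (j * (4 * n + 1)) + 1 ≤ d) (hN : 8 * d ^ 8 ≤ N) :
    (#(univ.filter fun σ : Fin r → Equiv.Perm (Fin N) => HasLargeEigen (2 * s + ε) N j σ) : ℝ) ≤
      (N.factorial : ℝ) ^ r * (512 * (d : ℝ) ^ 9 / N +
        4 * (4 * (4 * n + 1 : ℝ) ^ 4 * κ ^ (2 * n)) * (2 * N) ^ j) := by
  have hr' : (1:ℝ) ≤ r := by exact_mod_cast hr
  have hsr : s ≤ r := by nlinarith
  have hdeg : (g ^ 2).natDegree ≤ 4 * n := natDegree_pow_le.trans (by omega)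
  obtain ⟨a, ha, hA⟩ := exists_sphere_expansion r s hs hs2 (4 * n) (g ^ 2) hdeg (κ ^ (2 * n))
    (fun x hx => by
      rw [eval_pow, abs_pow, mul_comm 2 n, pow_mul]
      exact pow_le_pow_left₀ (abs_nonneg _) (hg2 x (hx.trans (by linarith)) hx) 2)
  push_cast at ha
  obtain ⟨δ, hδe⟩ : ∃ δ : ℝ, δ = 4 * (4 * n + 1 : ℝ) ^ 4 * κ ^ (2 * n) := ⟨_, rfl⟩
  have hδ0 : 0 ≤ δ := by rw [hδe]; positivity
  have hd1 : 1 ≤ d := by omega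
  have hd8 : d ≤ d ^ 8 := Nat.le_self_pow (by norm_num) d
  have hd48 : d ^ 4 ≤ d ^ 8 := Nat.pow_le_pow_right hd1 (by norm_num)
  have hjd : j ≤ d := by
    have h1 : j * 1 ≤ r * (j * (4 * n + 1)) := by
      calc j * 1 ≤ j * (4 * n + 1) := Nat.mul_le_mul_left _ (by omega)
        _ ≤ _ := Nat.le_mul_of_pos_left _ (by omega)
    omega
  have hNpos : (0:ℝ) < N := by exact_mod_cast (by omega : 0 < N)
  have hsum := sum_qSum_le hr s hs hs2 j (4 * n) a (κ ^ (2 * n)) (by positivity)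
    (by push_cast; exact ha) (by push_cast; exact hδ)
    (fun N σ => qSum_nonneg a (4 * n) g hA σ) (fun N σ => qSum_le a (4 * n) g hg1 hA σ) N
    (by
      have : (r * (j * (4 * n + 1)) + 1) ^ 4 ≤ d ^ 4 := Nat.pow_le_pow_left hd 4
      omega)
  push_cast at hsum
  rw [← hδe] at hsum ⊢
  have hlow : ∀ σ ∈ univ.filter (fun σ : Fin r → Equiv.Perm (Fin N) =>
      HasLargeEigen (2 * s + ε) N j σ), (1 / 4) * ((N : ℝ) / 2) ^ j ≤ qSum j a (4 * n) σ := by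
    intro σ hσ
    obtain ⟨f, t, hf0, hf, ht, hft⟩ := (mem_filter.1 hσ).2
    refine le_trans ?_ (le_qSum a (4 * n) g hA σ f hf0 hf t hft)
    rw [Fintype.card_fin]
    have h1 := hg3 t (adjR_eigenvalue_le σ t f hf0 hft) ht.le
    have h2 : (1:ℝ) / 4 ≤ g.eval t ^ 2 := by
      rw [← sq_abs]; nlinarith
    exact mul_le_mul h2 (half_pow_le_descFactorial N j (by omega)) (by positivity) (by positivity)
  have h3 : (#(univ.filter fun σ : Fin r → Equiv.Perm (Fin N) =>
      HasLargeEigen (2 * s + ε) N j σ) : ℝ) * ((1 / 4) * ((N : ℝ) / 2) ^ j) ≤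
      ∑ σ : Fin r → Equiv.Perm (Fin N), qSum j a (4 * n) σ := by
    rw [← nsmul_eq_mul]
    refine (card_nsmul_le_sum _ _ _ hlow).trans ?_
    exact sum_le_sum_of_subset_of_nonneg (filter_subset _ _)
      fun σ _ _ => qSum_nonneg a (4 * n) g hA σ
  have h4 : (0:ℝ) < (1 / 4) * ((N : ℝ) / 2) ^ j := by positivity
  refine le_of_mul_le_mul_right (h3.trans (hsum.trans ?_)) h4
  rw [mul_assoc ((N.factorial : ℝ) ^ r)]
  refine mul_le_mul_of_nonneg_left ?_ (by positivity)
  have hdr : ((r : ℝ) * (j * (4 * n + 1)) + 1) ≤ d := by exact_mod_cast hd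
  obtain ⟨y, hy⟩ : ∃ y : ℝ, y = 8 * (d : ℝ) ^ 8 / N := ⟨_, rfl⟩
  have hy0 : 0 ≤ y := by rw [hy]; positivity
  have hy1 : y ≤ 1 := by
    rw [hy, div_le_one hNpos]; exact_mod_cast hN
  have hyj : y ^ j ≤ y := by
    calc y ^ j ≤ y ^ 1 := pow_le_pow_of_le_one hy0 hy1 hj
      _ = y := pow_one y
  have h5 : (2 * (d : ℝ) ^ 4) ^ (2 * j) = y ^ j * ((N : ℝ) / 2) ^ j := by
    rw [pow_mul, ← mul_pow]
    congr 1
    rw [hy]; field_simp; ring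
  have h6 : (N : ℝ) ^ (2 * j) = (2 * N) ^ j * ((N : ℝ) / 2) ^ j := by
    rw [pow_mul, ← mul_pow]
    congr 1
    ring
  calc _ ≤ 16 * (d : ℝ) * (2 * (d : ℝ) ^ 4) ^ (2 * j) + δ * (N : ℝ) ^ (2 * j) := by gcongr
    _ = 16 * (d : ℝ) * (y ^ j * ((N : ℝ) / 2) ^ j) + δ * ((2 * N) ^ j * ((N : ℝ) / 2) ^ j) := by
      rw [h5, h6]
    _ ≤ 16 * (d : ℝ) * (y * ((N : ℝ) / 2) ^ j) + δ * ((2 * N) ^ j * ((N : ℝ) / 2) ^ j) := by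
      gcongr
    _ = _ := by rw [hy]; ring

open Classical in
theorem card_restNormC_gt_le (hr : 1 ≤ r) (s : ℝ) (hs : 1 ≤ s) (hs2 : s ^ 2 = 2 * r - 1)
    (ε κ : ℝ) (hε : 0 < ε) (hκ : 0 < κ) (n : ℕ) (g : ℝ[X]) (hg : g.natDegree ≤ 2 * n)
    (hg1 : ∀ x : ℝ, |x| ≤ 2 * r → |g.eval x| ≤ 1)
    (hg2 : ∀ x : ℝ, |x| ≤ 2 * r → |x| ≤ 2 * s → |g.eval x| ≤ κ ^ n)
    (hg3 : ∀ x : ℝ, |x| ≤ 2 * r → 2 * s + ε ≤ |x| → 1 / 2 ≤ |g.eval x|)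
    (hδ : 4 * (4 * n + 1 : ℝ) ^ 4 * κ ^ (2 * n) ≤ 1) (N k d : ℕ)
    (hd : r * (k * (4 * n + 1)) + 1 ≤ d) (hN : 8 * d ^ 8 ≤ N) :
    (#(univ.filter fun σ : Fin r → Equiv.Perm (Fin N) => 2 * s + ε < restNormC (∑ i : Fin r,
      (actMat (N := N) (k := k) (σ i) + actMat (N := N) (k := k) (σ i)⁻¹))) : ℝ) ≤
      (N.factorial : ℝ) ^ r * (512 * (d : ℝ) ^ 10 / N +
        16 * (d : ℝ) * (4 * n + 1 : ℝ) ^ 4 * κ ^ (2 * n) * (2 * N) ^ k) := by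
  have hkd : k ≤ d := by
    have h1 : k * 1 ≤ r * (k * (4 * n + 1)) := by
      calc k * 1 ≤ k * (4 * n + 1) := Nat.mul_le_mul_left _ (by omega)
        _ ≤ _ := Nat.le_mul_of_pos_left _ (by omega)
    omega
  have hd1 : 1 ≤ d := by omega
  have hN1 : (1:ℝ) ≤ N := by
    have : 0 < d ^ 8 := by positivity
    exact_mod_cast (by omega : 1 ≤ N)
  have h1 : (univ.filter fun σ : Fin r → Equiv.Perm (Fin N) => 2 * s + ε < restNormC (∑ i : Fin r,
      (actMat (N := N) (k := k) (σ i) + actMat (N := N) (k := k) (σ i)⁻¹))) ⊆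
      (Icc 1 k).biUnion fun j => univ.filter fun σ : Fin r → Equiv.Perm (Fin N) =>
        HasLargeEigen (2 * s + ε) N j σ := by
    intro σ hσ
    obtain ⟨j, h1, h2, h3⟩ := exists_eigen_of_lt_restNormC σ (2 * s + ε) (by linarith)
      (mem_filter.1 hσ).2
    exact mem_biUnion.2 ⟨j, mem_Icc.2 ⟨h1, h2⟩, mem_filter.2 ⟨mem_univ _, h3⟩⟩
  have h2 : ∀ j ∈ Icc 1 k, (#(univ.filter fun σ : Fin r → Equiv.Perm (Fin N) =>
      HasLargeEigen (2 * s + ε) N j σ) : ℝ) ≤ (N.factorial : ℝ) ^ r * (512 * (d : ℝ) ^ 9 / N +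
        4 * (4 * (4 * n + 1 : ℝ) ^ 4 * κ ^ (2 * n)) * (2 * N) ^ k) := by
    intro j hj
    obtain ⟨hj1, hj2⟩ := mem_Icc.1 hj
    refine (card_hasLargeEigen_le hr s hs hs2 ε κ hκ n g hg hg1 hg2 hg3 hδ N j d hj1
      (le_trans ?_ hd) hN).trans ?_
    · gcongr
    · gcongr
      linarith
  have h3 : (#((Icc 1 k).biUnion fun j => univ.filter fun σ : Fin r → Equiv.Perm (Fin N) =>
        HasLargeEigen (2 * s + ε) N j σ) : ℝ) ≤ ∑ j ∈ Icc 1 k,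
        (#(univ.filter fun σ : Fin r → Equiv.Perm (Fin N) =>
          HasLargeEigen (2 * s + ε) N j σ) : ℝ) := by
    exact_mod_cast card_biUnion_le
  refine (Nat.cast_le.2 (card_le_card h1)).trans (h3.trans ((sum_le_sum h2).trans ?_))
  rw [sum_const, Nat.card_Icc, Nat.add_sub_cancel, nsmul_eq_mul]
  have hkd' : (k : ℝ) ≤ d := by exact_mod_cast hkd
  refine (mul_le_mul_of_nonneg_right hkd' (by positivity)).trans (le_of_eq ?_)
  ring

end

end

section

open Finset Filter

noncomputable section

theorem tendsto_mul_exp_neg_rpow (c : ℝ) (hc : 0 < c) :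
    Tendsto (fun N : ℕ => (N : ℝ) * Real.exp (-c * (N : ℝ) ^ ((1 : ℝ) / 20))) atTop (nhds 0) := by
  have h1 := (tendsto_rpow_mul_exp_neg_mul_atTop_nhds_zero 20 c hc).comp
    ((tendsto_rpow_atTop (by norm_num : (0:ℝ) < 1 / 20)).comp
      (tendsto_natCast_atTop_atTop (R := ℝ)))
  refine h1.congr fun N => ?_
  simp only [Function.comp]
  rw [← Real.rpow_mul (Nat.cast_nonneg N)]
  norm_num

theorem eventually_log_two_mul_le (c : ℝ) (hc : 0 < c) :
    ∀ᶠ N : ℕ in atTop, Real.log (2 * (N : ℝ)) ≤ c * (N : ℝ) ^ ((1 : ℝ) / 420) := by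
  have h1 := ((isLittleO_log_rpow_atTop (by norm_num : (0:ℝ) < 1 / 420)).bound
    (by positivity : 0 < c / 2))
  have h2 := (tendsto_natCast_atTop_atTop (R := ℝ)).eventually h1
  filter_upwards [h2, eventually_ge_atTop 2] with N hN hN2
  have hN2' : (2:ℝ) ≤ N := by exact_mod_cast hN2
  rw [Real.norm_eq_abs, Real.norm_eq_abs, abs_of_nonneg (Real.log_nonneg (by linarith)),
    abs_of_nonneg (by positivity)] at hN
  rw [Real.log_mul (by norm_num) (by linarith)]
  have := Real.log_le_log (by norm_num) hN2'
  linarith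

/-- The number of coordinates explored is at most a constant times `N ^ (41 / 420)`. -/
theorem exploration_le (r k n : ℕ) (x : ℝ) (hr : 1 ≤ r) (hx : 1 ≤ x)
    (hk : (k : ℝ) ≤ x ^ ((1 : ℝ) / 21)) (hn : (n : ℝ) ≤ 2 * x ^ ((1 : ℝ) / 20)) :
    (4 * n + 1 : ℝ) ≤ 9 * x ^ ((1 : ℝ) / 20) ∧
    ((r * (k * (4 * n + 1)) + 1 : ℕ) : ℝ) ≤ 10 * r * x ^ ((41 : ℝ) / 420) := by
  have hr' : (1:ℝ) ≤ r := by exact_mod_cast hr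
  have h1 : 1 ≤ x ^ ((1 : ℝ) / 20) := Real.one_le_rpow hx (by norm_num)
  have h2 : 1 ≤ x ^ ((41 : ℝ) / 420) := Real.one_le_rpow hx (by norm_num)
  have h3 : (4 * n + 1 : ℝ) ≤ 9 * x ^ ((1 : ℝ) / 20) := by linarith
  refine ⟨h3, ?_⟩
  have h4 : x ^ ((1 : ℝ) / 21) * x ^ ((1 : ℝ) / 20) = x ^ ((41 : ℝ) / 420) := by
    rw [← Real.rpow_add (by linarith)]; norm_num
  push_cast
  calc (r : ℝ) * (k * (4 * n + 1)) + 1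
      ≤ r * (x ^ ((1 : ℝ) / 21) * (9 * x ^ ((1 : ℝ) / 20))) + 1 := by gcongr
    _ = 9 * (r * x ^ ((41 : ℝ) / 420)) + 1 := by rw [← h4]; ring
    _ ≤ _ := by nlinarith

theorem rate_le (r k n : ℕ) (x κ c : ℝ) (hr : 1 ≤ r) (hx : 1 ≤ x) (hκ : κ = Real.exp (-c))
    (hc : 0 < c) (hk : (k : ℝ) ≤ x ^ ((1 : ℝ) / 21)) (hn : (n : ℝ) ≤ 2 * x ^ ((1 : ℝ) / 20))
    (hn' : x ^ ((1 : ℝ) / 20) ≤ n) (hlog : Real.log (2 * x) ≤ c * x ^ ((1 : ℝ) / 420)) :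
    16 * ((r * (k * (4 * n + 1)) + 1 : ℕ) : ℝ) * (4 * n + 1 : ℝ) ^ 4 * κ ^ (2 * n) * (2 * x) ^ k ≤
      16 * (10 * r) * 9 ^ 4 * (x * Real.exp (-c * x ^ ((1 : ℝ) / 20))) := by
  obtain ⟨h1, h2⟩ := exploration_le r k n x hr hx hk hn
  have hx0 : 0 < x := by linarith
  have h3 : κ ^ (2 * n) * (2 * x) ^ k ≤ Real.exp (-c * x ^ ((1 : ℝ) / 20)) := by
    have e1 : (2 * x) ^ k = Real.exp (k * Real.log (2 * x)) := by
      rw [Real.exp_nat_mul, Real.exp_log (by linarith)]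
    rw [hκ, e1, ← Real.exp_nat_mul, ← Real.exp_add, Real.exp_le_exp]
    have h4 : x ^ ((1 : ℝ) / 21) * x ^ ((1 : ℝ) / 420) = x ^ ((1 : ℝ) / 20) := by
      rw [← Real.rpow_add hx0]; norm_num
    have h5 : (k : ℝ) * Real.log (2 * x) ≤ c * x ^ ((1 : ℝ) / 20) := by
      calc (k : ℝ) * Real.log (2 * x) ≤ x ^ ((1 : ℝ) / 21) * (c * x ^ ((1 : ℝ) / 420)) := by
            have : 0 ≤ Real.log (2 * x) := Real.log_nonneg (by linarith)
            gcongr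
        _ = _ := by rw [← h4]; ring
    push_cast
    nlinarith
  have h6 : x ^ ((41 : ℝ) / 420) * (x ^ ((1 : ℝ) / 20)) ^ 4 ≤ x := by
    rw [← Real.rpow_mul_natCast hx0.le, ← Real.rpow_add hx0]
    calc _ ≤ x ^ (1:ℝ) := Real.rpow_le_rpow_of_exponent_le hx (by norm_num)
      _ = x := Real.rpow_one x
  have hκ0 : 0 < κ := by rw [hκ]; positivity
  calc _ = 16 * ((r * (k * (4 * n + 1)) + 1 : ℕ) : ℝ) * (4 * n + 1 : ℝ) ^ 4 *
        (κ ^ (2 * n) * (2 * x) ^ k) := by ring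
    _ ≤ 16 * (10 * r * x ^ ((41 : ℝ) / 420)) * (9 * x ^ ((1 : ℝ) / 20)) ^ 4 *
        Real.exp (-c * x ^ ((1 : ℝ) / 20)) := by gcongr
    _ = 16 * (10 * r) * 9 ^ 4 * ((x ^ ((41 : ℝ) / 420) * (x ^ ((1 : ℝ) / 20)) ^ 4) *
        Real.exp (-c * x ^ ((1 : ℝ) / 20))) := by ring
    _ ≤ _ := by gcongr

theorem exploration_pow_le (r : ℕ) (d : ℕ) (m : ℕ) (x : ℝ) (hx : 1 ≤ x) 
    (hd : (d : ℝ) ≤ 10 * r * x ^ ((41 : ℝ) / 420)) (hm : m ≤ 10) :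
    (d : ℝ) ^ m / x ≤ (10 * r) ^ m * x ^ (-(1 : ℝ) / 42) := by
  have hx0 : 0 < x := by linarith
  rw [div_le_iff₀ hx0]
  have hm' : (m : ℝ) ≤ 10 := by exact_mod_cast hm
  calc (d : ℝ) ^ m ≤ (10 * r * x ^ ((41 : ℝ) / 420)) ^ m := by gcongr
    _ = (10 * r) ^ m * x ^ ((41 : ℝ) / 420 * m) := by
      rw [mul_pow, Real.rpow_mul_natCast hx0.le]
    _ ≤ (10 * r) ^ m * x ^ (-(1 : ℝ) / 42 + 1) := by
      gcongr
      · linarith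
    _ = _ := by rw [Real.rpow_add_one hx0.ne']; ring

open Classical in
/-- Lower and upper bounds combine to control the proportion of permutations with a large
deviation of the restricted norm. -/
theorem natCard_deviation_div_le {r : ℕ} (s ε : ℝ) (N k : ℕ) (δ : ℝ)
    (hlow : ∀ σ : Fin r → Equiv.Perm (Fin N), 2 * s - ε ≤ restNormC (∑ i : Fin r,
      (actMat (N := N) (k := k) (σ i) + actMat (N := N) (k := k) (σ i)⁻¹)))
    (hup : (#(univ.filter fun σ : Fin r → Equiv.Perm (Fin N) => 2 * s + ε < restNormC
      (∑ i : Fin r, (actMat (N := N) (k := k) (σ i) + actMat (N := N) (k := k) (σ i)⁻¹))) : ℝ) ≤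
      (N.factorial : ℝ) ^ r * δ) :
    (Nat.card {σ : Fin r → Equiv.Perm (Fin N) //
        ε < |restNormC (∑ i : Fin r,
          (actMat (N := N) (k := k) (σ i) + actMat (N := N) (k := k) (σ i)⁻¹)) - 2 * s|} : ℝ) /
      (Nat.card (Fin r → Equiv.Perm (Fin N)) : ℝ) ≤ δ := by
  have hF : (0:ℝ) < (N.factorial : ℝ) ^ r := by positivity
  rw [Nat.card_eq_fintype_card, Nat.card_eq_fintype_card, card_perm_tuple, div_le_iff₀ hF,
    Fintype.card_subtype, mul_comm δ]
  refine le_trans (Nat.cast_le.2 (card_le_card fun σ hσ => ?_)) hup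
  rw [mem_filter] at hσ ⊢
  refine ⟨mem_univ _, ?_⟩
  have h1 := hlow σ
  rcases lt_abs.1 hσ.2 with h | h <;> linarith

end

end

open Filter

/-- **Cassidy's theorem on random Schreier graphs**: optimal spectral gap of the Schreier graphs
of the action of random permutations on tuples of `k_N ≤ N^{1/21}` distinct points. -/
theorem random_schreier_optimal_gap (r : ℕ) (hr : 1 ≤ r) (k : ℕ → ℕ)
    (hk : ∀ᶠ N in Filter.atTop, 1 ≤ k N ∧ (k N : ℝ) ≤ (N : ℝ) ^ ((1 : ℝ) / 21))
    (ε : ℝ) (hε : 0 < ε) :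
    Tendsto
      (fun N =>
        (Nat.card {σ : Fin r → Equiv.Perm (Fin N) //
            ε < |restNormC (∑ i : Fin r,
                    (actMat (N := N) (k := k N) (σ i) + actMat (N := N) (k := k N) (σ i)⁻¹)) -
                  2 * Real.sqrt (2 * r - 1)|} : ℝ) /
          (Nat.card (Fin r → Equiv.Perm (Fin N)) : ℝ))
      atTop (nhds 0) := by
  have hr' : (1:ℝ) ≤ r := by exact_mod_cast hr
  obtain ⟨s, hsdef⟩ : ∃ s, s = Real.sqrt (2 * r - 1) := ⟨_, rfl⟩
  have hs : 1 ≤ s := by rw [hsdef, Real.one_le_sqrt]; linarith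
  have hs2 : s ^ 2 = 2 * r - 1 := by rw [hsdef, Real.sq_sqrt]; linarith
  rw [← hsdef]
  obtain ⟨κ, hκ0, hκ1, n0, hstep⟩ := exists_step_poly (2 * r) (2 * s) ε (by linarith) hε
    (by linarith)
  obtain ⟨N0, hlow⟩ := exists_le_restNormC r hr s (by linarith) hs2 ε hε
  obtain ⟨c, hcdef⟩ : ∃ c, c = -Real.log κ := ⟨_, rfl⟩
  have hc : 0 < c := by rw [hcdef]; linarith [Real.log_neg hκ0 hκ1]
  have hκc : κ = Real.exp (-c) := by rw [hcdef, neg_neg, Real.exp_log hκ0]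
  have hcast := tendsto_natCast_atTop_atTop (R := ℝ)
  have hneg : Tendsto (fun N : ℕ => (N : ℝ) ^ (-(1 : ℝ) / 42)) atTop (nhds 0) := by
    have := (tendsto_rpow_neg_atTop (by norm_num : (0:ℝ) < 1 / 42)).comp hcast
    simpa only [Function.comp_def, neg_div] using this
  have hexp := (tendsto_mul_exp_neg_rpow c hc).const_mul (16 * (10 * (r : ℝ)) * 9 ^ 4)
  have hlim : Tendsto (fun N : ℕ => 512 * ((10 * (r : ℝ)) ^ 10 * (N : ℝ) ^ (-(1 : ℝ) / 42)) +
      16 * (10 * (r : ℝ)) * 9 ^ 4 * ((N : ℝ) * Real.exp (-c * (N : ℝ) ^ ((1 : ℝ) / 20))))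
      atTop (nhds 0) := by
    simpa using ((hneg.const_mul ((10 * (r : ℝ)) ^ 10)).const_mul 512).add hexp
  have hpow8 : Tendsto (fun N : ℕ => 8 * ((10 * (r : ℝ)) ^ 8 * (N : ℝ) ^ (-(1 : ℝ) / 42)))
      atTop (nhds 0) := by
    simpa using (hneg.const_mul ((10 * (r : ℝ)) ^ 8)).const_mul 8
  have hexp' : ∀ᶠ N : ℕ in atTop,
      16 * (10 * (r : ℝ)) * 9 ^ 4 * ((N : ℝ) * Real.exp (-c * (N : ℝ) ^ ((1 : ℝ) / 20))) ≤ 1 :=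
    hexp.eventually_le_const (by simp)
  have hn0 : ∀ᶠ N : ℕ in atTop, (n0 : ℝ) ≤ (N : ℝ) ^ ((1 : ℝ) / 20) :=
    ((tendsto_rpow_atTop (by norm_num : (0:ℝ) < 1 / 20)).comp hcast).eventually_ge_atTop _
  refine squeeze_zero' (Eventually.of_forall fun N => by positivity) ?_ hlim
  filter_upwards [hk, eventually_ge_atTop N0, eventually_ge_atTop 1,
    eventually_log_two_mul_le c hc, hpow8.eventually_le_const zero_lt_one, hexp', hn0]
    with N hkN hN0 hN1 hlog h8 he hn0
  have hx : (1:ℝ) ≤ N := by exact_mod_cast hN1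
  have hy : 1 ≤ (N : ℝ) ^ ((1 : ℝ) / 20) := Real.one_le_rpow hx (by norm_num)
  obtain ⟨n, hn⟩ : ∃ n, n = ⌈(N : ℝ) ^ ((1 : ℝ) / 20)⌉₊ := ⟨_, rfl⟩
  have hnl : (N : ℝ) ^ ((1 : ℝ) / 20) ≤ n := by rw [hn]; exact Nat.le_ceil _
  have hnu : (n : ℝ) ≤ 2 * (N : ℝ) ^ ((1 : ℝ) / 20) := by
    have := (Nat.ceil_lt_add_one (by linarith : 0 ≤ (N : ℝ) ^ ((1 : ℝ) / 20))).le
    rw [← hn] at this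
    linarith
  obtain ⟨g, hg, hg1, hg2, hg3⟩ := hstep n (by exact_mod_cast hn0.trans hnl)
  obtain ⟨h4n, hd⟩ := exploration_le r (k N) n N hr hx hkN.2 hnu
  have hrate := rate_le r (k N) n N κ c hr hx hκc hc hkN.2 hnu hnl hlog
  have h10 := exploration_pow_le r _ 10 N hx hd le_rfl
  have h8' := exploration_pow_le r _ 8 N hx hd (by norm_num)
  obtain ⟨d, hdd⟩ : ∃ d, d = r * (k N * (4 * n + 1)) + 1 := ⟨_, rfl⟩
  rw [← hdd] at hd hrate h10 h8'
  have hN8 : 8 * d ^ 8 ≤ N := by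
    have h : (d : ℝ) ^ 8 / N ≤ 1 / 8 := by linarith
    rw [div_le_iff₀ (by linarith)] at h
    have h' : (8 * (d : ℝ) ^ 8) ≤ N := by linarith
    exact_mod_cast h'
  have hδ : 4 * (4 * n + 1 : ℝ) ^ 4 * κ ^ (2 * n) ≤ 1 := by
    refine le_trans ?_ (hrate.trans he)
    have hd1 : (1:ℝ) ≤ d := by exact_mod_cast (by omega : 1 ≤ d)
    have hp : (1:ℝ) ≤ (2 * N) ^ k N := one_le_pow₀ (by linarith)
    obtain ⟨z, hz⟩ : ∃ z : ℝ, z = (4 * n + 1 : ℝ) ^ 4 * κ ^ (2 * n) := ⟨_, rfl⟩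
    have hz0 : 0 ≤ z := by rw [hz]; positivity
    calc _ = 4 * 1 * z * 1 := by rw [hz]; ring
      _ ≤ 16 * d * z * (2 * N) ^ k N := by gcongr; norm_num
      _ = _ := by rw [hz]; ring
  have hkN' : k N ≤ N := by
    have h1 : (k N : ℝ) ≤ (N : ℝ) ^ (1 : ℝ) :=
      hkN.2.trans (Real.rpow_le_rpow_of_exponent_le hx (by norm_num))
    rw [Real.rpow_one] at h1
    exact_mod_cast h1
  refine natCard_deviation_div_le s ε N (k N) _ (hlow N hN0 (k N) hkN.1 hkN') ?_
  refine (card_restNormC_gt_le hr s hs hs2 ε κ hε hκ0 n g hg hg1 hg2 hg3 hδ N (k N) d hdd.ge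
    hN8).trans (mul_le_mul_of_nonneg_left ?_ (by positivity))
  rw [mul_div_assoc]
  exact add_le_add (by linarith) hrate
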